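/- For every integer n ≥ 6, every planar simple graph G on n vertices that contains no member of Θ₆ as a subgraph (i.e., no subgraph isomorphic to a 6-cycle with a chord joining two non-consecutive vertices) satisfies e(G) ≤ 18(n−2)/7. In particular, ex_P(n, Θ₆) ≤ 18(n−2)/7 for all n ≥ 6. -/

import Mathlib

open SimpleGraph

/-- `G` has a planar embedding (drawing in the plane): vertices are mapped to distinct
points of `ℝ²`, each edge `uv` is drawn as a simple continuous arc from the point of `u`
to the point of `v`, arcs traversed in opposite directions coincide, the interior of an
arc passes through no vertex point, and the interiors of arcs of distinct edges are
disjoint. -/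
def SimpleGraph.HasPlanarEmbedding {V : Type*} (G : SimpleGraph V) : Prop :=
  ∃ (pos : V → ℝ × ℝ) (arc : V → V → ℝ → ℝ × ℝ),
    Function.Injective pos ∧
    (∀ u v : V, G.Adj u v →
      ContinuousOn (arc u v) (Set.Icc (0 : ℝ) 1) ∧
      Set.InjOn (arc u v) (Set.Icc (0 : ℝ) 1) ∧
      arc u v 0 = pos u ∧
      arc u v 1 = pos v ∧
      (∀ t : ℝ, arc u v t = arc v u (1 - t)) ∧
      (∀ w : V, ∀ t ∈ Set.Ioo (0 : ℝ) 1, arc u v t ≠ pos w)) ∧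
    (∀ u v x y : V, G.Adj u v → G.Adj x y → s(u, v) ≠ s(x, y) →
      ∀ t₁ ∈ Set.Ioo (0 : ℝ) 1, ∀ t₂ ∈ Set.Ioo (0 : ℝ) 1, arc u v t₁ ≠ arc x y t₂)

/-- `G` contains a subgraph isomorphic to `F`, i.e. there is an injective graph
homomorphism from `F` to `G`. -/
def ContainsCopy {α β : Type*} (F : SimpleGraph α) (G : SimpleGraph β) : Prop :=
  ∃ f : F →g G, Function.Injective f

/-- The Theta graph on 4 vertices: the 4-cycle 0-1-2-3-0 plus the chord 02,
i.e. `K₄` minus one edge. -/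
def theta4 : SimpleGraph (Fin 4) :=
  SimpleGraph.fromEdgeSet {s(0, 1), s(1, 2), s(2, 3), s(0, 3), s(0, 2)}

/-- The Theta graph on 5 vertices: the 5-cycle 0-1-2-3-4-0 plus the chord 02. -/
def theta5 : SimpleGraph (Fin 5) :=
  SimpleGraph.fromEdgeSet {s(0, 1), s(1, 2), s(2, 3), s(3, 4), s(0, 4), s(0, 2)}

/-- The cycle on 6 vertices: 0-1-2-3-4-5-0. -/
def cycle6 : SimpleGraph (Fin 6) :=
  SimpleGraph.fromEdgeSet {s(0, 1), s(1, 2), s(2, 3), s(3, 4), s(4, 5), s(0, 5)}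

/-- `G` contains no member of `Θ₆` as a subgraph: for each pair of distinct
non-consecutive vertices `a`, `b` of the 6-cycle, `G` contains no copy of the Theta
graph obtained from the 6-cycle by adding the chord `ab`. -/
def Theta6Free {β : Type*} (G : SimpleGraph β) : Prop :=
  ∀ a b : Fin 6, a ≠ b → ¬ cycle6.Adj a b →
    ¬ ContainsCopy (cycle6 ⊔ SimpleGraph.fromEdgeSet {s(a, b)}) G

/-- `K₅⁻`: the complete graph on 5 vertices minus one edge. -/
def K5minus : SimpleGraph (Fin 5) :=
  (⊤ : SimpleGraph (Fin 5)).deleteEdges {s(0, 1)}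

section Winding

open unitInterval Complex

theorem exists_continuous_log_real_prod (f : C(ℝ × ℝ, ℂ)) (hf : ∀ a, f a ≠ 0) :
    ∃ l : C(ℝ × ℝ, ℂ), ∀ a, exp (l a) = f a := by
  obtain ⟨l, ⟨-, hl⟩, -⟩ := isCoveringMapOn_exp.existsUnique_continuousMap_lifts f
    (a₀ := (0, 0)) (exp_log (hf (0, 0))) (fun a ↦ hf a)
  exact ⟨l, fun a ↦ congrFun hl a⟩

theorem exists_continuous_log_square (f : C(I × I, ℂ)) (hf : ∀ a, f a ≠ 0) :
    ∃ l : C(I × I, ℂ), ∀ a, exp (l a) = f a := by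
  have h01 : (0 : ℝ) ≤ 1 := zero_le_one
  obtain ⟨l, hl⟩ := exists_continuous_log_real_prod
    ⟨fun x ↦ f (Set.projIcc 0 1 h01 x.1, Set.projIcc 0 1 h01 x.2), by fun_prop⟩ (fun a ↦ hf _)
  refine ⟨⟨fun x ↦ l (x.1, x.2), by fun_prop⟩, fun a ↦ ?_⟩
  have := hl (a.1, a.2)
  simpa using this

theorem exists_continuous_log_interval {f : I → ℂ} (hc : Continuous f) (hf : ∀ a, f a ≠ 0) :
    ∃ l : C(I, ℂ), ∀ a, exp (l a) = f a := by
  obtain ⟨l, hl⟩ := exists_continuous_log_square ⟨fun x ↦ f x.1, by fun_prop⟩ (fun a ↦ hf _)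
  exact ⟨⟨fun x ↦ l (x, 0), by fun_prop⟩, fun a ↦ hl (a, 0)⟩

/-- `n` counts, relative to the principal logarithm, the full turns around the origin made by a
continuous logarithm `l` of `f`. -/
def IsTurnCount (f : I → ℂ) (l : C(I, ℂ)) (n : ℤ) : Prop :=
  (∀ t, exp (l t) = f t) ∧ l 1 - log (f 1) - (l 0 - log (f 0)) = n * (2 * Real.pi * Complex.I)

open Classical in
/-- The parity of the number of turns around the origin of a path `f` in the punctured plane,
measured against the principal logarithms of its ends. -/
noncomputable def turnParity (f : I → ℂ) : ZMod 2 :=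
  if h : ∃ (n : ℤ) (l : C(I, ℂ)), IsTurnCount f l n then (h.choose : ZMod 2) else 0

theorem IsTurnCount.unique {f : I → ℂ} {l l' : C(I, ℂ)} {n n' : ℤ} (h : IsTurnCount f l n)
    (h' : IsTurnCount f l' n') : n = n' := by
  have hpi : (2 * Real.pi * Complex.I : ℂ) ≠ 0 := two_pi_I_ne_zero
  have key : ∀ t, ∃ m : ℤ, (l t - l' t) / (2 * Real.pi * Complex.I) = m := by
    intro t
    obtain ⟨m, hm⟩ := exp_eq_exp_iff_exists_int.1 ((h.1 t).trans (h'.1 t).symm)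
    exact ⟨m, by rw [hm]; field_simp; ring⟩
  choose m hm using key
  have hcont : Continuous fun t ↦ ((m t : ℤ) : ℝ) := by
    have : Continuous fun t ↦ ((l t - l' t) / (2 * Real.pi * Complex.I)).re := by fun_prop
    convert this using 2 with t
    rw [hm]; simp
  have hm' : Continuous m := Int.isClosedEmbedding_coe_real.isEmbedding.continuous_iff.2 hcont
  have hconst : m 1 = m 0 := PreconnectedSpace.constant inferInstance hm'
  have h1 := hm 1
  have h0 := hm 0
  rw [hconst] at h1
  rw [div_eq_iff hpi] at h1 h0
  have e := h.2
  have e' := h'.2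
  have : ((n : ℂ) - n') * (2 * Real.pi * Complex.I) = 0 := by
    linear_combination e' - e + h1 - h0
  rcases mul_eq_zero.1 this with h | h
  · exact_mod_cast sub_eq_zero.1 h
  · exact absurd h hpi

theorem IsTurnCount.turnParity_eq {f : I → ℂ} {l : C(I, ℂ)} {n : ℤ} (h : IsTurnCount f l n) :
    turnParity f = n := by
  have hex : ∃ (n : ℤ) (l : C(I, ℂ)), IsTurnCount f l n := ⟨n, l, h⟩
  rw [turnParity, dif_pos hex, hex.choose_spec.choose_spec.unique h]

theorem exists_isTurnCount_of_log {f : I → ℂ} {l : C(I, ℂ)} (h : ∀ t, exp (l t) = f t) :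
    ∃ n, IsTurnCount f l n := by
  have h' : ∀ t, ∃ m : ℤ, l t = log (f t) + m * (2 * Real.pi * Complex.I) := fun t ↦ by
    apply exp_eq_exp_iff_exists_int.1
    rw [h, exp_log]
    rw [← h]; exact exp_ne_zero _
  obtain ⟨a, ha⟩ := h' 1
  obtain ⟨b, hb⟩ := h' 0
  exact ⟨a - b, h, by rw [ha, hb]; push_cast; ring⟩

theorem exists_isTurnCount {f : I → ℂ} (hc : Continuous f) (hf : ∀ a, f a ≠ 0) :
    ∃ l n, IsTurnCount f l n := by
  obtain ⟨l, hl⟩ := exists_continuous_log_interval hc hf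
  exact ⟨l, exists_isTurnCount_of_log hl⟩

theorem turnParity_square (f : C(I × I, ℂ)) (hf : ∀ a, f a ≠ 0) :
    turnParity (fun s ↦ f (s, 0)) + turnParity (fun t ↦ f (1, t)) =
      turnParity (fun t ↦ f (0, t)) + turnParity (fun s ↦ f (s, 1)) := by
  obtain ⟨l, hl⟩ := exists_continuous_log_square f hf
  obtain ⟨a, ha⟩ := exists_isTurnCount_of_log (f := fun s ↦ f (s, 0))
    (l := ⟨fun s ↦ l (s, 0), by fun_prop⟩) (fun t ↦ hl _)
  obtain ⟨b, hb⟩ := exists_isTurnCount_of_log (f := fun t ↦ f (1, t))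
    (l := ⟨fun t ↦ l (1, t), by fun_prop⟩) (fun t ↦ hl _)
  obtain ⟨c, hc⟩ := exists_isTurnCount_of_log (f := fun t ↦ f (0, t))
    (l := ⟨fun t ↦ l (0, t), by fun_prop⟩) (fun t ↦ hl _)
  obtain ⟨d, hd⟩ := exists_isTurnCount_of_log (f := fun s ↦ f (s, 1))
    (l := ⟨fun s ↦ l (s, 1), by fun_prop⟩) (fun t ↦ hl _)
  rw [ha.turnParity_eq, hb.turnParity_eq, hc.turnParity_eq, hd.turnParity_eq]
  have e1 := ha.2
  have e2 := hb.2
  have e3 := hc.2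
  have e4 := hd.2
  simp only [ContinuousMap.coe_mk] at e1 e2 e3 e4
  have : ((a : ℂ) + b - c - d) * (2 * Real.pi * Complex.I) = 0 := by
    linear_combination e3 + e4 - e1 - e2
  rcases mul_eq_zero.1 this with h | h
  · have : a + b = c + d := by
      have h' : (a : ℂ) + b = c + d := by linear_combination h
      exact_mod_cast h'
    exact_mod_cast congrArg (Int.cast : ℤ → ZMod 2) this
  · exact absurd h two_pi_I_ne_zero

theorem turnParity_symm {f : I → ℂ} (hc : Continuous f) (hf : ∀ a, f a ≠ 0) :
    turnParity (fun t ↦ f (σ t)) = turnParity f := by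
  obtain ⟨l, n, h⟩ := exists_isTurnCount hc hf
  have h' : IsTurnCount (fun t ↦ f (σ t)) ⟨fun t ↦ l (σ t), by fun_prop⟩ (-n) := by
    refine ⟨fun t ↦ h.1 _, ?_⟩
    have := h.2
    simp only [ContinuousMap.coe_mk, symm_one, symm_zero]
    push_cast
    linear_combination -this
  rw [h.turnParity_eq, h'.turnParity_eq]
  push_cast
  exact CharTwo.neg_eq _

/-- Whether the argument of `z` drops by `π` when passing from `z` to `-z`. -/
noncomputable def upperParity (z : ℂ) : ZMod 2 := if 0 < z.arg then 1 else 0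

theorem upperParity_neg {z : ℂ} (hz : z ≠ 0) : upperParity (-z) = upperParity z + 1 := by
  unfold upperParity
  have h2 : (1 : ZMod 2) + 1 = 0 := by decide
  rcases lt_trichotomy z.im 0 with h | h | h
  · have h1 : z.arg < 0 := arg_neg_iff.2 h
    have := arg_neg_eq_arg_add_pi_of_im_neg h
    have := neg_pi_lt_arg z
    rw [if_pos (by linarith), if_neg (by linarith)]; simp
  · obtain ⟨x, y⟩ := z
    simp only at h
    subst h
    have hx : x ≠ 0 := fun h ↦ hz (by subst h; rfl)
    have e : (⟨x, 0⟩ : ℂ) = (x : ℂ) := rfl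
    rw [e, ← ofReal_neg]
    rcases lt_or_gt_of_ne hx with h | h
    · rw [arg_ofReal_of_nonneg (by linarith), arg_ofReal_of_neg h, if_pos Real.pi_pos]
      simp [h2]
    · rw [arg_ofReal_of_nonneg h.le, arg_ofReal_of_neg (by linarith), if_pos Real.pi_pos]
      simp
  · have h1 : 0 < z.arg := by
      rcases (arg_nonneg_iff.2 h.le).lt_or_eq with h' | h'
      · exact h'
      · exact absurd (arg_eq_zero_iff.1 h'.symm).2 h.ne'
    have := arg_neg_eq_arg_sub_pi_of_im_pos h
    have h3 : z.arg < Real.pi := by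
      refine lt_of_le_of_ne (arg_le_pi z) fun h' ↦ ?_
      exact h.ne' (arg_eq_pi_iff.1 h').2
    rw [if_neg (by linarith), if_pos h1, h2]

theorem log_neg_eq (z : ℂ) (hz : z ≠ 0) : ∃ n : ℤ, (n : ZMod 2) = upperParity z ∧
    log (-z) = log z + Real.pi * Complex.I - n * (2 * Real.pi * Complex.I) := by
  have key : (0 < z.arg → (-z).arg = z.arg - Real.pi) ∧
      (¬ 0 < z.arg → (-z).arg = z.arg + Real.pi) := by
    rcases lt_trichotomy z.im 0 with h | h | h
    · have h1 : z.arg < 0 := arg_neg_iff.2 h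
      exact ⟨fun h2 ↦ by linarith, fun _ ↦ arg_neg_eq_arg_add_pi_of_im_neg h⟩
    · obtain ⟨x, y⟩ := z
      simp only at h
      subst h
      have hx : x ≠ 0 := fun h ↦ hz (by subst h; rfl)
      have e : (⟨x, 0⟩ : ℂ) = (x : ℂ) := rfl
      rw [e, ← ofReal_neg]
      rcases lt_or_gt_of_ne hx with h | h
      · rw [arg_ofReal_of_neg h, arg_ofReal_of_nonneg (by linarith)]
        exact ⟨fun _ ↦ by ring, fun h2 ↦ absurd Real.pi_pos h2⟩
      · rw [arg_ofReal_of_nonneg h.le, arg_ofReal_of_neg (by linarith)]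
        exact ⟨fun h ↦ absurd h (lt_irrefl _), fun _ ↦ by ring⟩
    · have h1 : 0 ≤ z.arg := arg_nonneg_iff.2 h.le
      refine ⟨fun _ ↦ arg_neg_eq_arg_sub_pi_of_im_pos h, fun h2 ↦ ?_⟩
      have : z.arg = 0 := le_antisymm (not_lt.1 h2) h1
      exact absurd (arg_eq_zero_iff.1 this).2 h.ne'
  unfold upperParity
  by_cases h : 0 < z.arg
  · refine ⟨1, by simp [h], ?_⟩
    rw [log, log, key.1 h, norm_neg]; push_cast; ring
  · refine ⟨0, by simp [h], ?_⟩
    rw [log, log, key.2 h, norm_neg]; push_cast; ring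

theorem turnParity_neg {f : I → ℂ} (hc : Continuous f) (hf : ∀ a, f a ≠ 0) :
    turnParity (fun t ↦ -f t) = turnParity f + upperParity (f 0) + upperParity (f 1) := by
  obtain ⟨l, n, h⟩ := exists_isTurnCount hc hf
  obtain ⟨a, ha, ha'⟩ := log_neg_eq (f 0) (hf 0)
  obtain ⟨b, hb, hb'⟩ := log_neg_eq (f 1) (hf 1)
  have h' : IsTurnCount (fun t ↦ - f t) ⟨fun t ↦ l t + Real.pi * Complex.I, by fun_prop⟩
      (n - a + b) := by
    refine ⟨fun t ↦ ?_, ?_⟩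
    · simp only [ContinuousMap.coe_mk]
      rw [exp_add, h.1, exp_pi_mul_I]; ring
    · have := h.2
      simp only [ContinuousMap.coe_mk, ha', hb']
      push_cast
      linear_combination this
  rw [h.turnParity_eq, h'.turnParity_eq, ← ha, ← hb]
  push_cast
  rw [CharTwo.sub_eq_add]

theorem exists_turnParity_eq_of_halfPlane {d : ℂ} (hd : d ≠ 0) :
    ∃ g : ℂ → ZMod 2, ∀ f : I → ℂ, Continuous f → (∀ t, 0 < (f t / d).re) →
      turnParity f = g (f 0) + g (f 1) := by
  have key : ∀ z : ℂ, ∃ m : ℤ, 0 < (z / d).re →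
      log (z / d) + log d = log z + m * (2 * Real.pi * Complex.I) := by
    intro z
    by_cases hz : 0 < (z / d).re
    · have hz0 : z / d ≠ 0 := fun h ↦ by simp [h] at hz
      have hz1 : z ≠ 0 := fun h ↦ by simp [h] at hz
      obtain ⟨m, hm⟩ := exp_eq_exp_iff_exists_int.1
        (show exp (log (z / d) + log d) = exp (log z) by
          rw [exp_add, exp_log hz0, exp_log hd, exp_log hz1]; field_simp)
      exact ⟨m, fun _ ↦ hm⟩
    · exact ⟨0, fun h ↦ absurd h hz⟩
  choose m hm using key
  refine ⟨fun z ↦ (m z : ZMod 2), fun f hc hf ↦ ?_⟩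
  have h : IsTurnCount f ⟨fun t ↦ log (f t / d) + log d, by
      refine Continuous.add (Continuous.clog (by fun_prop) fun t ↦ Or.inl (hf t)) ?_
      fun_prop⟩ (m (f 1) - m (f 0)) := by
    refine ⟨fun t ↦ ?_, ?_⟩
    · have hz0 : f t / d ≠ 0 := fun h ↦ by simpa [h] using hf t
      simp only [ContinuousMap.coe_mk]
      rw [exp_add, exp_log hz0, exp_log hd]; field_simp
    · simp only [ContinuousMap.coe_mk]
      rw [hm _ (hf 1), hm _ (hf 0)]
      push_cast; ring
  rw [h.turnParity_eq]
  push_cast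
  rw [CharTwo.sub_eq_add, add_comm]

/-- The parity of the winding of a path `α` around a point `p`. -/
noncomputable def windParity (p : ℂ) {a b : ℂ} (α : _root_.Path a b) : ZMod 2 :=
  turnParity fun t ↦ α t - p

variable {a b c d p q u v : ℂ}

theorem windParity_symm (α : _root_.Path a b) (hp : p ∉ Set.range α) :
    windParity p α.symm = windParity p α := by
  simp only [windParity, Path.symm_apply]
  exact turnParity_symm (f := fun t ↦ α t - p) (by fun_prop)
    (fun t h ↦ hp ⟨t, sub_eq_zero.1 h⟩)

theorem windParity_refl : windParity p (Path.refl a) = 0 := by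
  have h : IsTurnCount (fun _ ↦ a - p) ⟨fun _ ↦ log (a - p), by fun_prop⟩ 0 ∨ a = p := by
    by_cases h : a = p
    · exact Or.inr h
    · exact Or.inl ⟨fun t ↦ exp_log (sub_ne_zero.2 h), by simp⟩
  rcases h with h | rfl
  · show turnParity (fun _ ↦ a - p) = 0
    simpa using h.turnParity_eq
  · show turnParity (fun _ ↦ a - a) = 0
    rw [turnParity, dif_neg]
    rintro ⟨n, l, h⟩
    have := h.1 0
    simp at this

/-- The affine map of the unit interval onto its first half. -/
noncomputable def firstHalf : C(I, I) :=
  ⟨fun t ↦ ⟨t / 2, by have := t.2.1; positivity, by have := t.2.2; linarith⟩, by fun_prop⟩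

/-- The affine map of the unit interval onto its second half. -/
noncomputable def secondHalf : C(I, I) :=
  ⟨fun t ↦ ⟨(1 + t) / 2, by have := t.2.1; positivity, by have := t.2.2; linarith⟩, by fun_prop⟩

theorem firstHalf_zero : firstHalf 0 = 0 := by ext; simp [firstHalf]

theorem firstHalf_one : firstHalf 1 = secondHalf 0 := by ext; simp [firstHalf, secondHalf]

theorem secondHalf_one : secondHalf 1 = 1 := by ext; simp [secondHalf]

theorem firstHalf_ne_one (t : I) : firstHalf t ≠ 1 := fun h ↦ by
  have := congrArg Subtype.val h
  have h2 := t.2.2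
  simp only [firstHalf, ContinuousMap.coe_mk, Set.Icc.coe_one] at this
  linarith

theorem secondHalf_ne_zero (t : I) : secondHalf t ≠ 0 := fun h ↦ by
  have := congrArg Subtype.val h
  have h2 := t.2.1
  simp only [secondHalf, ContinuousMap.coe_mk, Set.Icc.coe_zero] at this
  linarith

theorem symm_firstHalf_one : σ (firstHalf 1) = firstHalf 1 := by
  ext; simp only [firstHalf, ContinuousMap.coe_mk, coe_symm_eq, Set.Icc.coe_one]; norm_num

theorem windParity_eq_add_of_halves {γ : _root_.Path a c} {α : _root_.Path a b}
    {β : _root_.Path b c} (e₁ : ∀ t, γ (firstHalf t) = α t) (e₂ : ∀ t, γ (secondHalf t) = β t)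
    (hγ : p ∉ Set.range γ) : windParity p γ = windParity p α + windParity p β := by
  obtain ⟨l, n, h⟩ := exists_isTurnCount (f := fun t ↦ γ t - p) (by fun_prop)
    (fun t h ↦ hγ ⟨t, sub_eq_zero.1 h⟩)
  have h₁ := exists_isTurnCount_of_log (f := fun t ↦ α t - p) (l := l.comp firstHalf)
    (fun t ↦ by rw [ContinuousMap.comp_apply, h.1, ← e₁])
  have h₂ := exists_isTurnCount_of_log (f := fun t ↦ β t - p) (l := l.comp secondHalf)
    (fun t ↦ by rw [ContinuousMap.comp_apply, h.1, ← e₂])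
  obtain ⟨m, h₁⟩ := h₁
  obtain ⟨k, h₂⟩ := h₂
  have hn : n = m + k := by
    have E := h.2
    have E₁ := h₁.2
    have E₂ := h₂.2
    simp only [ContinuousMap.comp_apply, firstHalf_one, firstHalf_zero, secondHalf_one,
      Path.source, Path.target] at E E₁ E₂
    have : ((n : ℂ) - m - k) * (2 * Real.pi * Complex.I) = 0 := by
      linear_combination E₁ + E₂ - E
    rcases mul_eq_zero.1 this with h | h
    · have h' : (n : ℂ) = m + k := by linear_combination h
      exact_mod_cast h'
    · exact absurd h two_pi_I_ne_zero
  simp only [windParity]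
  rw [h.turnParity_eq, h₁.turnParity_eq, h₂.turnParity_eq, hn]
  push_cast; rfl

theorem windParity_trans (α : _root_.Path a b) (β : _root_.Path b c) (hα : p ∉ Set.range α)
    (hβ : p ∉ Set.range β) :
    windParity p (α.trans β) = windParity p α + windParity p β := by
  refine windParity_eq_add_of_halves (fun t ↦ ?_) (fun t ↦ ?_)
    (by rw [Path.trans_range]; exact fun h ↦ h.elim hα hβ)
  · rw [Path.trans_apply, dif_pos (by
      simp only [firstHalf, ContinuousMap.coe_mk]; linarith [t.2.2])]
    congr 1; ext; simp only [firstHalf, ContinuousMap.coe_mk]; ring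
  · rw [Path.trans_apply]
    split_ifs with ht
    · have h0 : t = 0 := by
        ext
        simp only [secondHalf, ContinuousMap.coe_mk] at ht
        exact le_antisymm (by simp only [Set.Icc.coe_zero]; linarith) t.2.1
      subst h0
      have : (⟨2 * ((secondHalf 0 : I) : ℝ), by simp [secondHalf]⟩ : I) = 1 := by
        ext; simp [secondHalf]
      simp only [this, Path.target, Path.source]
    · congr 1; ext; simp only [secondHalf, ContinuousMap.coe_mk]; ring

theorem exists_halves (γ : _root_.Path a b) :
    ∃ (α : _root_.Path a (γ (firstHalf 1))) (β : _root_.Path (γ (firstHalf 1)) b),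
      (∀ t, γ (firstHalf t) = α t) ∧ ∀ t, γ (secondHalf t) = β t :=
  ⟨⟨⟨fun t ↦ γ (firstHalf t), by fun_prop⟩, by simp [firstHalf_zero], rfl⟩,
    ⟨⟨fun t ↦ γ (secondHalf t), by fun_prop⟩, by simp [firstHalf_one], by simp [secondHalf_one]⟩,
    fun _ ↦ rfl, fun _ ↦ rfl⟩

theorem windParity_add_of_disjoint (α : _root_.Path a b) (β : _root_.Path c d)
    (h : Disjoint (Set.range α) (Set.range β)) :
    windParity c α + windParity d α + windParity a β + windParity b β =
      upperParity (c - a) + upperParity (d - a) + upperParity (c - b) + upperParity (d - b) := by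
  have hne : ∀ s t, α s ≠ β t := fun s t e ↦
    Set.disjoint_left.1 h ⟨s, rfl⟩ ⟨t, e.symm⟩
  have key := turnParity_square ⟨fun x ↦ α x.1 - β x.2, by fun_prop⟩
    (fun x ↦ sub_ne_zero.2 (hne _ _))
  have n1 := turnParity_neg (f := fun t ↦ β t - b) (by fun_prop)
    (fun t ↦ sub_ne_zero.2 (by simpa using (hne 1 t).symm))
  have n0 := turnParity_neg (f := fun t ↦ β t - a) (by fun_prop)
    (fun t ↦ sub_ne_zero.2 (by simpa using (hne 0 t).symm))
  simp only [ContinuousMap.coe_mk, Path.source, Path.target] at key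
  simp only [neg_sub, Path.source, Path.target] at n0 n1
  rw [n0, n1] at key
  have h2 : (2 : ZMod 2) = 0 := by decide
  simp only [windParity]
  linear_combination key + (turnParity (fun t ↦ α t - d) + turnParity (fun t ↦ β t - a)
    - upperParity (c - b) - upperParity (d - b)) * h2

theorem windParity_loop_eq (γ : _root_.Path p q) (α : _root_.Path a a)
    (h : Disjoint (Set.range γ) (Set.range α)) : windParity p α = windParity q α := by
  have := windParity_add_of_disjoint α γ h.symm
  have h2 : (2 : ZMod 2) = 0 := by decide
  linear_combination this + (- windParity a γ + upperParity (p - a) + upperParity (q - a) - windParity q α) * h2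

theorem theta_windParity_sum {x : Fin 3 → ℂ} (α : ∀ i, _root_.Path a (x i))
    (β : ∀ i, _root_.Path (x i) b)
    (h : ∀ i j, i ≠ j → Disjoint (Set.range (α i)) (Set.range (β j))) :
    ∑ i, ∑ j ∈ {j | j ≠ i}, (windParity (x i) (α j) + windParity (x i) (β j)) = 1 := by
  have hne : ∀ i j, i ≠ j → x j - x i ≠ 0 := fun i j hij e ↦
    Set.disjoint_left.1 (h i j hij) ⟨1, (α i).target⟩
      ⟨0, by rw [(β j).source]; exact sub_eq_zero.1 e⟩
  have key := fun i j (hij : i ≠ j) ↦ windParity_add_of_disjoint (α i) (β j) (h i j hij)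
  have hu : ∀ i j, i ≠ j → upperParity (x i - x j) = upperParity (x j - x i) + 1 :=
    fun i j hij ↦ by rw [← upperParity_neg (hne i j hij), neg_sub]
  have k01 := key 0 1 (by decide)
  have k02 := key 0 2 (by decide)
  have k12 := key 1 2 (by decide)
  have k10 := key 1 0 (by decide)
  have k20 := key 2 0 (by decide)
  have k21 := key 2 1 (by decide)
  have u01 := hu 0 1 (by decide)
  have u02 := hu 0 2 (by decide)
  have u12 := hu 1 2 (by decide)
  have s0 : (Finset.univ.filter fun j : Fin 3 ↦ j ≠ 0) = {1, 2} := by decide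
  have s1 : (Finset.univ.filter fun j : Fin 3 ↦ j ≠ 1) = {0, 2} := by decide
  have s2 : (Finset.univ.filter fun j : Fin 3 ↦ j ≠ 2) = {0, 1} := by decide
  have h2 : (2 : ZMod 2) = 0 := by decide
  rw [Fin.sum_univ_three, s0, s1, s2]
  simp only [Finset.sum_pair (show (1 : Fin 3) ≠ 2 by decide),
    Finset.sum_pair (show (0 : Fin 3) ≠ 2 by decide),
    Finset.sum_pair (show (0 : Fin 3) ≠ 1 by decide)]
  rw [u01] at k10
  rw [u02] at k20
  rw [u12] at k21
  generalize upperParity (b - a) = U at *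
  linear_combination k01 + k02 + k12 + k10 + k20 + k21 + (3 * U + 1
    - (windParity b (α 0) + windParity b (α 1) + windParity b (α 2))
    - (windParity a (β 0) + windParity a (β 1) + windParity a (β 2))
    + (upperParity (x 0 - a) + upperParity (x 1 - a) + upperParity (x 2 - a))
    + (upperParity (b - x 0) + upperParity (b - x 1) + upperParity (b - x 2))
    + (upperParity (x 1 - x 0) + upperParity (x 2 - x 0) + upperParity (x 2 - x 1))) * h2

/-- The loop running along `γ` and back along `δ`. -/
noncomputable def roundTrip (γ δ : _root_.Path a b) : _root_.Path a a := γ.trans δ.symm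

theorem range_roundTrip (γ δ : _root_.Path a b) :
    Set.range (roundTrip γ δ) = Set.range γ ∪ Set.range δ := by
  rw [roundTrip, Path.trans_range, Path.symm_range]

theorem windParity_roundTrip {γ δ : _root_.Path a b} (hγ : p ∉ Set.range γ)
    (hδ : p ∉ Set.range δ) :
    windParity p (roundTrip γ δ) = windParity p γ + windParity p δ := by
  rw [roundTrip, windParity_trans _ _ hγ (by rwa [Path.symm_range]), windParity_symm _ hδ]

theorem exists_windParity_eq_zero_of_pos (γ : Fin 3 → _root_.Path a b) (x : Fin 3 → ℂ)
    (hγ : ∀ i j, i ≠ j → Set.range (γ i) ∩ Set.range (γ j) ⊆ {a, b})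
    (hx : ∀ i j k, j ≠ i → k ≠ i → ∀ q ∈ Set.range (γ i), q ≠ a → q ≠ b →
      windParity q (roundTrip (γ j) (γ k)) = windParity (x i) (roundTrip (γ j) (γ k)))
    {d : ℂ} (hd : d ≠ 0) (hb : ((b - a) / d).re = 0) (hpos : ∃ i t, 0 < ((γ i t - a) / d).re) :
    ∃ i, ∀ j k, j ≠ i → k ≠ i → windParity (x i) (roundTrip (γ j) (γ k)) = 0 := by
  have hmax : ∀ i, ∃ t, ∀ s, ((γ i s - a) / d).re ≤ ((γ i t - a) / d).re := fun i ↦ by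
    obtain ⟨t, -, ht⟩ := isCompact_univ.exists_isMaxOn (f := fun t ↦ ((γ i t - a) / d).re)
      Set.univ_nonempty (by fun_prop)
    exact ⟨t, fun s ↦ ht (Set.mem_univ s)⟩
  choose t ht using hmax
  obtain ⟨i, hi⟩ := Finite.exists_max fun i ↦ ((γ i (t i) - a) / d).re
  set q := γ i (t i) with hq
  have hle : ∀ j s, ((γ j s - a) / d).re ≤ ((q - a) / d).re := fun j s ↦ (ht j s).trans (hi j)
  obtain ⟨i', t', h'⟩ := hpos
  have hqpos := h'.trans_le (hle i' t')
  have hqa : q ≠ a := fun h ↦ by simp [h] at hqpos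
  have hqb : q ≠ b := fun h ↦ by simp [h, hb] at hqpos
  refine ⟨i, fun j k hj hk ↦ ?_⟩
  rw [← hx i j k hj hk q ⟨_, rfl⟩ hqa hqb]
  have hq_notMem : ∀ j, j ≠ i → q ∉ Set.range (γ j) := fun j hj h ↦ by
    rcases hγ j i hj ⟨h, ⟨_, rfl⟩⟩ with h | h
    · exact hqa h
    · exact hqb h
  let δ : _root_.Path q (q + d) := ⟨⟨fun t ↦ q + (t : ℝ) * d, by fun_prop⟩, by simp, by simp⟩
  have hδ : Disjoint (Set.range δ) (Set.range (roundTrip (γ j) (γ k))) := by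
    have : ∀ j, j ≠ i → ∀ s r, δ s ≠ γ j r := fun j hj s r h ↦ by
      have h1 : δ s = q + ((s : ℝ) : ℂ) * d := rfl
      have h2 := hle j r
      rw [← h, h1] at h2
      have h3 : (q + ((s : ℝ) : ℂ) * d - a) / d = (q - a) / d + ((s : ℝ) : ℂ) := by
        field_simp; ring
      rw [h3, add_re, ofReal_re] at h2
      have h4 : (s : ℝ) = 0 := le_antisymm (by linarith) s.2.1
      rw [h4] at h1
      exact hq_notMem j hj ⟨r, by rw [← h, h1]; simp⟩
    rw [range_roundTrip, Set.disjoint_left]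
    rintro _ ⟨s, rfl⟩ (⟨r, h⟩ | ⟨r, h⟩)
    · exact this j hj s r h.symm
    · exact this k hk s r h.symm
  rw [windParity_loop_eq δ _ hδ]
  obtain ⟨g, hg⟩ := exists_turnParity_eq_of_halfPlane (neg_ne_zero.2 hd)
  rw [windParity, hg _ (by fun_prop)]
  · simp only [Path.source, Path.target]
    exact CharTwo.add_self_eq_zero _
  · intro r
    have hmem : roundTrip (γ j) (γ k) r ∈ Set.range (γ j) ∪ Set.range (γ k) := by
      rw [← range_roundTrip]; exact ⟨r, rfl⟩
    have : ∃ j' s, roundTrip (γ j) (γ k) r = γ j' s := by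
      rcases hmem with ⟨s, h⟩ | ⟨s, h⟩
      · exact ⟨j, s, h.symm⟩
      · exact ⟨k, s, h.symm⟩
    obtain ⟨j', s, h⟩ := this
    have h1 := hle j' s
    have h2 : (γ j' s - (q + d)) / -d = (q - a) / d - (γ j' s - a) / d + 1 := by
      field_simp; ring
    rw [h, h2, add_re, sub_re, one_re]
    linarith

theorem exists_windParity_eq_zero (hab : a ≠ b) (γ : Fin 3 → _root_.Path a b) (x : Fin 3 → ℂ)
    (hγ : ∀ i j, i ≠ j → Set.range (γ i) ∩ Set.range (γ j) ⊆ {a, b})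
    (hx : ∀ i j k, j ≠ i → k ≠ i → ∀ q ∈ Set.range (γ i), q ≠ a → q ≠ b →
      windParity q (roundTrip (γ j) (γ k)) = windParity (x i) (roundTrip (γ j) (γ k))) :
    ∃ i, ∀ j k, j ≠ i → k ≠ i → windParity (x i) (roundTrip (γ j) (γ k)) = 0 := by
  have hba : b - a ≠ 0 := sub_ne_zero.2 hab.symm
  have hd : Complex.I * (b - a) ≠ 0 := mul_ne_zero I_ne_zero hba
  have e : ∀ z, (z / (Complex.I * (b - a))).re = (z / (b - a)).im := fun z ↦ by
    rw [mul_comm, ← div_div]; simp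
  have e' : ∀ z, (z / (-(Complex.I * (b - a)))).re = -(z / (b - a)).im := fun z ↦ by
    rw [div_neg, neg_re, e]
  by_cases h1 : ∃ i t, 0 < ((γ i t - a) / (Complex.I * (b - a))).re
  · exact exists_windParity_eq_zero_of_pos γ x hγ hx hd (by rw [e, div_self hba]; simp) h1
  by_cases h2 : ∃ i t, 0 < ((γ i t - a) / (-(Complex.I * (b - a)))).re
  · exact exists_windParity_eq_zero_of_pos γ x hγ hx (neg_ne_zero.2 hd)
      (by rw [e', div_self hba]; simp) h2
  exfalso
  push Not at h1 h2
  simp only [e] at h1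
  simp only [e'] at h2
  have hmid : ∀ i, a + (1 / 2 : ℝ) * (b - a) ∈ Set.range (γ i) := fun i ↦ by
    have hc : Continuous fun t ↦ ((γ i t - a) / (b - a)).re := by fun_prop
    obtain ⟨t, ht⟩ := mem_range_of_exists_le_of_exists_ge (c := 1 / 2) hc ⟨0, by simp⟩
      ⟨1, by simp [div_self hba]; norm_num⟩
    refine ⟨t, ?_⟩
    have him : ((γ i t - a) / (b - a)).im = 0 := le_antisymm (h1 i t) (by linarith [h2 i t])
    have hz : (γ i t - a) / (b - a) = (1 / 2 : ℝ) := Complex.ext ht (by rw [him, ofReal_im])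
    rw [div_eq_iff hba] at hz
    rw [← hz]; ring
  rcases hγ 0 1 (by decide) ⟨hmid 0, hmid 1⟩ with h | h
  · rw [add_eq_left] at h
    rcases mul_eq_zero.1 h with h | h
    · norm_num at h
    · exact hba h
  · have h : (b - a) / 2 = 0 := by
      have h' : a + (1 / 2 : ℝ) * (b - a) = b := h
      push_cast at h'
      linear_combination -h'
    simp [hba] at h

end Winding

section Drawing

open unitInterval

/-- A drawing of a graph in the complex plane with non-crossing arcs. -/
structure Drawing {V : Type*} (G : SimpleGraph V) where
  pos : V → ℂ
  arc : ∀ {u v : V}, G.Adj u v → _root_.Path (pos u) (pos v)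
  pos_injective : Function.Injective pos
  arc_symm : ∀ {u v : V} (h : G.Adj u v) (t : I), arc h.symm t = arc h (σ t)
  arc_ne_pos : ∀ {u v : V} (h : G.Adj u v) (w : V) (t : I), t ≠ 0 → t ≠ 1 → arc h t ≠ pos w
  arc_disjoint : ∀ {u v x y : V} (h : G.Adj u v) (h' : G.Adj x y), s(u, v) ≠ s(x, y) →
    ∀ t t' : I, t ≠ 0 → t ≠ 1 → t' ≠ 0 → t' ≠ 1 → arc h t ≠ arc h' t'

theorem SimpleGraph.HasPlanarEmbedding.nonempty_drawing {V : Type*} {G : SimpleGraph V}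
    (hG : G.HasPlanarEmbedding) : Nonempty (Drawing G) := by
  obtain ⟨pos, arc, hpos, harc, hdisj⟩ := hG
  have hIoo : ∀ t : I, t ≠ 0 → t ≠ 1 → (t : ℝ) ∈ Set.Ioo (0 : ℝ) 1 := fun t h0 h1 ↦
    ⟨lt_of_le_of_ne t.2.1 fun h ↦ h0 (Subtype.ext h.symm),
      lt_of_le_of_ne t.2.2 fun h ↦ h1 (Subtype.ext h)⟩
  let e := Complex.equivRealProdCLM.symm
  have he : Function.Injective e := e.injective
  exact ⟨{
    pos := fun v ↦ e (pos v)
    arc := fun {u v} h ↦ ⟨⟨fun t ↦ e (arc u v t), by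
      have := (harc u v h).1.domRestrict
      exact e.continuous.comp this⟩, by simp [(harc u v h).2.2.1],
        by simp [(harc u v h).2.2.2.1]⟩
    pos_injective := he.comp hpos
    arc_symm := fun {u v} h t ↦ by
      show e (arc v u t) = e (arc u v (σ t))
      rw [(harc v u h.symm).2.2.2.2.1 t]; rfl
    arc_ne_pos := fun {u v} h w t h0 h1 hh ↦
      (harc u v h).2.2.2.2.2 w t (hIoo t h0 h1) (he hh)
    arc_disjoint := fun {u v x y} h h' hne t t' h0 h1 h0' h1' hh ↦
      hdisj u v x y h h' hne t (hIoo t h0 h1) t' (hIoo t' h0' h1') (he hh) }⟩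

namespace Drawing

variable {V : Type*} {G : SimpleGraph V} (D : Drawing G)

/-- The interior points of the arc of an edge. -/
def openArc (e : Sym2 V) : Set ℂ :=
  {z | ∃ (u v : V) (h : G.Adj u v) (t : I), e = s(u, v) ∧ t ≠ 0 ∧ t ≠ 1 ∧ D.arc h t = z}

open Classical in
/-- A point in the interior of the arc of an edge. -/
noncomputable def mid (e : Sym2 V) : ℂ :=
  if h : ∃ d : G.Dart, d.edge = e then D.arc h.choose.adj (firstHalf 1) else 0

open Classical in
/-- The parity of the winding of the arc of an edge around a point. -/
noncomputable def edgeWind (p : ℂ) (e : Sym2 V) : ZMod 2 :=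
  if h : ∃ d : G.Dart, d.edge = e then windParity p (D.arc h.choose.adj) else 0

variable {D} {u v w x y : V} {e e' : Sym2 V} {p q : ℂ}

theorem arc_symm_eq (h : G.Adj u v) : D.arc h.symm = (D.arc h).symm := by
  ext t; exact D.arc_symm h t

theorem mid_mk (h : G.Adj u v) : D.mid s(u, v) = D.arc h (firstHalf 1) := by
  have hex : ∃ d : G.Dart, d.edge = s(u, v) := ⟨⟨(u, v), h⟩, rfl⟩
  have key : ∀ d : G.Dart, d.edge = s(u, v) →
      D.arc d.adj (firstHalf 1) = D.arc h (firstHalf 1) := by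
    rintro ⟨⟨a, b⟩, hab⟩ hd
    rcases dart_edge_eq_mk'_iff'.1 hd with ⟨rfl, rfl⟩ | ⟨rfl, rfl⟩
    · rfl
    · exact (D.arc_symm h _).trans (by rw [symm_firstHalf_one])
  rw [mid, dif_pos hex]
  exact key _ hex.choose_spec

theorem edgeWind_mk (h : G.Adj u v) (hp : p ∉ Set.range (D.arc h)) :
    D.edgeWind p s(u, v) = windParity p (D.arc h) := by
  have hex : ∃ d : G.Dart, d.edge = s(u, v) := ⟨⟨(u, v), h⟩, rfl⟩
  have key : ∀ d : G.Dart, d.edge = s(u, v) →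
      windParity p (D.arc d.adj) = windParity p (D.arc h) := by
    rintro ⟨⟨a, b⟩, hab⟩ hd
    rcases dart_edge_eq_mk'_iff'.1 hd with ⟨rfl, rfl⟩ | ⟨rfl, rfl⟩
    · rfl
    · exact (congrArg _ (arc_symm_eq h)).trans (windParity_symm _ hp)
  rw [edgeWind, dif_pos hex]
  exact key _ hex.choose_spec

theorem mid_mem_openArc (h : G.Adj u v) : D.mid s(u, v) ∈ D.openArc s(u, v) :=
  ⟨u, v, h, firstHalf 1, rfl, firstHalf_one ▸ secondHalf_ne_zero 0, firstHalf_ne_one 1,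
    (mid_mk h).symm⟩

theorem pos_notMem_openArc : D.pos w ∉ D.openArc e := by
  rintro ⟨u, v, h, t, -, h0, h1, ht⟩
  exact D.arc_ne_pos h w t h0 h1 ht

theorem openArc_disjoint (hne : e ≠ e') : Disjoint (D.openArc e) (D.openArc e') := by
  rw [Set.disjoint_left]
  rintro _ ⟨u, v, h, t, rfl, h0, h1, rfl⟩ ⟨x, y, h', t', rfl, h0', h1', ht⟩
  exact D.arc_disjoint h h' hne t t' h0 h1 h0' h1' ht.symm

theorem arc_mem (h : G.Adj u v) (t : I) :
    (t = 0 ∧ D.arc h t = D.pos u) ∨ (t = 1 ∧ D.arc h t = D.pos v) ∨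
      (t ≠ 0 ∧ t ≠ 1 ∧ D.arc h t ∈ D.openArc s(u, v)) := by
  by_cases h0 : t = 0
  · subst h0; exact Or.inl ⟨rfl, by simp⟩
  by_cases h1 : t = 1
  · subst h1; exact Or.inr (Or.inl ⟨rfl, by simp⟩)
  exact Or.inr (Or.inr ⟨h0, h1, u, v, h, t, rfl, h0, h1, rfl⟩)

variable (D) in
/-- The curve traced by a walk in a drawing. -/
noncomputable def walkPath : ∀ {u v : V}, G.Walk u v → _root_.Path (D.pos u) (D.pos v)
  | _, _, .nil => .refl _
  | _, _, .cons h w => (D.arc h).trans (walkPath w)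

variable (D) in
/-- The vertices and open arcs of a walk. -/
def trace (W : G.Walk u v) : Set ℂ :=
  {z | (∃ x ∈ W.support, z = D.pos x) ∨ ∃ e ∈ W.edges, z ∈ D.openArc e}

theorem range_walkPath_subset (W : G.Walk u v) : Set.range (D.walkPath W) ⊆ D.trace W := by
  induction W with
  | nil => rintro _ ⟨t, rfl⟩; exact Or.inl ⟨_, by simp, rfl⟩
  | cons h W ih =>
    rw [walkPath, Path.trans_range]
    rintro z (⟨t, rfl⟩ | hz)
    · rcases D.arc_mem h t with h | h | h
      · exact Or.inl ⟨_, by simp, h.2⟩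
      · exact Or.inl ⟨_, by simp, h.2⟩
      · exact Or.inr ⟨_, by simp, h.2.2⟩
    · rcases ih hz with ⟨x, hx, h⟩ | ⟨e, he, h⟩
      · exact Or.inl ⟨x, by simp [hx], h⟩
      · exact Or.inr ⟨e, by simp [he], h⟩

theorem pos_mem_trace {W : G.Walk u v} : D.pos x ∈ D.trace W ↔ x ∈ W.support := by
  refine ⟨?_, fun h ↦ Or.inl ⟨x, h, rfl⟩⟩
  rintro (⟨y, hy, h⟩ | ⟨e, -, h⟩)
  · rwa [D.pos_injective h]
  · exact absurd h pos_notMem_openArc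

theorem mem_edges_of_mem_trace {W : G.Walk u v} (hp : p ∈ D.openArc e) (h : p ∈ D.trace W) :
    e ∈ W.edges := by
  rcases h with ⟨y, -, rfl⟩ | ⟨e', he', h⟩
  · exact absurd hp pos_notMem_openArc
  · by_cases hne : e = e'
    · rwa [hne]
    · exact absurd h (Set.disjoint_left.1 (openArc_disjoint hne) hp)

theorem windParity_walkPath {W : G.Walk u v} (hp : p ∉ D.trace W) :
    windParity p (D.walkPath W) = (W.edges.map (D.edgeWind p)).sum := by
  induction W with
  | nil => simp [walkPath, windParity_refl]
  | cons h W ih =>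
    have h1 : p ∉ D.trace W := fun hh ↦ hp <| by
      rcases hh with ⟨x, hx, h⟩ | ⟨e, he, h⟩
      · exact Or.inl ⟨x, by simp [hx], h⟩
      · exact Or.inr ⟨e, by simp [he], h⟩
    have h2 : p ∉ Set.range (D.arc h) := by
      rintro ⟨t, rfl⟩
      apply hp
      rcases D.arc_mem h t with h | h | h
      · exact Or.inl ⟨_, by simp, h.2⟩
      · exact Or.inl ⟨_, by simp, h.2⟩
      · exact Or.inr ⟨_, by simp, h.2.2⟩
    rw [walkPath, windParity_trans _ _ h2 fun hh ↦ h1 (range_walkPath_subset _ hh),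
      Walk.edges_cons, List.map_cons, List.sum_cons, edgeWind_mk h h2, ih h1]

theorem windParity_eq_of_mem_openArc {c : ℂ} (L : _root_.Path c c)
    (hL : Disjoint (D.openArc e) (Set.range L)) (hp : p ∈ D.openArc e) (hq : q ∈ D.openArc e) :
    windParity p L = windParity q L := by
  obtain ⟨u, v, h, s, rfl, hs0, hs1, rfl⟩ := hp
  obtain ⟨u', v', h', t, he, ht0, ht1, rfl⟩ := hq
  have hq' : ∃ t', t' ≠ 0 ∧ t' ≠ 1 ∧ D.arc h' t = D.arc h t' := by
    rcases Sym2.eq_iff.1 he with ⟨rfl, rfl⟩ | ⟨rfl, rfl⟩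
    · exact ⟨t, ht0, ht1, rfl⟩
    · exact ⟨σ t, by simpa using ht1, by simpa using ht0, D.arc_symm h t⟩
  obtain ⟨t', ht0', ht1', ht'⟩ := hq'
  rw [ht']
  refine windParity_loop_eq ((D.arc h).subpath s t') L (hL.mono_left ?_)
  rw [Path.range_subpath]
  rintro _ ⟨r, hr, rfl⟩
  rw [Set.mem_uIcc] at hr
  refine ⟨u, v, h, r, rfl, ?_, ?_, rfl⟩
  · rintro rfl
    rcases hr with hr | hr
    · exact hs0 (le_antisymm hr.1 s.2.1)
    · exact ht0' (le_antisymm hr.1 t'.2.1)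
  · rintro rfl
    rcases hr with hr | hr
    · exact ht1' (le_antisymm t'.2.2 hr.2)
    · exact hs1 (le_antisymm s.2.2 hr.2)

theorem windParity_mid_eq_pos {c : ℂ} (L : _root_.Path c c) (h : G.Adj u v)
    (hL : Disjoint (D.openArc s(u, v)) (Set.range L)) (hu : D.pos u ∉ Set.range L) :
    windParity (D.mid s(u, v)) L = windParity (D.pos u) L := by
  rw [mid_mk h]
  refine (windParity_loop_eq (((D.arc h).subpath 0 (firstHalf 1)).cast (by simp) rfl) L ?_).symm
  rw [Path.cast_coe, Path.range_subpath, Set.disjoint_left]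
  rintro _ ⟨r, hr, rfl⟩ hmem
  rcases D.arc_mem h r with h' | h' | h'
  · rw [h'.2] at hmem; exact hu hmem
  · rw [Set.uIcc_of_le (show (0 : I) ≤ firstHalf 1 from (firstHalf 1).2.1), h'.1] at hr
    exact firstHalf_ne_one 1 (le_antisymm (firstHalf 1).2.2 hr.2)
  · exact Set.disjoint_left.1 hL h'.2.2 hmem

theorem openArc_disjoint_trace {W : G.Walk u v} (he : e ∉ W.edges) :
    Disjoint (D.openArc e) (D.trace W) :=
  Set.disjoint_left.2 fun _ h h' ↦ he (mem_edges_of_mem_trace h h')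

variable (D) in
/-- The parity of the winding of a walk around the midpoint of an edge. -/
noncomputable def walkWind (e : Sym2 V) (W : G.Walk u v) : ZMod 2 :=
  (W.edges.map (D.edgeWind (D.mid e))).sum

theorem mid_notMem_trace {W : G.Walk u v} (he : e ∈ G.edgeSet) (h : e ∉ W.edges) :
    D.mid e ∉ D.trace W := by
  induction e with
  | h x y => exact Set.disjoint_left.1 (openArc_disjoint_trace h) (mid_mem_openArc he)

theorem walkWind_eq {W : G.Walk u v} (he : e ∈ G.edgeSet) (h : e ∉ W.edges) :
    D.walkWind e W = windParity (D.mid e) (D.walkPath W) :=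
  (windParity_walkPath (mid_notMem_trace he h)).symm

theorem walkWind_eq_of_common_vertex (C : G.Walk w w) {z : V} (hz : z ∉ C.support)
    (hx : G.Adj z x) (hy : G.Adj z y) : D.walkWind s(z, x) C = D.walkWind s(z, y) C := by
  have key : ∀ {x}, G.Adj z x → D.walkWind s(z, x) C = windParity (D.pos z) (D.walkPath C) := by
    intro x hx
    have hn : s(z, x) ∉ C.edges := fun h ↦ hz (C.fst_mem_support_of_mem_edges h)
    rw [walkWind_eq hx hn]
    exact windParity_mid_eq_pos _ hx
      ((openArc_disjoint_trace hn).mono_right (range_walkPath_subset C))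
      fun h ↦ hz (pos_mem_trace.1 (range_walkPath_subset C h))
  rw [key hx, key hy]

theorem windParity_mid_eq_of_mem_edges {c : ℂ} (L : _root_.Path c c) {P : G.Walk u v}
    (hP : P.IsPath) (hE : ∀ e ∈ P.edges, Disjoint (D.openArc e) (Set.range L))
    (hV : ∀ x ∈ P.support, x ≠ u → x ≠ v → D.pos x ∉ Set.range L)
    (he : e ∈ P.edges) (he' : e' ∈ P.edges) :
    windParity (D.mid e) L = windParity (D.mid e') L := by
  have key : ∃ r, ∀ e ∈ P.edges, windParity (D.mid e) L = r := by
    clear he he'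
    induction P with
    | nil => simp
    | @cons u b v h P ih =>
      cases P with
      | nil => exact ⟨windParity (D.mid s(u, b)) L, by simp⟩
      | @cons _ c _ h' P =>
        have hP' := (Walk.cons_isPath_iff _ _).1 hP
        have hP'' := (Walk.cons_isPath_iff _ _).1 hP'.1
        obtain ⟨r, hr⟩ := ih hP'.1 (fun e he ↦ hE e (by simp_all)) (fun x hx hxb hxv ↦
          hV x (by rw [Walk.support_cons]; exact List.mem_cons_of_mem _ hx)
            (fun h ↦ hP'.2 (h ▸ hx)) hxv)
        refine ⟨r, fun e he ↦ ?_⟩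
        rw [Walk.edges_cons, List.mem_cons] at he
        rcases he with rfl | he
        · have hb : D.pos b ∉ Set.range L := hV b (by simp) h.ne'
            fun hbv ↦ hP''.2 (hbv ▸ P.end_mem_support)
          rw [← hr s(b, c) (by simp), Sym2.eq_swap,
            windParity_mid_eq_pos L h.symm (Sym2.eq_swap ▸ hE _ (by simp)) hb,
            windParity_mid_eq_pos L h' (hE _ (by simp)) hb]
        · exact hr e he
  obtain ⟨r, hr⟩ := key
  rw [hr e he, hr e' he']

theorem _root_.SimpleGraph.Walk.exists_append_cons_of_mem_edges {W : G.Walk u v}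
    (he : e ∈ W.edges) : ∃ (a b : V) (A : G.Walk u a) (h : G.Adj a b) (B : G.Walk b v),
      W = A.append (.cons h B) ∧ e = s(a, b) := by
  induction W with
  | nil => simp at he
  | @cons u b v h W ih =>
    rw [Walk.edges_cons, List.mem_cons] at he
    rcases he with rfl | he
    · exact ⟨u, b, .nil, h, W, rfl, rfl⟩
    · obtain ⟨a', b', A, h', B, rfl, rfl⟩ := ih he
      exact ⟨a', b', .cons h A, h', B, rfl, rfl⟩

theorem mem_trace_append_left {A : G.Walk u w} (B : G.Walk w v) (h : p ∈ D.trace A) :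
    p ∈ D.trace (A.append B) := by
  rcases h with ⟨x, hx, h⟩ | ⟨e, he, h⟩
  · exact Or.inl ⟨x, Walk.support_subset_support_append_left _ _ hx, h⟩
  · exact Or.inr ⟨e, by simp [he], h⟩

theorem mem_trace_append_right {A : G.Walk u w} (B : G.Walk w v) (h : p ∈ D.trace B) :
    p ∈ D.trace (A.append B) := by
  rcases h with ⟨x, hx, h⟩ | ⟨e, he, h⟩
  · exact Or.inl ⟨x, Walk.support_subset_support_append_right _ _ hx, h⟩
  · exact Or.inr ⟨e, by simp [he], h⟩

/-- A path in the graph is split into two curves at the midpoint of one of its edges. -/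
theorem exists_split {P : G.Walk u v} (hP : P.IsPath) (he : e ∈ P.edges) :
    ∃ (α : _root_.Path (D.pos u) (D.mid e)) (β : _root_.Path (D.mid e) (D.pos v)),
      Set.range α ⊆ D.trace P ∧ Set.range β ⊆ D.trace P ∧ D.pos v ∉ Set.range α ∧
      D.pos u ∉ Set.range β ∧
      ∀ p ∉ D.trace P, windParity p α + windParity p β = windParity p (D.walkPath P) := by
  obtain ⟨a, b, A, h, B, rfl, rfl⟩ := Walk.exists_append_cons_of_mem_edges he
  obtain ⟨γ, δ, hγ, hδ⟩ := exists_halves (D.arc h)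
  have hm := mid_mk (D := D) h
  have hcons : ∀ t, t ≠ 1 → D.arc h t = D.pos a ∨ D.arc h t ∈ D.openArc s(a, b) := fun t ht ↦ by
    rcases D.arc_mem h t with h' | h' | h'
    · exact Or.inl h'.2
    · exact absurd h'.1 ht
    · exact Or.inr h'.2.2
  have hcons' : ∀ t, t ≠ 0 → D.arc h t = D.pos b ∨ D.arc h t ∈ D.openArc s(a, b) := fun t ht ↦ by
    rcases D.arc_mem h t with h' | h' | h'
    · exact absurd h'.1 ht
    · exact Or.inl h'.2
    · exact Or.inr h'.2.2
  have hnd := hP.support_nodup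
  rw [Walk.support_append, Walk.support_cons, List.tail_cons, List.nodup_append] at hnd
  have hγA : ∀ z ∈ Set.range γ, z = D.pos a ∨ z ∈ D.openArc s(a, b) := by
    rintro _ ⟨t, rfl⟩
    rw [← hγ]; exact hcons _ (firstHalf_ne_one t)
  have hδB : ∀ z ∈ Set.range δ, z = D.pos b ∨ z ∈ D.openArc s(a, b) := by
    rintro _ ⟨t, rfl⟩
    rw [← hδ]; exact hcons' _ (secondHalf_ne_zero t)
  refine ⟨((D.walkPath A).trans γ).cast rfl hm, (δ.trans (D.walkPath B)).cast hm rfl,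
    ?_, ?_, ?_, ?_, ?_⟩
  · rw [Path.cast_coe, Path.trans_range]
    rintro z (hz | hz)
    · exact mem_trace_append_left _ (range_walkPath_subset _ hz)
    · rcases hγA z hz with h' | h'
      · exact mem_trace_append_left _ (h' ▸ pos_mem_trace.2 A.end_mem_support)
      · exact Or.inr ⟨_, he, h'⟩
  · rw [Path.cast_coe, Path.trans_range]
    rintro z (hz | hz)
    · rcases hδB z hz with h' | h'
      · exact mem_trace_append_right _ (h' ▸ pos_mem_trace.2 (by simp))
      · exact Or.inr ⟨_, he, h'⟩
    · refine mem_trace_append_right _ ?_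
      rcases range_walkPath_subset _ hz with ⟨x, hx, h⟩ | ⟨e, he, h⟩
      · exact Or.inl ⟨x, by simp [hx], h⟩
      · exact Or.inr ⟨e, by simp [he], h⟩
  · rw [Path.cast_coe, Path.trans_range]
    rintro (hz | hz)
    · exact hnd.2.2 _ (pos_mem_trace.1 (range_walkPath_subset _ hz)) _ B.end_mem_support rfl
    · rcases hγA _ hz with h' | h'
      · exact hnd.2.2 _ (D.pos_injective h' ▸ A.end_mem_support) _ B.end_mem_support rfl
      · exact pos_notMem_openArc h'
  · rw [Path.cast_coe, Path.trans_range]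
    rintro (hz | hz)
    · rcases hδB _ hz with h' | h'
      · exact hnd.2.2 _ A.start_mem_support _ (D.pos_injective h' ▸ B.start_mem_support) rfl
      · exact pos_notMem_openArc h'
    · exact hnd.2.2 _ A.start_mem_support _ (pos_mem_trace.1 (range_walkPath_subset _ hz)) rfl
  · intro p hp
    have hA : p ∉ D.trace A := fun h ↦ hp (mem_trace_append_left _ h)
    have hB' : p ∉ D.trace (Walk.cons h B) := fun h ↦ hp (mem_trace_append_right _ h)
    have hB : p ∉ D.trace B := fun h' ↦ hB' <| by
      rcases h' with ⟨x, hx, h⟩ | ⟨e, he, h⟩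
      · exact Or.inl ⟨x, by simp [hx], h⟩
      · exact Or.inr ⟨e, by simp [he], h⟩
    have harc : p ∉ Set.range (D.arc h) := by
      rintro ⟨t, rfl⟩
      apply hB'
      rcases D.arc_mem h t with h | h | h
      · exact Or.inl ⟨_, by simp, h.2⟩
      · exact Or.inl ⟨_, by simp, h.2⟩
      · exact Or.inr ⟨_, by simp, h.2.2⟩
    have e1 : windParity p (((D.walkPath A).trans γ).cast rfl hm) =
        windParity p ((D.walkPath A).trans γ) := rfl
    have e2 : windParity p ((δ.trans (D.walkPath B)).cast hm rfl) =
        windParity p (δ.trans (D.walkPath B)) := rfl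
    have hpγ : p ∉ Set.range γ := by
      rintro ⟨t, ht⟩; exact harc ⟨_, (hγ t).trans ht⟩
    have hpδ : p ∉ Set.range δ := by
      rintro ⟨t, ht⟩; exact harc ⟨_, (hδ t).trans ht⟩
    rw [e1, e2, windParity_trans _ _ (fun h ↦ hA (range_walkPath_subset _ h)) hpγ,
      windParity_trans _ _ hpδ (fun h ↦ hB (range_walkPath_subset _ h)),
      windParity_walkPath hp, windParity_walkPath hA, windParity_walkPath hB,
      Walk.edges_append, Walk.edges_cons, List.map_append, List.sum_append, List.map_cons,
      List.sum_cons, edgeWind_mk h harc, windParity_eq_add_of_halves hγ hδ harc]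
    ring

theorem theta_walkWind (huv : u ≠ v) {P : Fin 3 → G.Walk u v} (hP : ∀ i, (P i).IsPath)
    (hS : ∀ i j, i ≠ j → ∀ x ∈ (P i).support, x ∈ (P j).support → x = u ∨ x = v)
    (hE : ∀ i j, i ≠ j → ∀ e ∈ (P i).edges, e ∉ (P j).edges) {f : Fin 3 → Sym2 V}
    (hf : ∀ i, f i ∈ (P i).edges) :
    ∑ i, ∑ j ∈ {j | j ≠ i}, D.walkWind (f i) (P j) = 1 ∧
      ∃ i, ∀ j k, j ≠ i → k ≠ i → D.walkWind (f i) (P j) + D.walkWind (f i) (P k) = 0 := by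
  have hfG : ∀ i, f i ∈ G.edgeSet := fun i ↦ (P i).edges_subset_edgeSet (hf i)
  have hfn : ∀ i j, i ≠ j → f i ∉ (P j).edges := fun i j hij ↦ hE i j hij _ (hf i)
  have htr : ∀ i j, i ≠ j → ∀ z ∈ D.trace (P i), z ∈ D.trace (P j) →
      z = D.pos u ∨ z = D.pos v := by
    rintro i j hij z (⟨x, hx, rfl⟩ | ⟨e, he, h⟩) hz'
    · exact (hS i j hij x hx (pos_mem_trace.1 hz')).imp (congrArg _) (congrArg _)
    · exact absurd (mem_edges_of_mem_trace h hz') (hE i j hij e he)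
  have hw : ∀ i j, i ≠ j → D.walkWind (f i) (P j) =
      windParity (D.mid (f i)) (D.walkPath (P j)) := fun i j hij ↦
    walkWind_eq (hfG i) (hfn i j hij)
  have hmid : ∀ i j, i ≠ j → D.mid (f i) ∉ D.trace (P j) := fun i j hij ↦
    mid_notMem_trace (hfG i) (hfn i j hij)
  constructor
  · choose α β h1 h2 h3 h4 h5 using fun i ↦ exists_split (D := D) (hP i) (hf i)
    rw [← theta_windParity_sum α β fun i j hij ↦ ?_]
    · refine Finset.sum_congr rfl fun i _ ↦ Finset.sum_congr rfl fun j hj ↦ ?_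
      have hij : i ≠ j := (Finset.mem_filter.1 hj).2.symm
      rw [hw i j hij, h5 j _ (hmid i j hij)]
    · rw [Set.disjoint_left]
      intro z hz hz'
      rcases htr i j hij z (h1 i hz) (h2 j hz') with rfl | rfl
      · exact h4 j hz'
      · exact h3 i hz
  · obtain ⟨i, hi⟩ := exists_windParity_eq_zero (fun h ↦ huv (D.pos_injective h))
      (fun i ↦ D.walkPath (P i)) (fun i ↦ D.mid (f i))
      (fun i j hij z hz ↦ htr i j hij z (range_walkPath_subset _ hz.1)
        (range_walkPath_subset _ hz.2)) (by
      intro i j k hj hk q hq hqu hqv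
      set L := roundTrip (D.walkPath (P j)) (D.walkPath (P k)) with hL
      have hLt : Set.range L ⊆ D.trace (P j) ∪ D.trace (P k) := by
        rw [hL, range_roundTrip]
        exact Set.union_subset_union (range_walkPath_subset _) (range_walkPath_subset _)
      have hEL : ∀ e ∈ (P i).edges, Disjoint (D.openArc e) (Set.range L) := fun e he ↦
        Disjoint.mono_right hLt <| Set.disjoint_union_right.2
          ⟨openArc_disjoint_trace (hE i j hj.symm e he),
            openArc_disjoint_trace (hE i k hk.symm e he)⟩
      have hVL : ∀ x ∈ (P i).support, x ≠ u → x ≠ v → D.pos x ∉ Set.range L := by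
        intro x hx hxu hxv hxL
        rcases hLt hxL with h | h
        · exact (hS i j hj.symm x hx (pos_mem_trace.1 h)).elim hxu hxv
        · exact (hS i k hk.symm x hx (pos_mem_trace.1 h)).elim hxu hxv
      rcases range_walkPath_subset _ hq with ⟨x, hx, rfl⟩ | ⟨e, he, h⟩
      · have hxu : x ≠ u := fun h ↦ hqu (h ▸ rfl)
        have hxv : x ≠ v := fun h ↦ hqv (h ▸ rfl)
        have hex : ∃ y, ∃ h : G.Adj x y, s(x, y) ∈ (P i).edges := by
          obtain ⟨A, B, hAB⟩ := Walk.mem_support_iff_exists_append.1 hx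
          cases B with
          | nil => exact absurd rfl hxv
          | cons h B => exact ⟨_, h, by rw [hAB]; simp⟩
        obtain ⟨y, hxy, hmem⟩ := hex
        rw [← windParity_mid_eq_pos L hxy (hEL _ hmem) (hVL x hx hxu hxv)]
        exact windParity_mid_eq_of_mem_edges L (hP i) hEL hVL hmem (hf i)
      · have hmide : D.mid e ∈ D.openArc e := by
          have := (P i).edges_subset_edgeSet he
          induction e with
          | h x y => exact mid_mem_openArc this
        rw [windParity_eq_of_mem_openArc L (hEL e he) h hmide]
        exact windParity_mid_eq_of_mem_edges L (hP i) hEL hVL he (hf i))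
    refine ⟨i, fun j k hj hk ↦ ?_⟩
    rw [hw i j hj.symm, hw i k hk.symm, ← hi j k hj hk, windParity_roundTrip
      (fun h ↦ hmid i j hj.symm (range_walkPath_subset _ h))
      (fun h ↦ hmid i k hk.symm (range_walkPath_subset _ h))]

end Drawing
end Drawing

section Separation

variable {V : Type*} [DecidableEq V] {G : SimpleGraph V}

/-- `F` is the edge set of a cycle of `G`. -/
def IsCycleSet (G : SimpleGraph V) (F : Finset (Sym2 V)) : Prop :=
  ∃ (u : V) (c : G.Walk u u), c.IsCycle ∧ c.edges.toFinset = F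

/-- Three internally disjoint paths with common ends. -/
structure IsThetaPaths {u v : V} (P : Fin 3 → G.Walk u v) : Prop where
  ne : u ≠ v
  isPath : ∀ i, (P i).IsPath
  support : ∀ i j, i ≠ j → ∀ x ∈ (P i).support, x ∈ (P j).support → x = u ∨ x = v
  edges : ∀ i j, i ≠ j → ∀ e ∈ (P i).edges, e ∉ (P j).edges

/-- The edge set of a walk. -/
def SimpleGraph.Walk.edgesFinset {u v : V} (P : G.Walk u v) : Finset (Sym2 V) := P.edges.toFinset

theorem SimpleGraph.Walk.mem_edgesFinset {u v : V} {P : G.Walk u v} {e : Sym2 V} :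
    e ∈ P.edgesFinset ↔ e ∈ P.edges := List.mem_toFinset

/-- A combinatorial separation rule: `κ` assigns to edges `e` and `z` a parity so that summing
`κ e` over a cycle tells on which side of the cycle the edge `e` lies. -/
structure IsSeparation (G : SimpleGraph V) (κ : Sym2 V → Sym2 V → ZMod 2) : Prop where
  common_vertex : ∀ F, IsCycleSet G F → ∀ w x y, (∀ e ∈ F, w ∉ e) → G.Adj w x → G.Adj w y →
    ∑ z ∈ F, κ s(w, x) z = ∑ z ∈ F, κ s(w, y) z
  theta : ∀ {u v : V} (P : Fin 3 → G.Walk u v), IsThetaPaths P → ∀ f : Fin 3 → Sym2 V,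
    (∀ i, f i ∈ (P i).edges) → ∀ t : Fin 3 → Fin 3 → ZMod 2,
    (∀ i j, t i j = ∑ z ∈ (P j).edgesFinset, κ (f i) z) →
    (t 0 1 + t 0 2) + (t 1 0 + t 1 2) + (t 2 0 + t 2 1) = 1 ∧
    (t 0 1 + t 0 2 = 0 ∨ t 1 0 + t 1 2 = 0 ∨ t 2 0 + t 2 1 = 0)

theorem Drawing.isSeparation (D : Drawing G) :
    IsSeparation G fun e z ↦ D.edgeWind (D.mid e) z where
  common_vertex := by
    rintro _ ⟨u, c, hc, rfl⟩ w x y hw hx hy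
    have hwc : w ∉ c.support := by
      intro h
      obtain ⟨e, he, hwe⟩ := (Walk.mem_support_iff_exists_mem_edges_of_not_nil hc.not_nil).1 h
      exact hw e (by simpa using he) hwe
    have := walkWind_eq_of_common_vertex (D := D) c hwc hx hy
    simp only [walkWind] at this
    rwa [List.sum_toFinset _ hc.edges_nodup, List.sum_toFinset _ hc.edges_nodup]
  theta := by
    intro u v P hP f hf t ht
    have key := theta_walkWind (D := D) hP.ne hP.isPath hP.support hP.edges hf
    have ht' : ∀ i j, D.walkWind (f i) (P j) = t i j := fun i j ↦ by
      rw [ht, walkWind, Walk.edgesFinset, List.sum_toFinset _ (hP.isPath j).isTrail.edges_nodup]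
    simp only [ht'] at key
    have s0 : (Finset.univ.filter fun j : Fin 3 ↦ j ≠ 0) = {1, 2} := by decide
    have s1 : (Finset.univ.filter fun j : Fin 3 ↦ j ≠ 1) = {0, 2} := by decide
    have s2 : (Finset.univ.filter fun j : Fin 3 ↦ j ≠ 2) = {0, 1} := by decide
    rw [Fin.sum_univ_three, s0, s1, s2] at key
    simp only [Finset.sum_pair (show (1 : Fin 3) ≠ 2 by decide),
      Finset.sum_pair (show (0 : Fin 3) ≠ 2 by decide),
      Finset.sum_pair (show (0 : Fin 3) ≠ 1 by decide)] at key
    refine ⟨key.1, ?_⟩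
    obtain ⟨i, hi⟩ := key.2
    fin_cases i
    · exact Or.inl (hi 1 2 (by decide) (by decide))
    · exact Or.inr (Or.inl (hi 0 2 (by decide) (by decide)))
    · exact Or.inr (Or.inr (hi 0 1 (by decide) (by decide)))

theorem isCycleSet_union {u v : V} {A B : G.Walk u v} (huv : u ≠ v) (hA : A.IsPath)
    (hB : B.IsPath) (hS : ∀ x ∈ A.support, x ∈ B.support → x = u ∨ x = v)
    (hE : ∀ e ∈ A.edges, e ∉ B.edges) : IsCycleSet G (A.edgesFinset ∪ B.edgesFinset) := by
  refine ⟨u, A.append B.reverse, hA.isCycle_append hB.reverse ?_ ?_, ?_⟩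
  · intro x hx hx'
    have h1 : x ∈ A.support := List.mem_of_mem_tail hx
    have h2 : x ∈ B.support := by
      have := List.mem_of_mem_tail hx'
      simpa using this
    rcases hS x h1 h2 with rfl | rfl
    · have := hA.support_nodup
      rw [← A.cons_tail_support, List.nodup_cons] at this
      exact this.1 hx
    · have := hB.reverse.support_nodup
      rw [← B.reverse.cons_tail_support, List.nodup_cons] at this
      exact this.1 hx'
  · by_contra! h
    rw [Walk.length_reverse] at h
    cases A with
    | nil => exact huv rfl
    | cons h1 A =>
      cases A with
      | nil =>
        cases B with
        | nil => exact huv rfl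
        | cons h2 B =>
          cases B with
          | nil => exact hE s(u, v) (by simp) (by simp)
          | cons h3 B => simp at h
      | cons h3 A => simp at h
  · ext e
    simp [Walk.mem_edgesFinset]

theorem IsCycleSet.exists_split {F : Finset (Sym2 V)} (hF : IsCycleSet G F) {u v : V}
    (huv : u ≠ v) (hu : ∃ e ∈ F, u ∈ e) (hv : ∃ e ∈ F, v ∈ e) :
    ∃ A B : G.Walk u v, A.IsPath ∧ B.IsPath ∧
      (∀ x ∈ A.support, x ∈ B.support → x = u ∨ x = v) ∧
      (∀ e ∈ A.edges, e ∉ B.edges) ∧ F = A.edgesFinset ∪ B.edgesFinset := by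
  obtain ⟨w, c, hc, rfl⟩ := hF
  have hmem : ∀ x, (∃ e ∈ c.edges.toFinset, x ∈ e) → x ∈ c.support := by
    rintro x ⟨e, he, hx⟩
    exact Walk.mem_support_of_mem_edges (List.mem_toFinset.1 he) hx
  have hcu := hmem u hu
  have hr := hc.rotate hcu
  set r := c.rotate u hcu with hrdef
  have hre : r.edges.toFinset = c.edges.toFinset :=
    List.toFinset_eq_of_perm _ _ (c.rotate_edges u hcu).perm
  have hvr : v ∈ r.support := by
    obtain ⟨e, he, hve⟩ := hv
    exact Walk.mem_support_of_mem_edges (List.mem_toFinset.1 (hre ▸ he)) hve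
  have hsp := r.take_spec hvr
  set A := r.takeUntil v hvr
  set B := r.dropUntil v hvr
  rw [← hsp] at hr hre
  have hA : A.IsPath := hr.isPath_of_append_left (Walk.not_nil_of_ne huv.symm)
  have hB : B.IsPath := hr.isPath_of_append_right (Walk.not_nil_of_ne huv)
  refine ⟨A, B.reverse, hA, hB.reverse, ?_, ?_, ?_⟩
  · intro x hxA hxB
    have hnd := hr.support_nodup
    rw [Walk.tail_support_append, List.nodup_append] at hnd
    rw [← A.cons_tail_support, List.mem_cons] at hxA
    rw [Walk.support_reverse, List.mem_reverse, ← B.cons_tail_support, List.mem_cons] at hxB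
    rcases hxA with h | h
    · exact Or.inl h
    · rcases hxB with h' | h'
      · exact Or.inr h'
      · exact absurd rfl (hnd.2.2 x h x h')
  · intro e he he'
    have hnd := hr.edges_nodup
    rw [Walk.edges_append, List.nodup_append] at hnd
    exact hnd.2.2 e he e (by simpa using he') rfl
  · rw [← hre]
    ext e
    simp [Walk.mem_edgesFinset]

/-- Two vertices other than `x` can be joined by a walk avoiding `x`. -/
def TwoConnected (G : SimpleGraph V) : Prop :=
  ∀ x a b : V, a ≠ x → b ≠ x → ∃ p : G.Walk a b, x ∉ p.support

/-- An edge with at least one end in `T` extends to a path with both ends in `T` and no interior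
vertex in `T`. -/
theorem TwoConnected.exists_ear (hG : TwoConnected G) {T : Finset V} {s t w : V} (hs : s ∈ T)
    (ht : t ∈ T) (hst : t ≠ s) (hw : G.Adj s w) :
    ∃ s' ∈ T, s' ≠ s ∧ ∃ Q : G.Walk s s', Q.IsPath ∧ s(s, w) ∈ Q.edges ∧
      (∀ x ∈ Q.support, x ∈ T → x = s ∨ x = s') ∧
      ∀ e ∈ Q.edges, (∀ x ∈ e, x ∈ T) → e = s(s, w) := by
  obtain ⟨p, hp⟩ := hG s w t hw.ne' hst
  obtain ⟨s', hs'T, hs', hfirst⟩ :=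
    p.exists_mem_support_forall_mem_support_imp_eq T ⟨t, by simpa using ht⟩
  have hsub : (p.takeUntil s' hs').bypass.support ⊆ p.support := fun x hx ↦
    p.support_takeUntil_subset_support hs' (Walk.support_bypass_subset_support _ hx)
  have hsn : s ∉ (p.takeUntil s' hs').bypass.support := fun h ↦ hp (hsub h)
  refine ⟨s', hs'T, fun h ↦ hp (h ▸ hs'), .cons hw (p.takeUntil s' hs').bypass,
    (Walk.bypass_isPath _).cons hsn, by simp, ?_, ?_⟩
  · intro x hx hxT
    rw [Walk.support_cons, List.mem_cons] at hx
    exact hx.imp id fun h ↦ hfirst x hxT (Walk.support_bypass_subset_support _ h)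
  · intro e he heT
    rw [Walk.edges_cons, List.mem_cons] at he
    refine he.resolve_right fun he' ↦ ?_
    induction e with
    | h a b =>
      have ha := hfirst a (heT a (by simp)) (Walk.support_bypass_subset_support _
        (Walk.fst_mem_support_of_mem_edges _ he'))
      have hb := hfirst b (heT b (by simp)) (Walk.support_bypass_subset_support _
        (Walk.snd_mem_support_of_mem_edges _ he'))
      exact (Walk.adj_of_mem_edges _ he').ne (ha.trans hb.symm)

theorem exists_adj_mem_of_walk {T : Finset V} {x t : V} (W : G.Walk x t) (ht : t ∈ T)
    (hx : x ∉ T) {y : V} (hxy : G.Adj x y) :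
    ∃ s ∈ T, ∃ w ∉ T, G.Adj s w ∧ ∀ ψ : Sym2 V → ZMod 2,
      (∀ z ∉ T, ∀ a b, G.Adj z a → G.Adj z b → ψ s(z, a) = ψ s(z, b)) →
        ψ s(x, y) = ψ s(s, w) := by
  induction W generalizing y with
  | nil => exact absurd ht hx
  | @cons x x' t h W ih =>
    by_cases hx' : x' ∈ T
    · exact ⟨x', hx', x, hx, h.symm, fun ψ hψ ↦ by rw [hψ x hx y x' hxy h, Sym2.eq_swap]⟩
    · obtain ⟨s, hs, w, hw, hsw, key⟩ := ih ht hx' h.symm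
      refine ⟨s, hs, w, hw, hsw, fun ψ hψ ↦ ?_⟩
      rw [← key ψ hψ, hψ x hx y x' hxy h, Sym2.eq_swap]

/-- Every edge can be moved to an edge meeting `T`, outside of a given set of edges between vertices
of `T`, through vertices outside of `T`. -/
theorem TwoConnected.exists_adj_mem (hG : TwoConnected G) {T : Finset V} {s : V} (hs : s ∈ T)
    {E : Finset (Sym2 V)} (hE : ∀ e ∈ E, ∀ x ∈ e, x ∈ T)
    {e : Sym2 V} (he : e ∈ G.edgeSet) (heE : e ∉ E) :
    ∃ s ∈ T, ∃ w, G.Adj s w ∧ s(s, w) ∉ E ∧ ∀ ψ : Sym2 V → ZMod 2,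
      (∀ z ∉ T, ∀ a b, G.Adj z a → G.Adj z b → ψ s(z, a) = ψ s(z, b)) →
        ψ e = ψ s(s, w) := by
  induction e with
  | h x y =>
    by_cases hx : x ∈ T
    · exact ⟨x, hx, y, he, heE, fun _ _ ↦ rfl⟩
    · have hW : ∃ t ∈ T, Nonempty (G.Walk x t) := by
        by_cases hxs : s = y
        · exact ⟨y, hxs ▸ hs, ⟨.cons he .nil⟩⟩
        · obtain ⟨p, -⟩ := hG y x s (G.ne_of_adj he) hxs
          exact ⟨s, hs, ⟨p⟩⟩
      obtain ⟨t, ht, ⟨W⟩⟩ := hW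
      obtain ⟨s, hs, w, hw, hsw, key⟩ := exists_adj_mem_of_walk W ht hx he
      exact ⟨s, hs, w, hsw, fun h ↦ hw (hE _ h w (by simp)), key⟩


omit [DecidableEq V] in
theorem eq_of_mem_edges_of_isPath {s t : V} {Q : G.Walk s t} (hQ : Q.IsPath)
    {ψ : Sym2 V → ZMod 2} (hψ : ∀ z ∈ Q.support, z ≠ s → z ≠ t → ∀ a b, G.Adj z a → G.Adj z b →
      ψ s(z, a) = ψ s(z, b)) {e e' : Sym2 V} (he : e ∈ Q.edges) (he' : e' ∈ Q.edges) :
    ψ e = ψ e' := by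
  have key : ∃ r, ∀ e ∈ Q.edges, ψ e = r := by
    clear he he'
    induction Q with
    | nil => simp
    | @cons u b v h P ih =>
      cases P with
      | nil => exact ⟨ψ s(u, b), by simp⟩
      | @cons _ c _ h' P =>
        have hP' := (Walk.cons_isPath_iff _ _).1 hQ
        have hP'' := (Walk.cons_isPath_iff _ _).1 hP'.1
        obtain ⟨r, hr⟩ := ih hP'.1 (fun x hx hxb hxv ↦
          hψ x (by rw [Walk.support_cons]; exact List.mem_cons_of_mem _ hx)
            (fun h ↦ hP'.2 (h ▸ hx)) hxv)
        refine ⟨r, fun e he ↦ ?_⟩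
        rw [Walk.edges_cons, List.mem_cons] at he
        rcases he with rfl | he
        · rw [← hr s(b, c) (by simp), Sym2.eq_swap]
          exact hψ b (by simp) h.ne' (fun hbv ↦ hP''.2 (hbv ▸ P.end_mem_support)) _ _ h.symm h'
        · exact hr e he
  obtain ⟨r, hr⟩ := key
  rw [hr e he, hr e' he']

end Separation

section Theta

variable {V : Type*} [DecidableEq V] {G : SimpleGraph V} {u v : V}

/-- Two walks with common ends meet only there. -/
def IntDisjoint (A B : G.Walk u v) : Prop :=
  (∀ x ∈ A.support, x ∈ B.support → x = u ∨ x = v) ∧ ∀ e ∈ A.edges, e ∉ B.edges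

omit [DecidableEq V] in
theorem IntDisjoint.symm {A B : G.Walk u v} (h : IntDisjoint A B) : IntDisjoint B A :=
  ⟨fun x hx hx' ↦ h.1 x hx' hx, fun e he he' ↦ h.2 e he' he⟩

/-- The parity of the side of the edge `e` with respect to a walk. -/
def walkSide (κ : Sym2 V → Sym2 V → ZMod 2) (W : G.Walk u v) (e : Sym2 V) : ZMod 2 :=
  ∑ z ∈ W.edgesFinset, κ e z

theorem sum_union_edgesFinset {A B : G.Walk u v} (h : IntDisjoint A B) (φ : Sym2 V → ZMod 2) :
    ∑ z ∈ A.edgesFinset ∪ B.edgesFinset, φ z =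
      ∑ z ∈ A.edgesFinset, φ z + ∑ z ∈ B.edgesFinset, φ z := by
  refine Finset.sum_union (Finset.disjoint_left.2 fun e he he' ↦ ?_)
  exact h.2 e (Walk.mem_edgesFinset.1 he) (Walk.mem_edgesFinset.1 he')

variable {κ : Sym2 V → Sym2 V → ZMod 2}

theorem IsSeparation.theta_three (hκ : IsSeparation G κ) (huv : u ≠ v) {A B C : G.Walk u v}
    (hA : A.IsPath) (hB : B.IsPath) (hC : C.IsPath) (hAB : IntDisjoint A B)
    (hAC : IntDisjoint A C) (hBC : IntDisjoint B C) {a b c : Sym2 V} (ha : a ∈ A.edges)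
    (hb : b ∈ B.edges) (hc : c ∈ C.edges) :
    (walkSide κ B a + walkSide κ C a) + (walkSide κ A b + walkSide κ C b) +
      (walkSide κ A c + walkSide κ B c) = 1 ∧
    (walkSide κ B a + walkSide κ C a = 0 ∨ walkSide κ A b + walkSide κ C b = 0 ∨
      walkSide κ A c + walkSide κ B c = 0) := by
  have key : ∀ i j : Fin 3, i ≠ j → IntDisjoint (![A, B, C] i) (![A, B, C] j) := by
    intro i j hij
    fin_cases i <;> fin_cases j <;> first
      | exact absurd rfl hij
      | assumption
      | (apply IntDisjoint.symm; assumption)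
  refine hκ.theta ![A, B, C] ⟨huv, fun i ↦ ?_, fun i j hij ↦ (key i j hij).1,
    fun i j hij ↦ (key i j hij).2⟩ ![a, b, c] (fun i ↦ ?_)
    (fun i j ↦ walkSide κ (![A, B, C] j) (![a, b, c] i)) fun i j ↦ rfl
  · fin_cases i <;> assumption
  · fin_cases i <;> assumption

theorem IsSeparation.walkSide_add_eq (hκ : IsSeparation G κ) (huv : u ≠ v) {A B : G.Walk u v}
    (hA : A.IsPath) (hB : B.IsPath) (hAB : IntDisjoint A B) {z a b : V} (hzA : z ∉ A.support)
    (hzB : z ∉ B.support) (ha : G.Adj z a) (hb : G.Adj z b) :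
    walkSide κ A s(z, a) + walkSide κ B s(z, a) = walkSide κ A s(z, b) + walkSide κ B s(z, b) := by
  have := hκ.common_vertex _ (isCycleSet_union huv hA hB hAB.1 hAB.2) z a b (fun e he hz ↦ by
    rcases Finset.mem_union.1 he with h | h
    · exact hzA (Walk.mem_support_of_mem_edges (Walk.mem_edgesFinset.1 h) hz)
    · exact hzB (Walk.mem_support_of_mem_edges (Walk.mem_edgesFinset.1 h) hz)) ha hb
  rwa [sum_union_edgesFinset hAB, sum_union_edgesFinset hAB] at this

theorem IsSeparation.walkSide_add_eq_of_mem (hκ : IsSeparation G κ) (huv : u ≠ v)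
    {A B C : G.Walk u v} (hA : A.IsPath) (hB : B.IsPath) (hC : C.IsPath) (hAB : IntDisjoint A B)
    (hAC : IntDisjoint A C) (hBC : IntDisjoint B C) {e e' : Sym2 V} (he : e ∈ C.edges)
    (he' : e' ∈ C.edges) :
    walkSide κ A e + walkSide κ B e = walkSide κ A e' + walkSide κ B e' := by
  refine eq_of_mem_edges_of_isPath (ψ := fun e ↦ walkSide κ A e + walkSide κ B e) hC
    (fun z hz hzu hzv a b ha hb ↦ ?_) he he'
  exact hκ.walkSide_add_eq huv hA hB hAB (fun h ↦ (hAC.1 z h hz).elim hzu hzv)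
    (fun h ↦ (hBC.1 z h hz).elim hzu hzv) ha hb

omit [DecidableEq V] in
theorem exists_mem_edges_of_mem_support {W : G.Walk u v} (huv : u ≠ v) {z : V}
    (hz : z ∈ W.support) : ∃ b, G.Adj z b ∧ s(z, b) ∈ W.edges := by
  obtain ⟨e, he, hze⟩ := (Walk.mem_support_iff_exists_mem_edges_of_not_nil
    (Walk.not_nil_of_ne huv)).1 hz
  obtain ⟨b, rfl⟩ := Sym2.mem_iff_exists.1 hze
  exact ⟨b, W.adj_of_mem_edges he, he⟩

theorem four_paths_contradiction (m01 m02 m10 m12 m20 m21 q0 q1 q2 p0 p1 p2 : ZMod 2)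
    (h012 : (m01 + m02) + (m10 + m12) + (m20 + m21) = 1 ∧
      (m01 + m02 = 0 ∨ m10 + m12 = 0 ∨ m20 + m21 = 0))
    (h01q : (m01 + p0) + (m10 + p1) + (q0 + q1) = 1 ∧
      (m01 + p0 = 0 ∨ m10 + p1 = 0 ∨ q0 + q1 = 0))
    (h02q : (m02 + p0) + (m20 + p2) + (q0 + q2) = 1 ∧
      (m02 + p0 = 0 ∨ m20 + p2 = 0 ∨ q0 + q2 = 0))
    (h12q : (m12 + p1) + (m21 + p2) + (q1 + q2) = 1 ∧
      (m12 + p1 = 0 ∨ m21 + p2 = 0 ∨ q1 + q2 = 0))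
    (h1 : m10 + m12 + (q0 + q2) = 1) (h2 : m01 + m02 + (q1 + q2) = 1) : False := by
  grind


theorem IsSeparation.not_both_sides (hκ : IsSeparation G κ) (hG : TwoConnected G) (huv : u ≠ v)
    {A B P : G.Walk u v} (hA : A.IsPath) (hB : B.IsPath) (hP : P.IsPath) (hAB : IntDisjoint A B)
    (hAP : IntDisjoint A P) (hBP : IntDisjoint B P) {a b e : Sym2 V} (ha : a ∈ A.edges)
    (hb : b ∈ B.edges) (he : e ∈ G.edgeSet) (heA : e ∉ A.edges) (heB : e ∉ B.edges)
    (heP : e ∉ P.edges)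
    (h1 : walkSide κ A b + walkSide κ P b + (walkSide κ A e + walkSide κ P e) = 1)
    (h2 : walkSide κ B a + walkSide κ P a + (walkSide κ B e + walkSide κ P e) = 1) : False := by
  obtain ⟨p, hp⟩ : ∃ p, p ∈ P.edges := by
    obtain ⟨b, -, hb⟩ := exists_mem_edges_of_mem_support huv P.start_mem_support
    exact ⟨_, hb⟩
  set T : Finset V := A.support.toFinset ∪ B.support.toFinset ∪ P.support.toFinset with hT
  set E : Finset (Sym2 V) := A.edgesFinset ∪ B.edgesFinset ∪ P.edgesFinset with hE
  have memT : ∀ x, x ∈ T ↔ x ∈ A.support ∨ x ∈ B.support ∨ x ∈ P.support := by simp [hT]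
  have memE : ∀ x, x ∈ E ↔ x ∈ A.edges ∨ x ∈ B.edges ∨ x ∈ P.edges := by
    simp [hE, Walk.mem_edgesFinset]
  have hET : ∀ e ∈ E, ∀ x ∈ e, x ∈ T := by
    intro e he x hx
    rw [memT]
    rcases (memE e).1 he with h | h | h
    · exact Or.inl (Walk.mem_support_of_mem_edges h hx)
    · exact Or.inr (Or.inl (Walk.mem_support_of_mem_edges h hx))
    · exact Or.inr (Or.inr (Walk.mem_support_of_mem_edges h hx))
  have const1 : ∀ z ∉ T, ∀ x y, G.Adj z x → G.Adj z y →
      walkSide κ A s(z, x) + walkSide κ P s(z, x) = walkSide κ A s(z, y) + walkSide κ P s(z, y) := by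
    intro z hz x y hx hy
    rw [memT] at hz
    push Not at hz
    exact hκ.walkSide_add_eq huv hA hP hAP hz.1 hz.2.2 hx hy
  have const2 : ∀ z ∉ T, ∀ x y, G.Adj z x → G.Adj z y →
      walkSide κ B s(z, x) + walkSide κ P s(z, x) = walkSide κ B s(z, y) + walkSide κ P s(z, y) := by
    intro z hz x y hx hy
    rw [memT] at hz
    push Not at hz
    exact hκ.walkSide_add_eq huv hB hP hBP hz.2.1 hz.2.2 hx hy
  have ends : ∀ s ∈ T, ∀ w, G.Adj s w →
      walkSide κ A b + walkSide κ P b + (walkSide κ A s(s, w) + walkSide κ P s(s, w)) = 1 →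
      walkSide κ B a + walkSide κ P a + (walkSide κ B s(s, w) + walkSide κ P s(s, w)) = 1 →
      s = u ∨ s = v := by
    intro s hs w hw h1 h2
    by_contra hne
    rcases (memT s).1 hs with h | h | h
    · obtain ⟨c, hc, hcA⟩ := exists_mem_edges_of_mem_support huv h
      have e1 := hκ.walkSide_add_eq huv hB hP hBP (fun h' ↦ hne (hAB.1 s h h'))
        (fun h' ↦ hne (hAP.1 s h h')) hw hc
      have e2 := hκ.walkSide_add_eq_of_mem huv hB hP hA hBP hAB.symm hAP.symm hcA ha
      grind
    · obtain ⟨c, hc, hcB⟩ := exists_mem_edges_of_mem_support huv h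
      have e1 := hκ.walkSide_add_eq huv hA hP hAP (fun h' ↦ hne (hAB.1 s h' h))
        (fun h' ↦ hne (hBP.1 s h h')) hw hc
      have e2 := hκ.walkSide_add_eq_of_mem huv hA hP hB hAP hAB hBP.symm hcB hb
      grind
    · obtain ⟨c, hc, hcP⟩ := exists_mem_edges_of_mem_support huv h
      have e1 := hκ.walkSide_add_eq huv hA hB hAB (fun h' ↦ hne (hAP.1 s h' h))
        (fun h' ↦ hne (hBP.1 s h' h)) hw hc
      have e2 := hκ.walkSide_add_eq_of_mem huv hA hB hP hAB hAP hBP hcP hp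
      have e3 := (hκ.theta_three huv hA hB hP hAB hAP hBP ha hb hp).1
      grind
  have conv : ∃ (Q : G.Walk u v) (f : Sym2 V), Q.IsPath ∧ IntDisjoint A Q ∧ IntDisjoint B Q ∧
      IntDisjoint P Q ∧ f ∈ Q.edges ∧
      walkSide κ A b + walkSide κ P b + (walkSide κ A f + walkSide κ P f) = 1 ∧
      walkSide κ B a + walkSide κ P a + (walkSide κ B f + walkSide κ P f) = 1 := by
    have heE : e ∉ E := by rw [memE]; tauto
    have huT : u ∈ T := (memT u).2 (Or.inl A.start_mem_support)
    obtain ⟨s, hs, w, hsw, hswE, hψ⟩ := hG.exists_adj_mem huT hET he heE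
    have l1 := hψ (fun e ↦ walkSide κ A e + walkSide κ P e) const1
    have l2 := hψ (fun e ↦ walkSide κ B e + walkSide κ P e) const2
    obtain ⟨t, ht, hts⟩ : ∃ t ∈ T, t ≠ s := by
      by_cases h : u = s
      · exact ⟨v, (memT v).2 (Or.inl A.end_mem_support), fun h' ↦ huv (h.trans h'.symm)⟩
      · exact ⟨u, huT, h⟩
    obtain ⟨s', hs', hne, Q, hQ, hfQ, hQT, hQE⟩ := hG.exists_ear hs ht hts hsw
    have cQ : ∀ g ∈ Q.edges,
        walkSide κ A b + walkSide κ P b + (walkSide κ A g + walkSide κ P g) = 1 ∧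
        walkSide κ B a + walkSide κ P a + (walkSide κ B g + walkSide κ P g) = 1 := by
      intro g hg
      have g1 := eq_of_mem_edges_of_isPath (ψ := fun e ↦ walkSide κ A e + walkSide κ P e) hQ
        (fun z hz hzs hzs' x y hx hy ↦
          const1 z (fun h ↦ (hQT z hz h).elim hzs hzs') x y hx hy) hg hfQ
      have g2 := eq_of_mem_edges_of_isPath (ψ := fun e ↦ walkSide κ B e + walkSide κ P e) hQ
        (fun z hz hzs hzs' x y hx hy ↦
          const2 z (fun h ↦ (hQT z hz h).elim hzs hzs') x y hx hy) hg hfQ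
      rw [g1, g2, ← l1, ← l2]
      exact ⟨h1, h2⟩
    have hsuv : s = u ∨ s = v := ends s hs w hsw (cQ _ hfQ).1 (cQ _ hfQ).2
    have hsuv' : s' = u ∨ s' = v := by
      obtain ⟨c, hc, hcQ⟩ := exists_mem_edges_of_mem_support hne.symm Q.end_mem_support
      exact ends s' hs' c hc (cQ _ hcQ).1 (cQ _ hcQ).2
    have dis : ∀ x, x ∈ Q.support → x ∈ T → x = u ∨ x = v := by
      intro x hx hxT
      rcases hQT x hx hxT with rfl | rfl <;> assumption
    have disE : ∀ g ∈ E, g ∉ Q.edges := by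
      intro g hg hgQ
      rw [hQE g hgQ (hET g hg)] at hg
      exact hswE hg
    have fin : ∀ Q' : G.Walk u v, Q'.IsPath → (∀ x, x ∈ Q'.support → x ∈ Q.support) →
        (∀ x, x ∈ Q'.edges ↔ x ∈ Q.edges) → ∃ (Q : G.Walk u v) (f : Sym2 V), Q.IsPath ∧
        IntDisjoint A Q ∧ IntDisjoint B Q ∧ IntDisjoint P Q ∧ f ∈ Q.edges ∧
        walkSide κ A b + walkSide κ P b + (walkSide κ A f + walkSide κ P f) = 1 ∧
        walkSide κ B a + walkSide κ P a + (walkSide κ B f + walkSide κ P f) = 1 := by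
      intro Q' hQ' hsup hed
      refine ⟨Q', s(s, w), hQ', ⟨fun x hx hx' ↦ dis x (hsup x hx') ((memT x).2 (Or.inl hx)),
        fun g hg hg' ↦ disE g ((memE g).2 (Or.inl hg)) ((hed g).1 hg')⟩,
        ⟨fun x hx hx' ↦ dis x (hsup x hx') ((memT x).2 (Or.inr (Or.inl hx))),
        fun g hg hg' ↦ disE g ((memE g).2 (Or.inr (Or.inl hg))) ((hed g).1 hg')⟩,
        ⟨fun x hx hx' ↦ dis x (hsup x hx') ((memT x).2 (Or.inr (Or.inr hx))),
        fun g hg hg' ↦ disE g ((memE g).2 (Or.inr (Or.inr hg))) ((hed g).1 hg')⟩,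
        (hed _).2 hfQ, cQ _ hfQ⟩
    rcases hsuv with rfl | rfl <;> rcases hsuv' with rfl | rfl
    · exact absurd rfl hne
    · exact fin Q hQ (fun _ h ↦ h) fun _ ↦ Iff.rfl
    · exact fin Q.reverse hQ.reverse (fun _ h ↦ by simpa using h) fun _ ↦ by simp
    · exact absurd rfl hne
  obtain ⟨Q, f, hQ, hAQ, hBQ, hPQ, hf, f1, f2⟩ := conv
  exact four_paths_contradiction _ _ _ _ _ _ _ _ _ _ _ _
    (hκ.theta_three huv hA hB hP hAB hAP hBP ha hb hp)
    (hκ.theta_three huv hA hB hQ hAB hAQ hBQ ha hb hf)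
    (hκ.theta_three huv hA hP hQ hAP hAQ hPQ ha hp hf)
    (hκ.theta_three huv hB hP hQ hBP hBQ hPQ hb hp hf) f1 f2

end Theta

section Faces

variable {V : Type*} [DecidableEq V] {G : SimpleGraph V}

theorem Walk.sum_edgesFinset_eq_add {u v : V} {P : G.Walk u v} (hP : P.IsPath)
    {φ : Sym2 V → ZMod 2} {g : V → ZMod 2} (h : ∀ a b, s(a, b) ∈ P.edges → φ s(a, b) = g a + g b) :
    ∑ e ∈ P.edgesFinset, φ e = g u + g v := by
  rw [Walk.edgesFinset, List.sum_toFinset _ hP.isTrail.edges_nodup]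
  clear hP
  induction P with
  | nil => simp [CharTwo.add_self_eq_zero]
  | @cons u b v h' P ih =>
    rw [Walk.edges_cons, List.map_cons, List.sum_cons, ih fun a b hab ↦ h a b (by simp [hab]),
      h u b (by simp)]
    grind

/-- A function on the edges of a path is the coboundary of a function with given values at the
ends. -/
theorem Walk.exists_potential {u v : V} {P : G.Walk u v} (hP : P.IsPath) (φ : Sym2 V → ZMod 2)
    (g : V → ZMod 2) (h : ∑ e ∈ P.edgesFinset, φ e = g u + g v) :
    ∃ g' : V → ZMod 2, (∀ x, (x ∈ P.support → x = u ∨ x = v) → g' x = g x) ∧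
      ∀ a b, s(a, b) ∈ P.edges → φ s(a, b) = g' a + g' b := by
  rw [Walk.edgesFinset, List.sum_toFinset _ hP.isTrail.edges_nodup] at h
  induction P generalizing g with
  | nil => exact ⟨g, fun _ _ ↦ rfl, by simp⟩
  | @cons u b v hub P ih =>
    have hP' := (Walk.cons_isPath_iff _ _).1 hP
    rw [Walk.edges_cons, List.map_cons, List.sum_cons] at h
    have hnil : b = v → (P.edges.map φ).sum = 0 := by
      rintro rfl
      rw [(Walk.isPath_iff_nil.1 hP'.1).eq_nil]
      simp
    have hv : Function.update g b (g u + φ s(u, b)) v = g v := by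
      by_cases hbv : b = v
      · have := hnil hbv
        subst hbv
        rw [Function.update_self]
        grind
      · rw [Function.update_of_ne (Ne.symm hbv)]
    obtain ⟨g', hg', hφ⟩ := ih hP'.1 (Function.update g b (g u + φ s(u, b))) (by
      rw [hv, Function.update_self]
      grind)
    have hu : g' u = g u := by
      rw [hg' u fun h ↦ absurd h hP'.2, Function.update_of_ne hub.ne]
    refine ⟨g', fun x hx ↦ ?_, fun a c hac ↦ ?_⟩
    · by_cases hxu : x = u
      · rw [hxu, hu]
      by_cases hxv : x = v
      · rw [hxv, hg' v fun _ ↦ Or.inr rfl, hv]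
      have hxP : x ∉ P.support := fun h ↦
        (hx (by simp [h])).elim hxu hxv
      rw [hg' x fun h ↦ absurd h hxP, Function.update_of_ne]
      rintro rfl
      exact hxP P.start_mem_support
    · have hb : g' b = g u + φ s(u, b) := by
        rw [hg' b fun _ ↦ Or.inl rfl, Function.update_self]
      rw [Walk.edges_cons, List.mem_cons] at hac
      rcases hac with hac | hac
      · have key : φ s(u, b) = g' u + g' b := by rw [hu, hb]; grind
        rcases Sym2.eq_iff.1 hac with ⟨rfl, rfl⟩ | ⟨rfl, rfl⟩
        · exact key
        · rw [hac, key, add_comm]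
      · exact hφ a c hac

theorem card_union_support {u v : V} {P : G.Walk u v} (hP : P.IsPath) (huv : u ≠ v)
    {S : Finset V} (hu : u ∈ S) (hv : v ∈ S) (hS : ∀ x ∈ P.support, x ∈ S → x = u ∨ x = v) :
    (S ∪ P.support.toFinset).card + 1 = S.card + P.edgesFinset.card := by
  have h1 := Finset.card_union_add_card_inter S P.support.toFinset
  have h2 : S ∩ P.support.toFinset = {u, v} := by
    ext x
    simp only [Finset.mem_inter, List.mem_toFinset, Finset.mem_insert, Finset.mem_singleton]
    constructor
    · exact fun h ↦ hS x h.2 h.1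
    · rintro (rfl | rfl)
      · exact ⟨hu, P.start_mem_support⟩
      · exact ⟨hv, P.end_mem_support⟩
  rw [h2, Finset.card_pair huv, List.toFinset_card_of_nodup hP.support_nodup,
    Walk.length_support] at h1
  rw [Walk.edgesFinset, List.toFinset_card_of_nodup hP.isTrail.edges_nodup, Walk.length_edges]
  omega

variable {κ : Sym2 V → Sym2 V → ZMod 2}

/-- Whether the edge `e` lies in the face `F`, given by a cycle and a choice of a side. -/
def faceSide (κ : Sym2 V → Sym2 V → ZMod 2) (F : Finset (Sym2 V) × ZMod 2) (e : Sym2 V) : ZMod 2 :=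
  F.2 + ∑ z ∈ F.1, κ e z

/-- The faces `Φ` of a subgraph of `G` with edge set `E` and vertex set `S`. -/
structure IsFaceSystem (G : SimpleGraph V) (κ : Sym2 V → Sym2 V → ZMod 2) (E : Finset (Sym2 V))
    (S : Finset V) (Φ : Finset (Finset (Sym2 V) × ZMod 2)) : Prop where
  edgeSet : ∀ e ∈ E, e ∈ G.edgeSet
  mem_iff : ∀ x, x ∈ S ↔ ∃ e ∈ E, x ∈ e
  cycle : ∀ F ∈ Φ, IsCycleSet G F.1
  subset : ∀ F ∈ Φ, F.1 ⊆ E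
  two : ∀ e ∈ E, (∑ F ∈ Φ, if e ∈ F.1 then 1 else 0) = 2
  euler : Φ.card + S.card = E.card + 2
  sum : ∑ F ∈ Φ, F.2 = 1
  off : ∀ F ∈ Φ, ∀ e ∈ E, e ∉ F.1 → faceSide κ F e = 0
  sep : ∀ F ∈ Φ, ∀ F' ∈ Φ, F ≠ F' → ∀ e ∈ G.edgeSet, e ∉ F.1 → e ∉ F'.1 →
    faceSide κ F e = 1 → faceSide κ F' e = 1 → False
  coboundary : ∀ φ : Sym2 V → ZMod 2, (∀ F ∈ Φ, ∑ e ∈ F.1, φ e = 0) →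
    ∃ g : V → ZMod 2, ∀ a b, s(a, b) ∈ E → φ s(a, b) = g a + g b

theorem faceSide_union {u v : V} {A B : G.Walk u v} (h : IntDisjoint A B) (c : ZMod 2)
    (e : Sym2 V) : faceSide κ (A.edgesFinset ∪ B.edgesFinset, c) e =
      c + (walkSide κ A e + walkSide κ B e) := by
  rw [faceSide, sum_union_edgesFinset h]
  rfl

theorem faceSide_eq_of_not_mem (hκ : IsSeparation G κ) {F : Finset (Sym2 V) × ZMod 2}
    (hF : IsCycleSet G F.1) {z a b : V} (hz : ∀ e ∈ F.1, z ∉ e) (ha : G.Adj z a)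
    (hb : G.Adj z b) : faceSide κ F s(z, a) = faceSide κ F s(z, b) := by
  rw [faceSide, faceSide, hκ.common_vertex _ hF z a b hz ha hb]

theorem IsFaceSystem.exists_faceSide_eq_one {E : Finset (Sym2 V)} {S : Finset V}
    {Φ : Finset (Finset (Sym2 V) × ZMod 2)} (h : IsFaceSystem G κ E S Φ) (e : Sym2 V) :
    ∃ F ∈ Φ, faceSide κ F e = 1 := by
  by_contra hne
  push Not at hne
  have h0 : ∑ F ∈ Φ, faceSide κ F e = 0 := Finset.sum_eq_zero fun F hF ↦ by
    have := hne F hF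
    generalize faceSide κ F e = x at *
    revert this; revert x; decide
  have h1 : ∑ F ∈ Φ, ∑ z ∈ F.1, κ e z = 0 := by
    calc ∑ F ∈ Φ, ∑ z ∈ F.1, κ e z = ∑ F ∈ Φ, ∑ z ∈ E, if z ∈ F.1 then κ e z else 0 := by
          refine Finset.sum_congr rfl fun F hF ↦ ?_
          rw [Finset.sum_ite_mem, Finset.inter_eq_right.2 (h.subset F hF)]
      _ = ∑ z ∈ E, κ e z * ((∑ F ∈ Φ, if z ∈ F.1 then 1 else 0 : ℕ) : ZMod 2) := by
          rw [Finset.sum_comm]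
          refine Finset.sum_congr rfl fun z _ ↦ ?_
          push_cast
          rw [Finset.mul_sum]
          refine Finset.sum_congr rfl fun F _ ↦ ?_
          split_ifs <;> simp
      _ = 0 := Finset.sum_eq_zero fun z hz ↦ by
          rw [h.two z hz, show ((2 : ℕ) : ZMod 2) = 0 by decide, mul_zero]
  simp only [faceSide, Finset.sum_add_distrib, h.sum, h1] at h0
  exact absurd h0 (by decide)

/-- Replacing one face by two. -/
theorem sum_insert_insert_erase {α M : Type*} [DecidableEq α] [AddCommMonoid M] {Φ : Finset α}
    {F F₁ F₂ : α} (hF : F ∈ Φ) (h1 : F₁ ∉ Φ) (h2 : F₂ ∉ Φ) (h12 : F₁ ≠ F₂) (f : α → M) :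
    ∑ x ∈ insert F₁ (insert F₂ (Φ.erase F)), f x + f F = ∑ x ∈ Φ, f x + (f F₁ + f F₂) := by
  rw [Finset.sum_insert (by simp [h12, h1]), Finset.sum_insert (by simp [h2]),
    ← Finset.add_sum_erase _ _ hF]
  abel


theorem IsFaceSystem.of_paths {u v : V} (huv : u ≠ v) {A B : G.Walk u v}
    (hA : A.IsPath) (hB : B.IsPath) (hAB : IntDisjoint A B) :
    IsFaceSystem G κ (A.edgesFinset ∪ B.edgesFinset) (A.support.toFinset ∪ B.support.toFinset)
      {(A.edgesFinset ∪ B.edgesFinset, 0), (A.edgesFinset ∪ B.edgesFinset, 1)} where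
  edgeSet e he := by
    simp only [Finset.mem_union, Walk.mem_edgesFinset] at he
    exact he.elim (Walk.edges_subset_edgeSet _ ·) (Walk.edges_subset_edgeSet _ ·)
  mem_iff x := by
    rw [Finset.mem_union, List.mem_toFinset, List.mem_toFinset,
      Walk.mem_support_iff_exists_mem_edges_of_not_nil (Walk.not_nil_of_ne huv),
      Walk.mem_support_iff_exists_mem_edges_of_not_nil (Walk.not_nil_of_ne huv)]
    simp only [Finset.mem_union, Walk.mem_edgesFinset]
    grind
  cycle F hF := by
    have : F.1 = A.edgesFinset ∪ B.edgesFinset := by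
      simp only [Finset.mem_insert, Finset.mem_singleton] at hF
      rcases hF with rfl | rfl <;> rfl
    rw [this]
    exact isCycleSet_union huv hA hB hAB.1 hAB.2
  subset F hF := by
    simp only [Finset.mem_insert, Finset.mem_singleton] at hF
    rcases hF with rfl | rfl <;> exact subset_rfl
  two e he := by
    rw [Finset.sum_pair (by simp)]
    simp only [if_pos he]
  euler := by
    have h1 := card_union_support (S := A.support.toFinset) hB huv (by simp) (by simp)
      fun x hx hx' ↦ hAB.1 x (by simpa using hx') hx
    have h2 : A.support.toFinset.card = A.edgesFinset.card + 1 := by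
      rw [List.toFinset_card_of_nodup hA.support_nodup, Walk.edgesFinset,
        List.toFinset_card_of_nodup hA.isTrail.edges_nodup, Walk.length_support, Walk.length_edges]
    have h3 : (A.edgesFinset ∪ B.edgesFinset).card = A.edgesFinset.card + B.edgesFinset.card :=
      Finset.card_union_of_disjoint (Finset.disjoint_left.2 fun e he he' ↦
        hAB.2 e (Walk.mem_edgesFinset.1 he) (Walk.mem_edgesFinset.1 he'))
    rw [Finset.card_pair (by simp)]
    omega
  sum := by
    rw [Finset.sum_pair (by simp), zero_add]
  off F hF e he heF := by
    simp only [Finset.mem_insert, Finset.mem_singleton] at hF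
    rcases hF with rfl | rfl <;> exact absurd he heF
  sep F hF F' hF' hne e he heF heF' h1 h2 := by
    simp only [Finset.mem_insert, Finset.mem_singleton] at hF hF'
    rcases hF with rfl | rfl <;> rcases hF' with rfl | rfl <;>
      simp only [ne_eq, not_true_eq_false] at hne <;> simp only [faceSide] at h1 h2 <;> grind
  coboundary φ hφ := by
    have h0 := hφ _ (Finset.mem_insert_self _ _)
    rw [sum_union_edgesFinset hAB] at h0
    have path_potential : ∃ g : V → ZMod 2, g u = 0 ∧
        ∀ a b, s(a, b) ∈ A.edges → φ s(a, b) = g a + g b := by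
      obtain ⟨g, hg, hg'⟩ := Walk.exists_potential hA φ
        (Function.update 0 v (∑ e ∈ A.edgesFinset, φ e)) (by
          rw [Function.update_self, Function.update_of_ne huv, Pi.zero_apply, zero_add])
      refine ⟨g, ?_, hg'⟩
      rw [hg u fun _ ↦ Or.inl rfl, Function.update_of_ne huv, Pi.zero_apply]
    obtain ⟨g, -, hg⟩ := path_potential
    have hsum := Walk.sum_edgesFinset_eq_add hA hg
    obtain ⟨g', hg', hφ'⟩ := Walk.exists_potential hB φ g (by grind)
    refine ⟨g', fun a b hab ↦ ?_⟩
    rw [Finset.mem_union, Walk.mem_edgesFinset, Walk.mem_edgesFinset] at hab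
    rcases hab with hab | hab
    · rw [hg a b hab, hg' a (hAB.1 a (Walk.fst_mem_support_of_mem_edges _ hab)),
        hg' b (hAB.1 b (Walk.snd_mem_support_of_mem_edges _ hab))]
    · exact hφ' a b hab

set_option maxHeartbeats 1000000 in
theorem IsFaceSystem.exists_larger {E : Finset (Sym2 V)} {S : Finset V}
    {Φ : Finset (Finset (Sym2 V) × ZMod 2)} (h : IsFaceSystem G κ E S Φ)
    (hκ : IsSeparation G κ) (hG : TwoConnected G) {e : Sym2 V} (he : e ∈ G.edgeSet) (heE : e ∉ E)
    (hS : S.Nontrivial) :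
    ∃ E' S' Φ', IsFaceSystem G κ E' S' Φ' ∧ S ⊆ S' ∧ E ⊂ E' := by
  have hES : ∀ e ∈ E, ∀ x ∈ e, x ∈ S := fun e he x hx ↦ (h.mem_iff x).2 ⟨e, he, hx⟩
  obtain ⟨s₀, hs₀⟩ := hS.nonempty
  obtain ⟨u, hu, w, huw, huwE, -⟩ := hG.exists_adj_mem hs₀ hES he heE
  obtain ⟨t, ht, htu⟩ := hS.exists_ne u
  obtain ⟨v, hv, hvu, P, hP, hfP, hPS, hPE⟩ := hG.exists_ear hu ht htu huw
  have huv : u ≠ v := hvu.symm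
  have hPE' : ∀ g ∈ P.edges, g ∉ E := fun g hg hgE ↦
    huwE (hPE g hg (hES g hgE) ▸ hgE)
  obtain ⟨F, hF, hFf⟩ := h.exists_faceSide_eq_one (κ := κ) s(u, w)
  have const : ∀ F' ∈ Φ, ∀ g ∈ P.edges, faceSide κ F' g = faceSide κ F' s(u, w) := by
    intro F' hF' g hg
    refine eq_of_mem_edges_of_isPath (ψ := faceSide κ F') hP (fun z hz hzu hzv a b ha hb ↦ ?_)
      hg hfP
    exact faceSide_eq_of_not_mem hκ (h.cycle F' hF') (fun e he hze ↦
      (hPS z hz (hES e (h.subset F' hF' he) z hze)).elim hzu hzv) ha hb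
  have ends : ∀ x ∈ S, ∀ y, s(x, y) ∈ P.edges → ∃ e ∈ F.1, x ∈ e := by
    intro x hx y hxy
    by_contra hne
    push Not at hne
    obtain ⟨e, heE, hxe⟩ := (h.mem_iff x).1 hx
    obtain ⟨b, rfl⟩ := Sym2.mem_iff_exists.1 hxe
    have h0 := h.off F hF _ heE fun hmem ↦ hne _ hmem hxe
    rw [← faceSide_eq_of_not_mem hκ (h.cycle F hF) hne (P.adj_of_mem_edges hxy)
      (h.edgeSet _ heE), const F hF _ hxy, hFf] at h0
    exact absurd h0 (by decide)
  obtain ⟨y, -, hvy⟩ := exists_mem_edges_of_mem_support huv P.end_mem_support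
  obtain ⟨A, B, hA, hB, hABs, hABe, hFAB⟩ := (h.cycle F hF).exists_split huv
    (ends u hu w hfP) (ends v hv y hvy)
  have hAB : IntDisjoint A B := ⟨hABs, hABe⟩
  have subE : ∀ g, g ∈ A.edges ∨ g ∈ B.edges → g ∈ E := fun g hg ↦
    h.subset F hF (by rw [hFAB, Finset.mem_union, Walk.mem_edgesFinset, Walk.mem_edgesFinset]
                      exact hg)
  have subS : ∀ C : G.Walk u v, (∀ g ∈ C.edges, g ∈ E) → ∀ x ∈ C.support, x ∈ S := by
    intro C hC x hx
    obtain ⟨b, -, hb⟩ := exists_mem_edges_of_mem_support huv hx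
    exact hES _ (hC _ hb) x (by simp)
  have hAP : IntDisjoint A P :=
    ⟨fun x hx hx' ↦ hPS x hx' (subS A (fun g hg ↦ subE g (Or.inl hg)) x hx),
      fun g hg hg' ↦ hPE' g hg' (subE g (Or.inl hg))⟩
  have hBP : IntDisjoint B P :=
    ⟨fun x hx hx' ↦ hPS x hx' (subS B (fun g hg ↦ subE g (Or.inr hg)) x hx),
      fun g hg hg' ↦ hPE' g hg' (subE g (Or.inr hg))⟩
  obtain ⟨a', -, ha⟩ := exists_mem_edges_of_mem_support huv A.start_mem_support
  obtain ⟨b', -, hb⟩ := exists_mem_edges_of_mem_support huv B.start_mem_support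
  set a := s(u, a')
  set b := s(u, b')
  set c₁ := walkSide κ A b + walkSide κ P b with hc₁
  set c₂ := walkSide κ B a + walkSide κ P a with hc₂
  set F₁ : Finset (Sym2 V) × ZMod 2 := (A.edgesFinset ∪ P.edgesFinset, c₁) with hF₁
  set F₂ : Finset (Sym2 V) × ZMod 2 := (B.edgesFinset ∪ P.edgesFinset, c₂) with hF₂
  have memF : ∀ g, g ∈ F.1 ↔ g ∈ A.edges ∨ g ∈ B.edges := fun g ↦ by
    rw [hFAB, Finset.mem_union, Walk.mem_edgesFinset, Walk.mem_edgesFinset]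
  have memF₁ : ∀ g, g ∈ F₁.1 ↔ g ∈ A.edges ∨ g ∈ P.edges := fun g ↦ by
    rw [hF₁, Finset.mem_union, Walk.mem_edgesFinset, Walk.mem_edgesFinset]
  have memF₂ : ∀ g, g ∈ F₂.1 ↔ g ∈ B.edges ∨ g ∈ P.edges := fun g ↦ by
    rw [hF₂, Finset.mem_union, Walk.mem_edgesFinset, Walk.mem_edgesFinset]
  have l1 : ∀ g, faceSide κ F₁ g = c₁ + (walkSide κ A g + walkSide κ P g) :=
    faceSide_union hAP c₁
  have l2 : ∀ g, faceSide κ F₂ g = c₂ + (walkSide κ B g + walkSide κ P g) :=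
    faceSide_union hBP c₂
  have l0 : ∀ g, faceSide κ F g = F.2 + (walkSide κ A g + walkSide κ B g) := fun g ↦ by
    rw [← faceSide_union hAB, ← hFAB]
  have hc : F.2 = c₁ + c₂ := by
    have h1 := (hκ.theta_three huv hA hB hP hAB hAP hBP ha hb hfP).1
    have h2 := l0 s(u, w)
    rw [hFf] at h2
    grind
  have ladd : ∀ g, faceSide κ F g = faceSide κ F₁ g + faceSide κ F₂ g := fun g ↦ by
    rw [l0, l1, l2, hc]
    grind
  have notboth : ∀ g ∈ G.edgeSet, g ∉ A.edges → g ∉ B.edges → g ∉ P.edges →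
      faceSide κ F₁ g = 1 → faceSide κ F₂ g = 1 → False := by
    intro g hg hgA hgB hgP e1 e2
    rw [l1] at e1
    rw [l2] at e2
    exact hκ.not_both_sides hG huv hA hB hP hAB hAP hBP ha hb hg hgA hgB hgP e1 e2
  have offB : ∀ g ∈ B.edges, faceSide κ F₁ g = 0 := by
    intro g hg
    rw [l1, hκ.walkSide_add_eq_of_mem huv hA hP hB hAP hAB hBP.symm hg hb]
    grind
  have offA : ∀ g ∈ A.edges, faceSide κ F₂ g = 0 := by
    intro g hg
    rw [l2, hκ.walkSide_add_eq_of_mem huv hB hP hA hBP hAB.symm hAP.symm hg ha]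
    grind
  have zmod : ∀ x y : ZMod 2, (x = 1 → y = 1 → False) → x + y = 0 → x = 0 ∧ y = 0 := by decide
  have zmod' : ∀ x y : ZMod 2, (x = 1 → y = 1 → False) → (x = 1 ∨ y = 1) → x + y = 1 := by decide
  have hP0 : ∀ F' ∈ Φ, F' ≠ F → ∀ g ∈ P.edges, faceSide κ F' g = 0 := by
    intro F' hF' hne g hg
    have hsep := h.sep F hF F' hF' hne.symm g (P.edges_subset_edgeSet hg)
      (fun h' ↦ hPE' g hg (h.subset F hF h')) (fun h' ↦ hPE' g hg (h.subset F' hF' h'))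
      (by rw [const F hF g hg, hFf])
    generalize faceSide κ F' g = x at hsep
    revert hsep; revert x; decide
  have hF₁Φ : F₁ ∉ Φ := fun h' ↦
    hPE' _ hfP (h.subset F₁ h' ((memF₁ _).2 (Or.inr hfP)))
  have hF₂Φ : F₂ ∉ Φ := fun h' ↦
    hPE' _ hfP (h.subset F₂ h' ((memF₂ _).2 (Or.inr hfP)))
  have h12 : F₁ ≠ F₂ := fun h' ↦ by
    have := (memF₂ a).1 (h' ▸ (memF₁ a).2 (Or.inl ha))
    exact this.elim (hAB.2 a ha) (hAP.2 a ha)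
  have hsum : ∀ {M : Type} [AddCommMonoid M] (f : _ → M), _ := fun {M} _ f ↦
    sum_insert_insert_erase (M := M) hF hF₁Φ hF₂Φ h12 f
  have memΦ : ∀ F' ∈ insert F₁ (insert F₂ (Φ.erase F)),
      F' = F₁ ∨ F' = F₂ ∨ (F' ∈ Φ ∧ F' ≠ F) := by
    intro F' hF'
    simp only [Finset.mem_insert, Finset.mem_erase] at hF'
    tauto
  have memE : ∀ g, g ∈ E ∪ P.edgesFinset ↔ g ∈ E ∨ g ∈ P.edges := fun g ↦ by
    rw [Finset.mem_union, Walk.mem_edgesFinset]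
  have sep₁ : ∀ F' ∈ Φ, F' ≠ F → ∀ g ∈ G.edgeSet, g ∉ F'.1 → (g ∉ F₁.1 → faceSide κ F₁ g = 1 →
      faceSide κ F' g = 1 → False) ∧ (g ∉ F₂.1 → faceSide κ F₂ g = 1 →
      faceSide κ F' g = 1 → False) := by
    intro F' hF' hne g hg hgF'
    have key : g ∉ P.edges → g ∉ F.1 → (faceSide κ F₁ g = 1 ∨ faceSide κ F₂ g = 1) →
        faceSide κ F' g = 1 → False := by
      intro hgP hgF h1 h'
      have hgF2 := hgF
      rw [memF] at hgF
      push Not at hgF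
      exact h.sep F hF F' hF' hne.symm g hg hgF2 hgF'
        ((ladd g).trans (zmod' _ _ (notboth g hg hgF.1 hgF.2 hgP) h1)) h'
    constructor
    · intro hg1 h1 h'
      rw [memF₁] at hg1
      push Not at hg1
      refine key hg1.2 (fun hgF ↦ ?_) (Or.inl h1) h'
      have := offB g (((memF g).1 hgF).resolve_left hg1.1)
      rw [h1] at this
      exact absurd this (by decide)
    · intro hg1 h1 h'
      rw [memF₂] at hg1
      push Not at hg1
      refine key hg1.2 (fun hgF ↦ ?_) (Or.inr h1) h'
      have := offA g (((memF g).1 hgF).resolve_right hg1.1)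
      rw [h1] at this
      exact absurd this (by decide)
  have sep₂ : ∀ g ∈ G.edgeSet, g ∉ F₁.1 → g ∉ F₂.1 → faceSide κ F₁ g = 1 →
      faceSide κ F₂ g = 1 → False := by
    intro g hg h1 h2
    rw [memF₁] at h1
    rw [memF₂] at h2
    push Not at h1 h2
    exact notboth g hg h1.1 h2.1 h1.2
  refine ⟨E ∪ P.edgesFinset, S ∪ P.support.toFinset, insert F₁ (insert F₂ (Φ.erase F)), ?_,
    Finset.subset_union_left, ?_⟩
  swap
  · refine Finset.ssubset_iff_subset_ne.2 ⟨Finset.subset_union_left, fun h' ↦ ?_⟩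
    exact hPE' _ hfP (h' ▸ (memE _).2 (Or.inr hfP))
  constructor
  · intro g hg
    exact ((memE g).1 hg).elim (h.edgeSet g) (P.edges_subset_edgeSet ·)
  · intro x
    rw [Finset.mem_union, List.mem_toFinset, h.mem_iff,
      Walk.mem_support_iff_exists_mem_edges_of_not_nil (Walk.not_nil_of_ne huv)]
    simp only [memE, or_and_right, exists_or]
  · intro F' hF'
    rcases memΦ F' hF' with rfl | rfl | ⟨h', -⟩
    · exact isCycleSet_union huv hA hP hAP.1 hAP.2
    · exact isCycleSet_union huv hB hP hBP.1 hBP.2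
    · exact h.cycle F' h'
  · intro F' hF' g hg
    rw [memE]
    rcases memΦ F' hF' with rfl | rfl | ⟨h', -⟩
    · exact ((memF₁ g).1 hg).imp (fun h ↦ subE g (Or.inl h)) id
    · exact ((memF₂ g).1 hg).imp (fun h ↦ subE g (Or.inr h)) id
    · exact Or.inl (h.subset F' h' hg)
  · intro g hg
    have hs := hsum fun F' ↦ if g ∈ F'.1 then 1 else 0
    simp only [memF₁, memF₂, memF] at hs
    by_cases hgP : g ∈ P.edges
    · have hgE := hPE' g hgP
      have h0 : (∑ F' ∈ Φ, if g ∈ F'.1 then 1 else 0) = 0 :=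
        Finset.sum_eq_zero fun F' hF' ↦ if_neg fun h' ↦ hgE (h.subset F' hF' h')
      have h1 : ¬ (g ∈ A.edges ∨ g ∈ B.edges) := fun h' ↦ hgE (subE g h')
      rw [h0, if_neg h1] at hs
      simp only [hgP, or_true, if_true] at hs
      omega
    · have hgE : g ∈ E := ((memE g).1 hg).resolve_right hgP
      rw [h.two g hgE] at hs
      simp only [hgP, or_false] at hs
      have hdis := hAB.2 g
      by_cases hgA : g ∈ A.edges
      · simp only [hgA, hdis hgA, true_or, if_true, if_false] at hs
        omega
      · by_cases hgB : g ∈ B.edges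
        · simp only [hgA, hgB, or_true, if_true, if_false] at hs
          omega
        · simp only [hgA, hgB, or_false, if_false] at hs
          omega
  · have h1 := card_union_support hP huv hu hv hPS
    have h2 : (E ∪ P.edgesFinset).card = E.card + P.edgesFinset.card :=
      Finset.card_union_of_disjoint (Finset.disjoint_left.2 fun g hg hg' ↦
        hPE' g (Walk.mem_edgesFinset.1 hg') hg)
    have h3 := hsum fun _ ↦ 1
    simp only [Finset.sum_const, smul_eq_mul, mul_one] at h3
    have h4 := h.euler
    omega
  · have h3 := hsum fun F' ↦ F'.2
    simp only at h3
    rw [h.sum, hc] at h3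
    simp only [hF₁, hF₂] at h3 ⊢
    grind
  · intro F' hF' g hg hgF'
    rcases memΦ F' hF' with rfl | rfl | ⟨h', hne⟩
    · rw [memF₁] at hgF'
      push Not at hgF'
      have hgE : g ∈ E := ((memE g).1 hg).resolve_right hgF'.2
      by_cases hgB : g ∈ B.edges
      · exact offB g hgB
      · have h0 := h.off F hF g hgE fun h' ↦ ((memF g).1 h').elim hgF'.1 hgB
        rw [ladd] at h0
        exact (zmod _ _ (notboth g (h.edgeSet g hgE) hgF'.1 hgB hgF'.2) h0).1
    · rw [memF₂] at hgF'
      push Not at hgF'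
      have hgE : g ∈ E := ((memE g).1 hg).resolve_right hgF'.2
      by_cases hgA : g ∈ A.edges
      · exact offA g hgA
      · have h0 := h.off F hF g hgE fun h' ↦ ((memF g).1 h').elim hgA hgF'.1
        rw [ladd] at h0
        exact (zmod _ _ (notboth g (h.edgeSet g hgE) hgA hgF'.1 hgF'.2) h0).2
    · rcases (memE g).1 hg with hgE | hgP
      · exact h.off F' h' g hgE hgF'
      · exact hP0 F' h' hne g hgP
  · intro X hX Y hY hne g hg hgX hgY h1 h2
    rcases memΦ X hX with rfl | rfl | ⟨hX, hXF⟩ <;> rcases memΦ Y hY with rfl | rfl | ⟨hY, hYF⟩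
    · exact hne rfl
    · exact sep₂ g hg hgX hgY h1 h2
    · exact (sep₁ Y hY hYF g hg hgY).1 hgX h1 h2
    · exact sep₂ g hg hgY hgX h2 h1
    · exact hne rfl
    · exact (sep₁ Y hY hYF g hg hgY).2 hgX h1 h2
    · exact (sep₁ X hX hXF g hg hgX).1 hgY h2 h1
    · exact (sep₁ X hX hXF g hg hgX).2 hgY h2 h1
    · exact h.sep X hX Y hY hne g hg hgX hgY h1 h2
  · intro φ hφ
    have s1 : ∑ e ∈ F₁.1, φ e = 0 := hφ _ (by simp)
    have s2 : ∑ e ∈ F₂.1, φ e = 0 := hφ _ (by simp)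
    simp only [hF₁, hF₂] at s1 s2
    rw [sum_union_edgesFinset hAP] at s1
    rw [sum_union_edgesFinset hBP] at s2
    obtain ⟨g, hg⟩ := h.coboundary φ fun F' hF' ↦ by
      by_cases hne : F' = F
      · rw [hne, hFAB, sum_union_edgesFinset hAB]
        grind
      · exact hφ F' (by simp [hne, hF'])
    have s3 := Walk.sum_edgesFinset_eq_add hA fun x y hxy ↦ hg x y (subE _ (Or.inl hxy))
    obtain ⟨g', hg', hφ'⟩ := Walk.exists_potential hP φ g (by grind)
    refine ⟨g', fun x y hxy ↦ ?_⟩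
    rcases (memE _).1 hxy with hxy | hxy
    · rw [hg x y hxy, hg' x fun hx ↦ hPS x hx (hES _ hxy x (by simp)),
        hg' y fun hy ↦ hPS y hy (hES _ hxy y (by simp))]
    · exact hφ' x y hxy

end Faces

section Faces

variable {V : Type*} [DecidableEq V] {G : SimpleGraph V}

theorem IsFaceSystem.exists_univ [Fintype V] {κ : Sym2 V → Sym2 V → ZMod 2}
    (hκ : IsSeparation G κ) (hG : TwoConnected G) (hV : 3 ≤ Fintype.card V) :
    ∃ E Φ, (∀ e, e ∈ E ↔ e ∈ G.edgeSet) ∧ IsFaceSystem G κ E Finset.univ Φ := by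
  have nb : ∀ x, ∃ y, G.Adj x y := by
    intro x
    obtain ⟨a, ha, b, hb, hab⟩ : ∃ a, a ≠ x ∧ ∃ b, b ≠ x ∧ a ≠ b := by
      have h1 : 1 < (Finset.univ.erase x).card := by
        rw [Finset.card_erase_of_mem (Finset.mem_univ x), Finset.card_univ]
        omega
      obtain ⟨a, ha, b, hb, hab⟩ := Finset.one_lt_card.1 h1
      exact ⟨a, Finset.ne_of_mem_erase ha, b, Finset.ne_of_mem_erase hb, hab⟩
    obtain ⟨p, -⟩ := hG b x a hb.symm hab
    cases p with
    | nil => exact absurd rfl ha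
    | cons h _ => exact ⟨_, h⟩
  have start : ∃ E S Φ, IsFaceSystem G κ E S Φ ∧ S.Nontrivial := by
    obtain ⟨s⟩ : Nonempty V := Fintype.card_pos_iff.1 (by omega)
    obtain ⟨w, hsw⟩ := nb s
    obtain ⟨x, hx⟩ : ∃ x, x ∉ ({s, w} : Finset V) := by
      by_contra! h
      have := Finset.card_le_card (fun y _ ↦ h y : Finset.univ ⊆ ({s, w} : Finset V))
      rw [Finset.card_univ, Finset.card_pair hsw.ne] at this
      omega
    obtain ⟨y, hxy⟩ := nb x
    have hxs : s(x, y) ∉ ({s(s, w)} : Finset (Sym2 V)) := by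
      rw [Finset.mem_singleton]
      intro h
      have : x ∈ s(s, w) := h ▸ Sym2.mem_mk_left x y
      exact hx (by simpa using this)
    obtain ⟨u, hu, c, huc, hucE, -⟩ := hG.exists_adj_mem (T := {s, w}) (Finset.mem_insert_self _ _)
      (E := {s(s, w)}) (by simp) (e := s(x, y)) hxy hxs
    obtain ⟨t, ht, htu⟩ : ∃ t ∈ ({s, w} : Finset V), t ≠ u := by
      by_cases h : s = u
      · exact ⟨w, by simp, h ▸ hsw.ne'⟩
      · exact ⟨s, by simp, h⟩
    obtain ⟨v, hv, hvu, Q, hQ, -, hQT, hQE⟩ := hG.exists_ear hu ht htu huc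
    have hpair : s(u, v) = s(s, w) := by
      simp only [Finset.mem_insert, Finset.mem_singleton] at hu hv
      rcases hu with rfl | rfl <;> rcases hv with rfl | rfl
      · exact absurd rfl hvu
      · rfl
      · exact Sym2.eq_swap
      · exact absurd rfl hvu
    have huv : G.Adj u v := by
      rw [← SimpleGraph.mem_edgeSet, hpair]
      exact hsw
    refine ⟨_, _, _, IsFaceSystem.of_paths huv.ne (A := .cons huv .nil) (B := Q)
      (by simp [huv.ne]) hQ ⟨fun x hx _ ↦ by simpa using hx, fun e he heQ ↦ ?_⟩,
      ⟨u, by simp, v, by simp, huv.ne⟩⟩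
    have he' : e = s(u, v) := by simpa using he
    refine hucE ?_
    rw [← hQE e heQ, he', hpair]
    · simp
    · rw [he', hpair]
      simp
  have key : ∀ n : ℕ, ∀ E S Φ, IsFaceSystem G κ E S Φ → S.Nontrivial →
      Fintype.card (Sym2 V) - E.card ≤ n →
      ∃ E Φ, (∀ e, e ∈ E ↔ e ∈ G.edgeSet) ∧ IsFaceSystem G κ E Finset.univ Φ := by
    intro n
    induction n with
    | zero =>
      intro E S Φ h hS hn
      have hE : E = Finset.univ := Finset.card_eq_iff_eq_univ _ |>.1
        (le_antisymm (Finset.card_le_univ _) (by omega))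
      have hSu : S = Finset.univ := by
        ext x
        obtain ⟨y, hxy⟩ := nb x
        simp only [Finset.mem_univ, iff_true]
        exact (h.mem_iff x).2 ⟨s(x, y), by simp [hE], by simp⟩
      exact ⟨E, Φ, fun e ↦ ⟨h.edgeSet e, fun _ ↦ by simp [hE]⟩, hSu ▸ h⟩
    | succ n ih =>
      intro E S Φ h hS hn
      by_cases hE : ∀ e ∈ G.edgeSet, e ∈ E
      · have hSu : S = Finset.univ := by
          ext x
          obtain ⟨y, hxy⟩ := nb x
          simp only [Finset.mem_univ, iff_true]
          exact (h.mem_iff x).2 ⟨s(x, y), hE _ hxy, by simp⟩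
        exact ⟨E, Φ, fun e ↦ ⟨h.edgeSet e, hE e⟩, hSu ▸ h⟩
      · push Not at hE
        obtain ⟨e, he, heE⟩ := hE
        obtain ⟨E', S', Φ', h', hSS, hEE⟩ := h.exists_larger hκ hG he heE hS
        have h1 := Finset.card_lt_card hEE
        have h2 := Finset.card_le_univ E'
        exact ih E' S' Φ' h' (hS.mono hSS) (by omega)
  obtain ⟨E, S, Φ, h, hS⟩ := start
  exact key _ E S Φ h hS le_rfl

theorem IsCycleSet.exists_two {F : Finset (Sym2 V)} (hF : IsCycleSet G F) {v z : V}
    (hz : s(v, z) ∈ F) : ∃ x y, x ≠ y ∧ ∀ z, s(v, z) ∈ F ↔ z = x ∨ z = y := by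
  obtain ⟨u, c, hc, rfl⟩ := hF
  have hv : v ∈ c.support := Walk.fst_mem_support_of_mem_edges c (List.mem_toFinset.1 hz)
  obtain ⟨x, y, hxy, h⟩ := Set.ncard_eq_two.1 (hc.ncard_neighborSet_toSubgraph_eq_two hv)
  refine ⟨x, y, hxy, fun z ↦ ?_⟩
  have : z ∈ c.toSubgraph.neighborSet v ↔ z = x ∨ z = y := by rw [h]; simp
  rw [← this, Subgraph.mem_neighborSet, List.mem_toFinset, Walk.adj_toSubgraph_iff_mem_edges]

theorem IsCycleSet.subset_edgeSet {F : Finset (Sym2 V)} (hF : IsCycleSet G F) {e : Sym2 V}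
    (he : e ∈ F) : e ∈ G.edgeSet := by
  obtain ⟨u, c, hc, rfl⟩ := hF
  exact c.edges_subset_edgeSet (List.mem_toFinset.1 he)

/-- The boundaries of the faces of a plane graph. -/
structure IsFaceSet (G : SimpleGraph V) (Φ : Finset (Finset (Sym2 V))) : Prop where
  cycle : ∀ F ∈ Φ, IsCycleSet G F
  two : ∀ e ∈ G.edgeSet, (Φ.filter (e ∈ ·)).card = 2
  rotation : ∀ (v x y : V) (X : Set V), x ∈ X → y ∉ X → G.Adj v x → G.Adj v y →
    ∃ F ∈ Φ, ∃ x' ∈ X, ∃ y' ∉ X, s(v, x') ∈ F ∧ s(v, y') ∈ F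
  unique : ∀ F ∈ Φ, ∀ F' ∈ Φ, ∀ v x y, x ≠ y → s(v, x) ∈ F → s(v, y) ∈ F → s(v, x) ∈ F' →
    s(v, y) ∈ F' → F = F'

theorem exists_isFaceSet [Fintype V] {κ : Sym2 V → Sym2 V → ZMod 2}
    (hκ : IsSeparation G κ) (hG : TwoConnected G) (hV : 3 ≤ Fintype.card V)
    (hdeg : ∀ v x y, ∃ z, z ≠ x ∧ z ≠ y ∧ G.Adj v z) :
    ∃ Φ, IsFaceSet G Φ ∧ Φ.card + Fintype.card V = G.edgeSet.ncard + 2 := by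
  obtain ⟨E, Φ, hE, h⟩ := IsFaceSystem.exists_univ hκ hG hV
  have rot : ∀ (v x y : V) (X : Set V), x ∈ X → y ∉ X → G.Adj v x → G.Adj v y →
      ∃ F ∈ Φ, ∃ x' ∈ X, ∃ y' ∉ X, s(v, x') ∈ F.1 ∧ s(v, y') ∈ F.1 := by
    classical
    intro v x y X hx hy hvx hvy
    by_contra! hne
    set φ : Sym2 V → ZMod 2 := fun e ↦ if ∃ x ∈ X, e = s(v, x) then 1 else 0 with hφ
    have φv : ∀ z, φ s(v, z) = if z ∈ X then 1 else 0 := by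
      intro z
      simp only [hφ, Sym2.congr_right]
      by_cases hz : z ∈ X <;> simp [hz]
    have φn : ∀ a b, a ≠ v → b ≠ v → φ s(a, b) = 0 := by
      intro a b ha hb
      simp only [hφ]
      rw [if_neg]
      rintro ⟨x, -, h⟩
      have : v ∈ s(a, b) := h ▸ Sym2.mem_mk_left v x
      rcases Sym2.mem_iff.1 this with h | h
      · exact ha h.symm
      · exact hb h.symm
    obtain ⟨g, hg⟩ := h.coboundary φ fun F hF ↦ by
      by_cases hz : ∃ z, s(v, z) ∈ F.1
      · obtain ⟨z, hz⟩ := hz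
        obtain ⟨a, b, hab, hvF⟩ := (h.cycle F hF).exists_two hz
        have ha : s(v, a) ∈ F.1 := (hvF a).2 (Or.inl rfl)
        have hb : s(v, b) ∈ F.1 := (hvF b).2 (Or.inr rfl)
        rw [← Finset.sum_subset (s₁ := {s(v, a), s(v, b)})]
        · rw [Finset.sum_pair (by rwa [Ne, Sym2.congr_right]), φv, φv]
          by_cases haX : a ∈ X <;> by_cases hbX : b ∈ X
          · simp only [haX, hbX, if_true]; decide
          · exact absurd hb (hne F hF a haX b hbX ha)
          · exact absurd ha (hne F hF b hbX a haX hb)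
          · simp [haX, hbX]
        · intro e he
          simp only [Finset.mem_insert, Finset.mem_singleton] at he
          rcases he with rfl | rfl <;> assumption
        · intro e he he'
          induction e with
          | h c d =>
            refine φn c d ?_ ?_
            · rintro rfl
              rcases (hvF d).1 he with rfl | rfl <;> simp at he'
            · rintro rfl
              rw [Sym2.eq_swap] at he he'
              rcases (hvF c).1 he with rfl | rfl <;> simp at he'
      · push Not at hz
        refine Finset.sum_eq_zero fun e he ↦ ?_
        induction e with
        | h c d =>
          refine φn c d ?_ ?_
          · rintro rfl
            exact hz d he
          · rintro rfl
            rw [Sym2.eq_swap] at he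
            exact hz c he
    have gconst : ∀ a b, ∀ p : G.Walk a b, v ∉ p.support → g a = g b := by
      intro a b p hp
      induction p with
      | nil => rfl
      | @cons a c b hac p ih =>
        rw [Walk.support_cons, List.mem_cons, not_or] at hp
        have h1 := hg a c ((hE _).2 hac)
        rw [φn a c (fun h ↦ hp.1 h.symm) (fun h ↦ hp.2 (h ▸ p.start_mem_support))] at h1
        rw [← ih hp.2]
        grind
    obtain ⟨p, hp⟩ := hG v x y hvx.ne' hvy.ne'
    have h1 := hg v x ((hE _).2 hvx)
    have h2 := hg v y ((hE _).2 hvy)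
    rw [φv, if_pos hx] at h1
    rw [φv, if_neg hy] at h2
    rw [gconst x y p hp, ← h2] at h1
    exact absurd h1 (by decide)
  have two : ∀ e ∈ G.edgeSet, (Φ.filter (e ∈ ·.1)).card = 2 := by
    intro e he
    rw [Finset.card_filter]
    exact h.two e ((hE e).2 he)
  have uniq : ∀ F ∈ Φ, ∀ F' ∈ Φ, ∀ v x y, x ≠ y → s(v, x) ∈ F.1 → s(v, y) ∈ F.1 →
      s(v, x) ∈ F'.1 → s(v, y) ∈ F'.1 → F = F' := by
    intro F hF F' hF' v x y hxy hx hy hx' hy'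
    by_contra hne
    obtain ⟨z, hzx, hzy, hvz⟩ := hdeg v x y
    obtain ⟨F'', hF'', a, ha, b, hb, haF, hbF⟩ := rot v x z {x, y} (by simp) (by simp [hzx, hzy])
      ((h.cycle F hF).subset_edgeSet hx) hvz
    have noext : ∀ F ∈ Φ, s(v, x) ∈ F.1 → s(v, y) ∈ F.1 → ∀ c, s(v, c) ∈ F.1 → c = x ∨ c = y := by
      intro F hF hx hy c hc
      obtain ⟨a, b, -, h2⟩ := (h.cycle F hF).exists_two hx
      rw [h2] at hx hy hc
      grind
    have ha' : s(v, a) ∈ F.1 ∧ s(v, a) ∈ F'.1 := by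
      rcases ha with rfl | rfl <;> constructor <;> assumption
    have hb' : ¬ (b = x ∨ b = y) := by simpa using hb
    have h1 : F'' ≠ F := by
      rintro rfl
      exact hb' (noext _ hF hx hy b hbF)
    have h2 : F'' ≠ F' := by
      rintro rfl
      exact hb' (noext _ hF' hx' hy' b hbF)
    have h3 : ({F, F', F''} : Finset _) ⊆ Φ.filter (s(v, a) ∈ ·.1) := by
      intro X hX
      simp only [Finset.mem_insert, Finset.mem_singleton] at hX
      rw [Finset.mem_filter]
      rcases hX with rfl | rfl | rfl
      · exact ⟨hF, ha'.1⟩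
      · exact ⟨hF', ha'.2⟩
      · exact ⟨hF'', haF⟩
    have h4 := Finset.card_le_card h3
    rw [two _ ((h.cycle F hF).subset_edgeSet ha'.1), Finset.card_eq_three.2
      ⟨F, F', F'', hne, h1.symm, h2.symm, rfl⟩] at h4
    omega
  have inj : Set.InjOn Prod.fst (Φ : Set (Finset (Sym2 V) × ZMod 2)) := by
    intro F hF F' hF' hFF
    obtain ⟨u, c, hc, hcF⟩ := h.cycle F hF
    obtain ⟨e, he⟩ : ∃ e, e ∈ F.1 := by
      rw [← hcF]
      have := hc.three_le_length
      cases c with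
      | nil => simp at this
      | @cons _ w _ h p => exact ⟨s(u, w), by simp⟩
    induction e with
    | h a b =>
      obtain ⟨x, y, hxy, h2⟩ := (h.cycle F hF).exists_two he
      have hx := (h2 x).2 (Or.inl rfl)
      have hy := (h2 y).2 (Or.inr rfl)
      exact uniq F hF F' hF' a x y hxy hx hy (hFF ▸ hx) (hFF ▸ hy)
  refine ⟨Φ.image Prod.fst, ⟨?_, ?_, ?_, ?_⟩, ?_⟩
  · intro F hF
    obtain ⟨F, hF', rfl⟩ := Finset.mem_image.1 hF
    exact h.cycle F hF'
  · intro e he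
    refine Eq.trans ?_ (two e he)
    rw [Finset.filter_image, Finset.card_image_of_injOn]
    exact inj.mono fun F hF ↦ (Finset.mem_filter.1 hF).1
  · intro v x y X hx hy hvx hvy
    obtain ⟨F, hF, h⟩ := rot v x y X hx hy hvx hvy
    exact ⟨F.1, Finset.mem_image_of_mem _ hF, h⟩
  · intro F hF F' hF' v x y hxy h1 h2 h3 h4
    obtain ⟨F, hF₀, rfl⟩ := Finset.mem_image.1 hF
    obtain ⟨F', hF₀', rfl⟩ := Finset.mem_image.1 hF'
    rw [uniq F hF₀ F' hF₀' v x y hxy h1 h2 h3 h4]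
  · rw [Finset.card_image_of_injOn inj, ← Finset.card_univ, h.euler]
    congr 1
    rw [← Set.ncard_coe_finset]
    congr 1
    ext e
    exact hE e

end Faces

section LocalStructure

variable {V : Type*} [DecidableEq V] {G : SimpleGraph V}

theorem IsCycleSet.three_le_card {F : Finset (Sym2 V)} (hF : IsCycleSet G F) : 3 ≤ F.card := by
  obtain ⟨u, c, hc, rfl⟩ := hF
  rw [List.toFinset_card_of_nodup hc.edges_nodup, Walk.length_edges]
  exact hc.three_le_length

omit [DecidableEq V] in
theorem Walk.edges_eq_singleton_of_mem {u v : V} {P : G.Walk u v} (hP : P.IsPath)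
    (h : s(u, v) ∈ P.edges) : P.edges = [s(u, v)] := by
  cases P with
  | nil => simp at h
  | @cons _ b _ h' P =>
    have hP' := (Walk.cons_isPath_iff _ _).1 hP
    rw [Walk.edges_cons, List.mem_cons] at h
    rcases h with h | h
    · obtain rfl : v = b := Sym2.congr_right.1 h
      rw [Walk.edges_cons, (Walk.isPath_iff_nil.1 hP'.1).eq_nil, Walk.edges_nil]
    · exact absurd (Walk.fst_mem_support_of_mem_edges _ h) hP'.2

theorem IsCycleSet.exists_path {F : Finset (Sym2 V)} (hF : IsCycleSet G F) {a b : V}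
    (hab : s(a, b) ∈ F) : ∃ P : G.Walk b a, P.IsPath ∧ F = insert s(a, b) P.edgesFinset ∧
      F.card = P.length + 1 := by
  have hne : a ≠ b := G.ne_of_adj (hF.subset_edgeSet hab)
  obtain ⟨A, B, hA, hB, -, hE, rfl⟩ := hF.exists_split hne ⟨_, hab, by simp⟩ ⟨_, hab, by simp⟩
  have key : ∀ A B : G.Walk a b, A.IsPath → B.IsPath → (∀ e ∈ A.edges, e ∉ B.edges) →
      s(a, b) ∈ A.edges → ∃ P : G.Walk b a, P.IsPath ∧
      A.edgesFinset ∪ B.edgesFinset = insert s(a, b) P.edgesFinset ∧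
      (A.edgesFinset ∪ B.edgesFinset).card = P.length + 1 := by
    intro A B hA hB hE hab
    have hA' : A.edgesFinset = {s(a, b)} := by
      rw [Walk.edgesFinset, Walk.edges_eq_singleton_of_mem hA hab]
      rfl
    have hB' : B.reverse.edgesFinset = B.edgesFinset := by
      ext e
      simp [Walk.mem_edgesFinset]
    refine ⟨B.reverse, hB.reverse, ?_, ?_⟩
    · rw [hA', hB']
      rfl
    · rw [hA', ← Finset.insert_eq, Finset.card_insert_of_notMem
        (fun h ↦ hE _ hab (Walk.mem_edgesFinset.1 h)), Walk.edgesFinset,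
        List.toFinset_card_of_nodup hB.isTrail.edges_nodup, Walk.length_edges, Walk.length_reverse]
  rcases Finset.mem_union.1 hab with h | h
  · exact key A B hA hB hE (Walk.mem_edgesFinset.1 h)
  · rw [Finset.union_comm]
    exact key B A hB hA (fun e he he' ↦ hE e he' he) (Walk.mem_edgesFinset.1 h)

/-- The edge set of a triangle. -/
def tri (a b c : V) : Finset (Sym2 V) := {s(a, b), s(b, c), s(a, c)}

theorem tri_rotate (a b c : V) : tri b c a = tri a b c := by
  ext e
  simp only [tri, Finset.mem_insert, Finset.mem_singleton, Sym2.eq_swap (a := c) (b := a),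
    Sym2.eq_swap (a := b) (b := a)]
  tauto

theorem tri_swap (a b c : V) : tri b a c = tri a b c := by
  ext e
  simp only [tri, Finset.mem_insert, Finset.mem_singleton, Sym2.eq_swap (a := b) (b := a)]
  tauto

theorem IsCycleSet.exists_eq_tri {F : Finset (Sym2 V)} (hF : IsCycleSet G F) {a b : V}
    (hab : s(a, b) ∈ F) (h3 : F.card = 3) : ∃ c, F = tri a b c := by
  obtain ⟨P, hP, rfl, hlen⟩ := hF.exists_path hab
  rw [h3] at hlen
  cases P with
  | nil => simp at hlen
  | @cons _ c _ h1 P =>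
    cases P with
    | nil => simp at hlen
    | @cons _ d _ h2 P =>
      cases P with
      | cons => simp at hlen
      | nil =>
        refine ⟨c, ?_⟩
        ext e
        simp only [tri, Walk.edgesFinset, Walk.edges_cons, Walk.edges_nil, List.toFinset_cons,
          List.toFinset_nil, Finset.mem_insert, Finset.notMem_empty,
          Finset.mem_singleton, Sym2.eq_swap (a := c) (b := a), or_false]

theorem IsCycleSet.exists_of_card_four {F : Finset (Sym2 V)} (hF : IsCycleSet G F) {a b : V}
    (hab : s(a, b) ∈ F) (h4 : F.card = 4) : ∃ c d, a ≠ c ∧ b ≠ d ∧ G.Adj a b ∧ G.Adj b c ∧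
      G.Adj c d ∧ G.Adj d a ∧ F = {s(a, b), s(b, c), s(c, d), s(d, a)} := by
  have hadj : G.Adj a b := hF.subset_edgeSet hab
  obtain ⟨P, hP, rfl, hlen⟩ := hF.exists_path hab
  rw [h4] at hlen
  cases P with
  | nil => simp at hlen
  | @cons _ c _ h1 P =>
    cases P with
    | nil => simp at hlen
    | @cons _ d _ h2 P =>
      cases P with
      | nil => simp at hlen
      | @cons _ _ _ h3 P =>
        cases P with
        | cons => simp at hlen
        | nil =>
          have hnd := hP.support_nodup
          simp only [Walk.support_cons, Walk.support_nil] at hnd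
          simp only [List.nodup_cons, List.mem_cons, List.not_mem_nil] at hnd
          refine ⟨c, d, by grind, by grind, hadj, h1, h2, h3, ?_⟩
          ext e
          simp [Walk.edgesFinset]

theorem IsCycleSet.exists_of_card_five {F : Finset (Sym2 V)} (hF : IsCycleSet G F) {a b : V}
    (hab : s(a, b) ∈ F) (h5 : F.card = 5) : ∃ c d e, (a ≠ c ∧ a ≠ d ∧ b ≠ d ∧ b ≠ e ∧ c ≠ e) ∧
      G.Adj a b ∧ G.Adj b c ∧ G.Adj c d ∧ G.Adj d e ∧ G.Adj e a ∧
      F = {s(a, b), s(b, c), s(c, d), s(d, e), s(e, a)} := by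
  have hadj : G.Adj a b := hF.subset_edgeSet hab
  obtain ⟨P, hP, rfl, hlen⟩ := hF.exists_path hab
  rw [h5] at hlen
  cases P with
  | nil => simp at hlen
  | @cons _ c _ h1 P =>
    cases P with
    | nil => simp at hlen
    | @cons _ d _ h2 P =>
      cases P with
      | nil => simp at hlen
      | @cons _ e _ h3 P =>
        cases P with
        | nil => simp at hlen
        | @cons _ _ _ h4 P =>
          cases P with
          | cons => simp at hlen
          | nil =>
            have hnd := hP.support_nodup
            simp only [Walk.support_cons, Walk.support_nil] at hnd
            simp only [List.nodup_cons, List.mem_cons, List.not_mem_nil] at hnd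
            refine ⟨c, d, e, by grind, hadj, h1, h2, h3, h4, ?_⟩
            ext f
            simp [Walk.edgesFinset]

omit [DecidableEq V] in
theorem Theta6Free.false_of_cycle (hG : Theta6Free G) {a b c d e f : V} (hab : G.Adj a b)
    (hbc : G.Adj b c) (hcd : G.Adj c d) (hde : G.Adj d e) (hef : G.Adj e f) (hfa : G.Adj f a)
    (hac : G.Adj a c ∨ G.Adj a d)
    (hne : a ≠ c ∧ a ≠ d ∧ a ≠ e ∧ b ≠ d ∧ b ≠ e ∧ b ≠ f ∧ c ≠ e ∧ c ≠ f ∧ d ≠ f) : False := by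
  obtain ⟨n1, n2, n3, n4, n5, n6, n7, n8, n9⟩ := hne
  have inj : Function.Injective ![a, b, c, d, e, f] := by
    have := hab.ne; have := hbc.ne; have := hcd.ne; have := hde.ne; have := hef.ne; have := hfa.ne
    intro i j hij
    fin_cases i <;> fin_cases j <;> first
      | rfl
      | (exfalso; simp at hij; grind)
  have key : ∀ k : Fin 6, (k = 2 ∧ G.Adj a c) ∨ (k = 3 ∧ G.Adj a d) → False := by
    intro k hk
    refine hG 0 k (by omega) ?_ ⟨⟨![a, b, c, d, e, f], ?_⟩, inj⟩
    · rcases hk with ⟨rfl, -⟩ | ⟨rfl, -⟩ <;> simp [cycle6]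
    · intro i j hij
      simp only [cycle6, SimpleGraph.sup_adj, SimpleGraph.fromEdgeSet_adj, Set.mem_insert_iff,
        Set.mem_singleton_iff, Sym2.eq_iff] at hij
      rcases hk with ⟨rfl, h⟩ | ⟨rfl, h⟩ <;>
      rcases hij with ⟨(⟨rfl, rfl⟩ | ⟨rfl, rfl⟩) | (⟨rfl, rfl⟩ | ⟨rfl, rfl⟩) |
        (⟨rfl, rfl⟩ | ⟨rfl, rfl⟩) | (⟨rfl, rfl⟩ | ⟨rfl, rfl⟩) | (⟨rfl, rfl⟩ | ⟨rfl, rfl⟩) |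
        (⟨rfl, rfl⟩ | ⟨rfl, rfl⟩), -⟩ | ⟨⟨rfl, rfl⟩ | ⟨rfl, rfl⟩, -⟩ <;>
      first
        | assumption
        | (apply SimpleGraph.Adj.symm; assumption)
  rcases hac with h | h
  · exact key 2 (Or.inl ⟨rfl, h⟩)
  · exact key 3 (Or.inr ⟨rfl, h⟩)

end LocalStructure

section FaceSet

variable {V : Type*} [DecidableEq V] {G : SimpleGraph V} {Φ : Finset (Finset (Sym2 V))}

namespace IsFaceSet

variable (hΦ : IsFaceSet G Φ)
include hΦ

theorem mem_edgeSet {F : Finset (Sym2 V)} (hF : F ∈ Φ) {e : Sym2 V} (he : e ∈ F) :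
    e ∈ G.edgeSet :=
  (hΦ.cycle F hF).subset_edgeSet he

theorem adj {F : Finset (Sym2 V)} (hF : F ∈ Φ) {a b : V} (he : s(a, b) ∈ F) : G.Adj a b :=
  hΦ.mem_edgeSet hF he

theorem exists_pair {e : Sym2 V} (he : e ∈ G.edgeSet) :
    ∃ F F', F ≠ F' ∧ ∀ X, (X ∈ Φ ∧ e ∈ X) ↔ X = F ∨ X = F' := by
  obtain ⟨F, F', hne, h⟩ := Finset.card_eq_two.1 (hΦ.two e he)
  refine ⟨F, F', hne, fun X ↦ ?_⟩
  have := Finset.ext_iff.1 h X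
  simpa using this

theorem exists_ne {F : Finset (Sym2 V)} (hF : F ∈ Φ) {e : Sym2 V} (he : e ∈ F) :
    ∃ F' ∈ Φ, e ∈ F' ∧ F' ≠ F ∧ ∀ X ∈ Φ, e ∈ X → X = F ∨ X = F' := by
  obtain ⟨A, B, hne, h⟩ := hΦ.exists_pair (hΦ.mem_edgeSet hF he)
  have hA := (h A).2 (Or.inl rfl)
  have hB := (h B).2 (Or.inr rfl)
  rcases (h F).1 ⟨hF, he⟩ with rfl | rfl
  · exact ⟨B, hB.1, hB.2, hne.symm, fun X h1 h2 ↦ (h X).1 ⟨h1, h2⟩⟩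
  · exact ⟨A, hA.1, hA.2, hne, fun X h1 h2 ↦ ((h X).1 ⟨h1, h2⟩).symm⟩

theorem eq_or_eq {F F' X : Finset (Sym2 V)} {e : Sym2 V} (hF : F ∈ Φ) (hF' : F' ∈ Φ) (hX : X ∈ Φ)
    (hne : F ≠ F') (he : e ∈ F) (he' : e ∈ F') (heX : e ∈ X) : X = F ∨ X = F' := by
  obtain ⟨A, -, -, -, h⟩ := hΦ.exists_ne hF he
  rcases h F' hF' he' with rfl | rfl
  · exact absurd rfl hne
  · exact h X hX heX

theorem adj_of_tri {a b c : V} (h : tri a b c ∈ Φ) : G.Adj a b ∧ G.Adj b c ∧ G.Adj a c :=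
  ⟨hΦ.adj h (by simp [tri]), hΦ.adj h (by simp [tri]), hΦ.adj h (by simp [tri])⟩

theorem ne_of_tri {a b c : V} (h : tri a b c ∈ Φ) : a ≠ b ∧ b ≠ c ∧ a ≠ c :=
  have h := hΦ.adj_of_tri h
  ⟨h.1.ne, h.2.1.ne, h.2.2.ne⟩

theorem eq_of_tri_eq {a b c d : V} (h : tri a b c ∈ Φ) (hcd : tri a b c = tri a b d) : c = d := by
  obtain ⟨h1, h2, h3⟩ := hΦ.ne_of_tri h
  have : s(b, c) ∈ tri a b d := hcd ▸ (by simp [tri])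
  simp only [tri, Finset.mem_insert, Finset.mem_singleton, Sym2.eq_iff] at this
  grind

theorem sum_tri {a b c : V} (h : tri a b c ∈ Φ) {M : Type*} [AddCommMonoid M] (f : Sym2 V → M) :
    ∑ e ∈ tri a b c, f e = f s(a, b) + (f s(b, c) + f s(a, c)) := by
  obtain ⟨h1, h2, h3⟩ := hΦ.ne_of_tri h
  rw [tri, Finset.sum_insert, Finset.sum_insert, Finset.sum_singleton]
  all_goals simp only [Finset.mem_insert, Finset.mem_singleton, Sym2.eq_iff]; grind

theorem card_tri {a b c : V} (h : tri a b c ∈ Φ) : (tri a b c).card = 3 := by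
  rw [Finset.card_eq_sum_ones, hΦ.sum_tri h]
  rfl

/-- An edge lies in at most two triangular faces. -/
theorem apex {a b c d z : V} (h1 : tri a b c ∈ Φ) (h2 : tri a b d ∈ Φ) (hcd : c ≠ d)
    (hz : tri a b z ∈ Φ) : z = c ∨ z = d := by
  rcases hΦ.eq_or_eq h1 h2 hz (fun h ↦ hcd (hΦ.eq_of_tri_eq h1 h)) (e := s(a, b)) (by simp [tri])
    (by simp [tri]) (by simp [tri]) with h | h
  · exact Or.inl (hΦ.eq_of_tri_eq hz h)
  · exact Or.inr (hΦ.eq_of_tri_eq hz h)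

theorem eq_tri_or {a b c d : V} {F : Finset (Sym2 V)} (h1 : tri a b c ∈ Φ) (h2 : tri a b d ∈ Φ)
    (hcd : c ≠ d) (hF : F ∈ Φ) (hab : s(a, b) ∈ F) : F = tri a b c ∨ F = tri a b d :=
  hΦ.eq_or_eq h1 h2 hF (fun h ↦ hcd (hΦ.eq_of_tri_eq h1 h)) (e := s(a, b)) (by simp [tri])
    (by simp [tri]) hab

theorem exists_eq_tri {F : Finset (Sym2 V)} (hF : F ∈ Φ) {a b : V} (hab : s(a, b) ∈ F)
    (h3 : F.card = 3) : ∃ c, F = tri a b c ∧ tri a b c ∈ Φ := by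
  obtain ⟨c, rfl⟩ := (hΦ.cycle F hF).exists_eq_tri hab h3
  exact ⟨c, rfl, hF⟩

theorem eq_of_mem_face {F : Finset (Sym2 V)} (hF : F ∈ Φ) {v a b z : V} (hab : a ≠ b)
    (ha : s(v, a) ∈ F) (hb : s(v, b) ∈ F) (hz : s(v, z) ∈ F) : z = a ∨ z = b := by
  obtain ⟨x, y, hxy, h⟩ := (hΦ.cycle F hF).exists_two ha
  have := (h a).1 ha
  have := (h b).1 hb
  have := (h z).1 hz
  grind

/-- If the faces of `S` close up around `w`, then they are all the faces at `w`. -/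
theorem closed {w : V} {X : Finset V} {S : Finset (Finset (Sym2 V))} (hX : X.Nonempty)
    (hS : S ⊆ Φ) (h1 : ∀ x ∈ X, ∃ F ∈ S, ∃ F' ∈ S, F ≠ F' ∧ s(w, x) ∈ F ∧ s(w, x) ∈ F')
    (h2 : ∀ F ∈ S, ∃ a ∈ X, ∃ b ∈ X, a ≠ b ∧ s(w, a) ∈ F ∧ s(w, b) ∈ F) :
    (∀ z, G.Adj w z → z ∈ X) ∧ ∀ F ∈ Φ, ∀ z, s(w, z) ∈ F → F ∈ S := by
  have mem : ∀ F ∈ Φ, ∀ x ∈ X, s(w, x) ∈ F → F ∈ S := by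
    intro F hF x hx hxF
    obtain ⟨A, hA, B, hB, hne, hxA, hxB⟩ := h1 x hx
    rcases hΦ.eq_or_eq (hS hA) (hS hB) hF hne hxA hxB hxF with rfl | rfl <;> assumption
  have key : ∀ z, G.Adj w z → z ∈ X := by
    intro z hz
    by_contra hzX
    obtain ⟨x, hx⟩ := hX
    obtain ⟨A, hA, -, -, -, hxA, -⟩ := h1 x hx
    obtain ⟨F, hF, x', hx', y', hy', hxF, hyF⟩ := hΦ.rotation w x z X hx hzX
      (hΦ.adj (hS hA) hxA) hz
    obtain ⟨a, ha, b, hb, hab, haF, hbF⟩ := h2 F (mem F hF x' hx' hxF)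
    rcases hΦ.eq_of_mem_face hF hab haF hbF hyF with rfl | rfl
    · exact hy' ha
    · exact hy' hb
  exact ⟨key, fun F hF z hz ↦ mem F hF z (key z (hΦ.adj hF hz)) hz⟩

theorem closed3 {w a b c : V} {F₁ F₂ F₃ : Finset (Sym2 V)} (h1 : F₁ ∈ Φ) (h2 : F₂ ∈ Φ)
    (h3 : F₃ ∈ Φ) (ha1 : s(w, a) ∈ F₁) (hb1 : s(w, b) ∈ F₁) (hb2 : s(w, b) ∈ F₂)
    (hc2 : s(w, c) ∈ F₂) (hc3 : s(w, c) ∈ F₃) (ha3 : s(w, a) ∈ F₃) (hab : a ≠ b) (hbc : b ≠ c)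
    (hac : a ≠ c) : (∀ z, G.Adj w z → z = a ∨ z = b ∨ z = c) ∧
      ∀ F ∈ Φ, ∀ z, s(w, z) ∈ F → F = F₁ ∨ F = F₂ ∨ F = F₃ := by
  have h12 : F₁ ≠ F₂ := by
    rintro rfl
    have := hΦ.eq_of_mem_face h1 hab ha1 hb1 hc2
    grind
  have h23 : F₂ ≠ F₃ := by
    rintro rfl
    have := hΦ.eq_of_mem_face h2 hbc hb2 hc2 ha3
    grind
  have h31 : F₃ ≠ F₁ := by
    rintro rfl
    have := hΦ.eq_of_mem_face h3 hab ha3 hb1 hc3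
    grind
  simpa using hΦ.closed (w := w) (X := {a, b, c}) (S := {F₁, F₂, F₃}) (by simp)
    (by intro F; simp only [Finset.mem_insert, Finset.mem_singleton]; grind)
    (by simp only [Finset.mem_insert, Finset.mem_singleton]; grind)
    (by simp only [Finset.mem_insert, Finset.mem_singleton]; grind)

theorem closed4 {w a b c d : V} {F₁ F₂ F₃ F₄ : Finset (Sym2 V)} (h1 : F₁ ∈ Φ) (h2 : F₂ ∈ Φ)
    (h3 : F₃ ∈ Φ) (h4 : F₄ ∈ Φ) (ha1 : s(w, a) ∈ F₁) (hb1 : s(w, b) ∈ F₁) (hb2 : s(w, b) ∈ F₂)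
    (hc2 : s(w, c) ∈ F₂) (hc3 : s(w, c) ∈ F₃) (hd3 : s(w, d) ∈ F₃) (hd4 : s(w, d) ∈ F₄)
    (ha4 : s(w, a) ∈ F₄) (hne : a ≠ b ∧ a ≠ c ∧ a ≠ d ∧ b ≠ c ∧ b ≠ d ∧ c ≠ d) :
    (∀ z, G.Adj w z → z = a ∨ z = b ∨ z = c ∨ z = d) ∧
      ∀ F ∈ Φ, ∀ z, s(w, z) ∈ F → F = F₁ ∨ F = F₂ ∨ F = F₃ ∨ F = F₄ := by
  have h12 : F₁ ≠ F₂ := by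
    rintro rfl
    have := hΦ.eq_of_mem_face h1 hne.1 ha1 hb1 hc2
    grind
  have h23 : F₂ ≠ F₃ := by
    rintro rfl
    have := hΦ.eq_of_mem_face h2 hne.2.2.2.1 hb2 hc2 hd3
    grind
  have h34 : F₃ ≠ F₄ := by
    rintro rfl
    have := hΦ.eq_of_mem_face h3 hne.2.2.2.2.2 hc3 hd3 ha4
    grind
  have h41 : F₄ ≠ F₁ := by
    rintro rfl
    have := hΦ.eq_of_mem_face h4 hne.2.2.1 ha4 hd4 hb1
    grind
  simpa using hΦ.closed (w := w) (X := {a, b, c, d}) (S := {F₁, F₂, F₃, F₄}) (by simp)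
    (by intro F; simp only [Finset.mem_insert, Finset.mem_singleton]; grind)
    (by simp only [Finset.mem_insert, Finset.mem_singleton]; grind)
    (by simp only [Finset.mem_insert, Finset.mem_singleton]; grind)

end IsFaceSet

end FaceSet

section LocalAnalysis

variable {V : Type*} [DecidableEq V] {G : SimpleGraph V} {Φ : Finset (Finset (Sym2 V))}

/-- No nonempty set of at most five vertices is a union of components. -/
def Expands (G : SimpleGraph V) : Prop :=
  ∀ U : Finset V, U.Nonempty → U.card ≤ 5 → ∃ u ∈ U, ∃ z ∉ U, G.Adj u z

omit [DecidableEq V] in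
theorem Theta6Free.false_of_chord (hG : Theta6Free G) (a b c d e f : V)
    (h : (G.Adj a b ∧ G.Adj b c ∧ G.Adj c d ∧ G.Adj d e ∧ G.Adj e f ∧ G.Adj f a ∧
      (G.Adj a c ∨ G.Adj a d)) ∧
      a ≠ c ∧ a ≠ d ∧ a ≠ e ∧ b ≠ d ∧ b ≠ e ∧ b ≠ f ∧ c ≠ e ∧ c ≠ f ∧ d ≠ f) : False :=
  hG.false_of_cycle h.1.1 h.1.2.1 h.1.2.2.1 h.1.2.2.2.1 h.1.2.2.2.2.1 h.1.2.2.2.2.2.1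
    h.1.2.2.2.2.2.2 h.2

theorem tri_edges (a b c : V) : s(a, b) ∈ tri a b c ∧ s(b, a) ∈ tri a b c ∧ s(b, c) ∈ tri a b c ∧
    s(c, b) ∈ tri a b c ∧ s(a, c) ∈ tri a b c ∧ s(c, a) ∈ tri a b c := by
  refine ⟨?_, ?_, ?_, ?_, ?_, ?_⟩ <;> simp [tri, Sym2.eq_swap]

theorem tri_perm {a b c : V} (h : tri a b c ∈ Φ) : tri a c b ∈ Φ ∧ tri b a c ∈ Φ ∧
    tri b c a ∈ Φ ∧ tri c a b ∈ Φ ∧ tri c b a ∈ Φ := by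
  rw [tri_swap c a b, tri_swap a b c, tri_rotate a b c, tri_swap b c a, ← tri_rotate c a b,
    tri_rotate a b c]
  exact ⟨h, h, h, h, h⟩

namespace IsFaceSet

variable (hΦ : IsFaceSet G Φ) (hG : Theta6Free G) (hE : Expands G)
include hΦ

theorem exists_of_card_four {F : Finset (Sym2 V)} (hF : F ∈ Φ) {a b : V} (hab : s(a, b) ∈ F)
    (hc : F.card = 4) : ∃ c d, (a ≠ c ∧ b ≠ d ∧ a ≠ d ∧ b ≠ c ∧ c ≠ d) ∧
      (G.Adj b c ∧ G.Adj c b ∧ G.Adj c d ∧ G.Adj d c ∧ G.Adj d a ∧ G.Adj a d) ∧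
      s(b, c) ∈ F ∧ s(c, b) ∈ F ∧ s(c, d) ∈ F ∧ s(d, c) ∈ F ∧ s(d, a) ∈ F ∧ s(a, d) ∈ F := by
  obtain ⟨c, d, h1, h2, h3, h4, h5, h6, rfl⟩ := (hΦ.cycle F hF).exists_of_card_four hab hc
  exact ⟨c, d, ⟨h1, h2, h6.ne', h4.ne, h5.ne⟩, ⟨h4, h4.symm, h5, h5.symm, h6, h6.symm⟩,
    by simp [Sym2.eq_swap]⟩

theorem exists_of_card_five {F : Finset (Sym2 V)} (hF : F ∈ Φ) {a b : V} (hab : s(a, b) ∈ F)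
    (hc : F.card = 5) : ∃ c d e, (a ≠ c ∧ a ≠ d ∧ a ≠ e ∧ b ≠ c ∧ b ≠ d ∧ b ≠ e ∧ c ≠ d ∧ c ≠ e ∧
      d ≠ e) ∧ (G.Adj b c ∧ G.Adj c b ∧ G.Adj c d ∧ G.Adj d c ∧ G.Adj d e ∧ G.Adj e d ∧
      G.Adj e a ∧ G.Adj a e) ∧ s(b, c) ∈ F ∧ s(c, b) ∈ F ∧ s(c, d) ∈ F ∧ s(d, c) ∈ F ∧
      s(d, e) ∈ F ∧ s(e, d) ∈ F ∧ s(e, a) ∈ F ∧ s(a, e) ∈ F := by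
  obtain ⟨c, d, e, ⟨n1, n2, n3, n4, n5⟩, h1, h2, h3, h4, h5, rfl⟩ :=
    (hΦ.cycle F hF).exists_of_card_five hab hc
  exact ⟨c, d, e, ⟨n1, n2, h5.ne', h2.ne, n3, n4, h3.ne, n5, h4.ne⟩,
    ⟨h2, h2.symm, h3, h3.symm, h4, h4.symm, h5, h5.symm⟩, by simp [Sym2.eq_swap]⟩

theorem facts {a b c : V} (h : tri a b c ∈ Φ) : G.Adj a b ∧ G.Adj b a ∧ G.Adj b c ∧ G.Adj c b ∧
    G.Adj a c ∧ G.Adj c a ∧ a ≠ b ∧ b ≠ c ∧ a ≠ c :=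
  have ⟨h1, h2, h3⟩ := hΦ.adj_of_tri h
  ⟨h1, h1.symm, h2, h2.symm, h3, h3.symm, h1.ne, h2.ne, h3.ne⟩

theorem unique_tri {F : Finset (Sym2 V)} (hF : F ∈ Φ) {v x y : V} (h : tri v x y ∈ Φ)
    (hx : s(v, x) ∈ F) (hy : s(v, y) ∈ F) : F = tri v x y :=
  hΦ.unique F hF _ h v x y (hΦ.ne_of_tri h).2.1 hx hy (tri_edges v x y).1 (tri_edges v x y).2.2.2.2.1

theorem closed_tri3 {w a b c : V} (h1 : tri w a b ∈ Φ) (h2 : tri w b c ∈ Φ) (h3 : tri w a c ∈ Φ) :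
    (∀ z, G.Adj w z → z = a ∨ z = b ∨ z = c) ∧
      ∀ F ∈ Φ, ∀ z, s(w, z) ∈ F → F.card = 3 := by
  have := hΦ.facts h1; have := hΦ.facts h2; have := hΦ.facts h3
  have := hΦ.card_tri h1; have := hΦ.card_tri h2; have := hΦ.card_tri h3
  have key := hΦ.closed3 (w := w) (a := a) (b := b) (c := c) h1 h2 h3 (by simp [tri_edges])
    (by simp [tri_edges]) (by simp [tri_edges]) (by simp [tri_edges]) (by simp [tri_edges])
    (by simp [tri_edges]) (by grind) (by grind) (by grind)
  refine ⟨key.1, fun F hF z hz ↦ ?_⟩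
  rcases key.2 F hF z hz with rfl | rfl | rfl <;> assumption

theorem closed_tri4 {w a b c d : V} (h1 : tri w a b ∈ Φ) (h2 : tri w b c ∈ Φ)
    (h3 : tri w c d ∈ Φ) (h4 : tri w a d ∈ Φ) (hne : a ≠ c ∧ b ≠ d) :
    (∀ z, G.Adj w z → z = a ∨ z = b ∨ z = c ∨ z = d) ∧
      ∀ F ∈ Φ, ∀ z, s(w, z) ∈ F → F.card = 3 := by
  have := hΦ.facts h1; have := hΦ.facts h2; have := hΦ.facts h3; have := hΦ.facts h4
  have := hΦ.card_tri h1; have := hΦ.card_tri h2; have := hΦ.card_tri h3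
  have := hΦ.card_tri h4
  have key := hΦ.closed4 (w := w) (a := a) (b := b) (c := c) (d := d) h1 h2 h3 h4 (by simp [tri_edges])
    (by simp [tri_edges]) (by simp [tri_edges]) (by simp [tri_edges]) (by simp [tri_edges])
    (by simp [tri_edges]) (by simp [tri_edges]) (by simp [tri_edges]) (by grind)
  refine ⟨key.1, fun F hF z hz ↦ ?_⟩
  rcases key.2 F hF z hz with rfl | rfl | rfl | rfl <;> assumption

theorem six_le {F : Finset (Sym2 V)} (hF : F ∈ Φ) {a b : V} (hab : s(a, b) ∈ F)
    (h3 : ∀ z, F = tri a b z → tri a b z ∈ Φ → False)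
    (h4 : ∀ c d, (a ≠ c ∧ b ≠ d ∧ a ≠ d ∧ b ≠ c ∧ c ≠ d) ∧
      (G.Adj b c ∧ G.Adj c b ∧ G.Adj c d ∧ G.Adj d c ∧ G.Adj d a ∧ G.Adj a d) ∧
      s(b, c) ∈ F ∧ s(c, b) ∈ F ∧ s(c, d) ∈ F ∧ s(d, c) ∈ F ∧ s(d, a) ∈ F ∧ s(a, d) ∈ F →
      F.card ≠ 3 → False)
    (h5 : ∀ c d e, (a ≠ c ∧ a ≠ d ∧ a ≠ e ∧ b ≠ c ∧ b ≠ d ∧ b ≠ e ∧ c ≠ d ∧ c ≠ e ∧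
      d ≠ e) ∧ (G.Adj b c ∧ G.Adj c b ∧ G.Adj c d ∧ G.Adj d c ∧ G.Adj d e ∧ G.Adj e d ∧
      G.Adj e a ∧ G.Adj a e) ∧ s(b, c) ∈ F ∧ s(c, b) ∈ F ∧ s(c, d) ∈ F ∧ s(d, c) ∈ F ∧
      s(d, e) ∈ F ∧ s(e, d) ∈ F ∧ s(e, a) ∈ F ∧ s(a, e) ∈ F → F.card ≠ 3 → False) : 6 ≤ F.card := by
  by_contra hlt
  have := (hΦ.cycle F hF).three_le_card
  obtain h | h | h : F.card = 3 ∨ F.card = 4 ∨ F.card = 5 := by omega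
  · obtain ⟨c, h1, h2⟩ := hΦ.exists_eq_tri hF hab h
    exact h3 c h1 h2
  · obtain ⟨c, d, h⟩ := hΦ.exists_of_card_four hF hab h
    exact h4 c d h (by omega)
  · obtain ⟨c, d, e, h⟩ := hΦ.exists_of_card_five hF hab h
    exact h5 c d e h (by omega)

include hG

/-- A face surrounded by three triangular faces with two distinct apexes. -/
theorem surrounded {p q r x y : V} (h : tri p q r ∈ Φ) (hqr : tri q r y ∈ Φ) (hrp : tri r p y ∈ Φ)
    (hpq : tri p q x ∈ Φ) (hxy : x ≠ y) (hxr : x ≠ r) :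
    (∀ z, G.Adj r z → z = p ∨ z = q ∨ z = y) ∧
    (∀ z, tri q y z ∈ Φ → z = r ∨ z = x) ∧ (∀ z, tri p x z ∈ Φ → z = q ∨ z = y) := by
  have := hΦ.facts h; have := hΦ.facts hqr; have := hΦ.facts hrp; have := hΦ.facts hpq
  have key := (hΦ.closed_tri3 (tri_perm h).2.2.2.1 (tri_perm hqr).2.1 hrp).1
  refine ⟨key, fun z hz ↦ ?_, fun z hz ↦ ?_⟩
  · have := hΦ.facts hz
    by_contra! hne
    by_cases hzp : z = p
    · subst hzp
      have := hΦ.apex h hpq hxr.symm (tri_perm hz).2.2.2.1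
      grind
    · exact hG.false_of_chord q z y r p x (by grind)
  · have := hΦ.facts hz
    by_contra! hne
    have hzr : z ≠ r := by
      rintro rfl
      have := key x
      grind
    exact hG.false_of_chord p z x q y r (by grind)

include hE in
theorem not_tri_of_surrounded {p q r x y : V} (h : tri p q r ∈ Φ) (hqr : tri q r y ∈ Φ)
    (hrp : tri r p y ∈ Φ) (hpq : tri p q x ∈ Φ) (hxy : x ≠ y) (hxr : x ≠ r)
    (h1 : tri q y x ∈ Φ) (h2 : tri p x y ∈ Φ) : False := by
  have := hΦ.facts h; have := hΦ.facts hqr; have := hΦ.facts hrp; have := hΦ.facts hpq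
  have := (hΦ.surrounded hG h hqr hrp hpq hxy hxr).1
  have := (hΦ.closed_tri4 (w := q) (tri_perm h).2.1 hqr h1 (tri_perm hpq).2.1 (by grind)).1
  have := (hΦ.closed_tri4 (w := p) h (tri_perm hrp).2.1 (tri_perm h2).1 hpq (by grind)).1
  have := (hΦ.closed_tri3 (w := x) (tri_perm hpq).2.2.2.1 (tri_perm h1).2.2.2.1
    (tri_perm h2).2.1).1
  have := (hΦ.closed_tri4 (w := y) (tri_perm hqr).2.2.2.1 (tri_perm hrp).2.2.2.1
    (tri_perm h2).2.2.2.1 (tri_perm h1).2.1 (by grind)).1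
  obtain ⟨u, hu, z, hz, huz⟩ := hE {p, q, r, x, y} (by simp) Finset.card_le_five
  simp only [Finset.mem_insert, Finset.mem_singleton] at hu hz
  grind

include hE in
theorem surrounded_of_tri {p q r x y : V} (h : tri p q r ∈ Φ) (hqr : tri q r y ∈ Φ)
    (hrp : tri r p y ∈ Φ) (hpq : tri p q x ∈ Φ) (hxy : x ≠ y) (hxr : x ≠ r)
    (h1 : tri q y x ∈ Φ) :
    (∀ z, tri x y z ∈ Φ → z = q) ∧
    (∀ F ∈ Φ, s(p, y) ∈ F → F ≠ tri p y r → 6 ≤ F.card) ∧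
    (∀ F ∈ Φ, s(p, x) ∈ F → F ≠ tri p x q → 6 ≤ F.card) := by
  have := hΦ.facts h; have := hΦ.facts hqr; have := hΦ.facts hrp; have := hΦ.facts hpq
  have := hΦ.facts h1
  obtain ⟨s1, s2, s3⟩ := hΦ.surrounded hG h hqr hrp hpq hxy hxr
  obtain ⟨-, s4, s5⟩ := hΦ.surrounded hG (tri_perm h).2.1 (tri_perm hrp).2.1 (tri_perm hqr).2.1
    (tri_perm hpq).2.1 hxy hxr
  have hn : tri p x y ∉ Φ := hΦ.not_tri_of_surrounded hG hE h hqr hrp hpq hxy hxr h1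
  obtain ⟨-, Nr⟩ := hΦ.closed_tri3 (tri_perm h).2.2.2.1 (tri_perm hqr).2.1 hrp
  obtain ⟨Nq, Nq'⟩ := hΦ.closed_tri4 (w := q) (tri_perm h).2.1 hqr h1 (tri_perm hpq).2.1 (by grind)
  refine ⟨fun z hz ↦ ?_, fun F hF he hne ↦ ?_, fun F hF he hne ↦ ?_⟩
  · have := hΦ.facts hz
    by_contra hzq
    have : z ≠ p := by
      rintro rfl
      exact hn (tri_perm hz).2.2.2.1
    have : z ≠ r := by
      rintro rfl
      grind
    exact hG.false_of_chord p x z y r q (by grind)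
  all_goals
    have nr : ∀ z, F.card ≠ 3 → s(r, z) ∉ F := fun z h h' ↦ h (Nr F hF z h')
    have nq : ∀ z, F.card ≠ 3 → s(q, z) ∉ F := fun z h h' ↦ h (Nq' F hF z h')
  · refine hΦ.six_le hF he (fun z h3 h3' ↦ ?_) (fun c d h4 h ↦ ?_) (fun c d e h5 h ↦ ?_)
    · rcases s4 z h3' with rfl | rfl
      · exact hne h3
      · exact hn (tri_perm h3').1
    · have : q ≠ c ∧ q ≠ d ∧ r ≠ c ∧ r ≠ d := by grind
      exact hG.false_of_chord p d c y q r (by grind)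
    · have : q ≠ c ∧ q ≠ d ∧ q ≠ e ∧ r ≠ c ∧ r ≠ d ∧ r ≠ e := by grind
      exact hG.false_of_chord p q y c d e (by grind)
  · refine hΦ.six_le hF he (fun z h3 h3' ↦ ?_) (fun c d h4 h ↦ ?_) (fun c d e h5 h ↦ ?_)
    · rcases s3 z h3' with rfl | rfl
      · exact hne h3
      · exact hn h3'
    · have : q ≠ c ∧ q ≠ d ∧ r ≠ c ∧ r ≠ d := by grind
      exact hG.false_of_chord p d c x q r (by grind)
    · have : q ≠ c ∧ q ≠ d ∧ q ≠ e ∧ r ≠ c ∧ r ≠ d ∧ r ≠ e := by grind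
      exact hG.false_of_chord p q x c d e (by grind)

theorem surrounded_of_not_tri {p q r x y : V} (h : tri p q r ∈ Φ) (hqr : tri q r y ∈ Φ)
    (hrp : tri r p y ∈ Φ) (hpq : tri p q x ∈ Φ) (hxy : x ≠ y) (hxr : x ≠ r)
    (h1 : tri p x y ∉ Φ) : ∀ F ∈ Φ, s(p, x) ∈ F → F ≠ tri p x q → 6 ≤ F.card := by
  have := hΦ.facts h; have := hΦ.facts hqr; have := hΦ.facts hrp; have := hΦ.facts hpq
  obtain ⟨s1, s2, s3⟩ := hΦ.surrounded hG h hqr hrp hpq hxy hxr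
  obtain ⟨-, Nr⟩ := hΦ.closed_tri3 (tri_perm h).2.2.2.1 (tri_perm hqr).2.1 hrp
  intro F hF he hne
  have nr : ∀ z, F.card ≠ 3 → s(r, z) ∉ F := fun z h h' ↦ h (Nr F hF z h')
  have n1 : s(p, q) ∉ F := fun h ↦ hne (hΦ.unique_tri hF (tri_perm hpq).1 he h)
  have n2 : s(x, q) ∉ F := fun h ↦ hne ((hΦ.unique_tri hF (tri_perm hpq).2.2.2.1
    (Sym2.eq_swap ▸ he) h).trans (tri_swap p x q))
  refine hΦ.six_le hF he (fun z h3 h3' ↦ ?_) (fun c d h4 h ↦ ?_) (fun c d e h5 h ↦ ?_)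
  · rcases s3 z h3' with rfl | rfl
    · exact hne h3
    · exact h1 h3'
  · have : q ≠ c ∧ q ≠ d ∧ r ≠ c ∧ r ≠ d := by grind
    exact hG.false_of_chord p d c x q r (by grind)
  · have : q ≠ c ∧ q ≠ e ∧ r ≠ c ∧ r ≠ d ∧ r ≠ e := by grind
    by_cases hqd : q = d
    · by_cases hyc : y = c
      · exact hG.false_of_chord p x y r q e (by grind)
      · exact hG.false_of_chord p x c q y r (by grind)
    · exact hG.false_of_chord p q x c d e (by grind)

end IsFaceSet
end LocalAnalysis

section QuadLemma

variable {V : Type*} [DecidableEq V] {G : SimpleGraph V} {Φ : Finset (Finset (Sym2 V))}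

/-- The edge `ab` of the triangle `abc` borders another triangular face. -/
def IsInner (Φ : Finset (Finset (Sym2 V))) (a b c : V) : Prop :=
  ∃ d, d ≠ c ∧ tri a b d ∈ Φ

/-- The triangular face `wux` can support the triangular face across `wu`. -/
def Supports (Φ : Finset (Finset (Sym2 V))) (w u x : V) : Prop :=
  (IsInner Φ u x w ↔ IsInner Φ w x u) ∨
  (¬ IsInner Φ u x w ∧ (∀ F ∈ Φ, s(u, x) ∈ F → F ≠ tri w u x → 6 ≤ F.card) ∧
    ∃ z, z ≠ u ∧ tri w x z ∈ Φ ∧ ¬ (IsInner Φ w z x ∧ IsInner Φ x z w))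

namespace IsFaceSet

variable (hΦ : IsFaceSet G Φ) (hG : Theta6Free G) (hE : Expands G)
include hΦ hG

theorem supports_of_eq {u v w x d : V} {Q : Finset (Sym2 V)} (h : tri u v w ∈ Φ)
    (hux : tri w u x ∈ Φ) (hvx : tri w v x ∈ Φ) (hQ : Q ∈ Φ) (huv : s(u, v) ∈ Q)
    (hvx' : s(v, x) ∈ Q) (hdu : s(u, d) ∈ Q) (hQ3 : Q.card ≠ 3) (hdx : d ≠ x) (hdv : d ≠ v)
    (hiu : ¬ IsInner Φ u x w)
    (hiv : ¬ IsInner Φ v x w) : Supports Φ w u x := by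
  have := hΦ.facts h; have := hΦ.facts hux; have := hΦ.facts hvx
  obtain ⟨-, Nw⟩ := hΦ.closed_tri3 (tri_perm h).2.2.2.1 hvx hux
  obtain ⟨-, Nv⟩ := hΦ.closed3 (w := v) (a := u) (b := w) (c := x) h hvx hQ
    (by simp [tri_edges]) (by simp [tri_edges]) (by simp [tri_edges]) (by simp [tri_edges])
    hvx' (Sym2.eq_swap ▸ huv) (by grind) (by grind) (by grind)
  refine Or.inr ⟨hiu, fun F hF he hne ↦ ?_, v, by grind, (tri_perm hvx).1,
    fun h ↦ hiv ?_⟩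
  swap
  · obtain ⟨d, hd, h⟩ := h.2
    exact ⟨d, hd, (tri_perm h).2.1⟩
  have nw : ∀ z, F.card ≠ 3 → s(w, z) ∉ F := fun z h h' ↦ h (Nw F hF z h')
  have nQ : F ≠ Q := by
    rintro rfl
    have := hΦ.eq_of_mem_face hF hdx.symm he hdu huv
    grind
  have nv : ∀ z, F.card ≠ 3 → s(v, z) ∉ F := by
    intro z h3 h'
    rcases Nv F hF z h' with rfl | rfl | rfl
    · exact h3 (hΦ.card_tri h)
    · exact h3 (hΦ.card_tri hvx)
    · exact nQ rfl
  refine hΦ.six_le hF he (fun z h3 h3' ↦ ?_) (fun c d h4 h ↦ ?_) (fun c d e h5 h ↦ ?_)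
  · by_cases hzw : z = w
    · exact hne (by rw [h3, hzw, tri_rotate])
    · exact hiu ⟨z, hzw, h3'⟩
  · have : v ≠ c ∧ v ≠ d ∧ w ≠ c ∧ w ≠ d := by grind
    exact hG.false_of_chord u d c x v w (by grind)
  · have : v ≠ c ∧ v ≠ d ∧ v ≠ e ∧ w ≠ c ∧ w ≠ d ∧ w ≠ e := by grind
    exact hG.false_of_chord u w x c d e (by grind)

theorem supports_or_of_eq {u v w x : V} {Q : Finset (Sym2 V)} (h : tri u v w ∈ Φ)
    (hux : tri w u x ∈ Φ) (hvx : tri w v x ∈ Φ) (hQ : Q ∈ Φ) (huv : s(u, v) ∈ Q)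
    (hQ4 : Q.card = 4) : Supports Φ w u x ∨ Supports Φ w v x := by
  have := hΦ.facts h; have := hΦ.facts hux; have := hΦ.facts hvx
  have i1 : IsInner Φ w x u := ⟨v, by grind, (tri_perm hvx).1⟩
  have i2 : IsInner Φ w x v := ⟨u, by grind, (tri_perm hux).1⟩
  by_contra! hs
  have hiu : ¬ IsInner Φ u x w := fun h ↦ hs.1 (Or.inl ⟨fun _ ↦ i1, fun _ ↦ h⟩)
  have hiv : ¬ IsInner Φ v x w := fun h ↦ hs.2 (Or.inl ⟨fun _ ↦ i2, fun _ ↦ h⟩)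
  obtain ⟨c, d, h4⟩ := hΦ.exists_of_card_four hQ huv hQ4
  by_cases hc : x = c
  · subst hc
    exact hs.1 (hΦ.supports_of_eq hG h hux hvx hQ huv h4.2.2.1 h4.2.2.2.2.2.2.2 (by omega)
      (by grind) (by grind) hiu hiv)
  by_cases hd : x = d
  · subst hd
    exact hs.2 (hΦ.supports_of_eq hG (tri_perm h).2.1 hvx hux hQ (Sym2.eq_swap ▸ huv)
      h4.2.2.2.2.2.2.2 h4.2.2.1 (by omega) (by grind) (by grind) hiv hiu)
  obtain ⟨-, Nw⟩ := hΦ.closed_tri3 (tri_perm h).2.2.2.1 hvx hux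
  have nw : ∀ z, s(w, z) ∉ Q := fun z h' ↦ by have := Nw Q hQ z h'; omega
  exact hG.false_of_chord u d c v x w (by grind)

omit hG in
include hE in
theorem not_rim {u v w x y : V} {R : Finset (Sym2 V)} (h : tri u v w ∈ Φ) (hux : tri w u x ∈ Φ)
    (hvy : tri w v y ∈ Φ) (hxy : tri w x y ∈ Φ) (huy : u ≠ y) (hvx : v ≠ x) (hR : R ∈ Φ)
    (h1 : s(u, v) ∈ R) (h2 : s(v, y) ∈ R) (h3 : s(y, x) ∈ R) (h4 : s(x, u) ∈ R) : False := by
  have := hΦ.facts h; have := hΦ.facts hux; have := hΦ.facts hvy; have := hΦ.facts hxy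
  have h1' : s(v, u) ∈ R := Sym2.eq_swap ▸ h1
  have h2' : s(y, v) ∈ R := Sym2.eq_swap ▸ h2
  have h3' : s(x, y) ∈ R := Sym2.eq_swap ▸ h3
  have h4' : s(u, x) ∈ R := Sym2.eq_swap ▸ h4
  have Nw := (hΦ.closed_tri4 (tri_perm h).2.2.2.1 hvy (tri_perm hxy).1 hux ⟨huy, hvx⟩).1
  have N : ∀ a b c, tri w a b ∈ Φ → tri w a c ∈ Φ → s(a, b) ∈ R → s(a, c) ∈ R → b ≠ c →
      ∀ z, G.Adj a z → z = b ∨ z = w ∨ z = c := by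
    intro a b c hab hac hb hc hbc
    have := hΦ.facts hab; have := hΦ.facts hac
    exact (hΦ.closed3 (w := a) (a := b) (b := w) (c := c) hab hac hR (by simp [tri_edges])
      (by simp [tri_edges]) (by simp [tri_edges]) (by simp [tri_edges]) hc hb (by grind) (by grind)
      hbc).1
  have Nu := N u v x (tri_perm h).2.2.2.1 hux h1 h4' (by grind)
  have Nv := N v u y (tri_perm h).2.2.2.2 hvy h1' h2 (by grind)
  have Nx := N x u y (tri_perm hux).1 hxy h4 h3' (by grind)
  have Ny := N y v x (tri_perm hvy).1 (tri_perm hxy).1 h2' h3 (by grind)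
  obtain ⟨a, ha, z, hz, haz⟩ := hE {u, v, w, x, y} (by simp) Finset.card_le_five
  simp only [Finset.mem_insert, Finset.mem_singleton] at ha hz
  grind

omit hG in
include hE in
theorem not_crossed {u v w x y : V} {F Q : Finset (Sym2 V)} (h : tri u v w ∈ Φ)
    (hux : tri w u x ∈ Φ) (hvy : tri w v y ∈ Φ) (hxy : tri w x y ∈ Φ) (huy : u ≠ y) (hvx : v ≠ x)
    (hF : F ∈ Φ) (h1 : s(u, x) ∈ F) (h2 : s(x, v) ∈ F) (h3 : s(v, y) ∈ F) (h4 : s(y, u) ∈ F)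
    (hQ : Q ∈ Φ) (g1 : s(u, v) ∈ Q) (g2 : s(v, x) ∈ Q) (g3 : s(x, y) ∈ Q) (g4 : s(y, u) ∈ Q) :
    False := by
  have := hΦ.facts h; have := hΦ.facts hux; have := hΦ.facts hvy; have := hΦ.facts hxy
  have Nw := (hΦ.closed_tri4 (tri_perm h).2.2.2.1 hvy (tri_perm hxy).1 hux ⟨huy, hvx⟩).1
  have N : ∀ a b c d, tri w a b ∈ Φ → tri w a c ∈ Φ → s(a, c) ∈ F → s(a, d) ∈ F → s(a, d) ∈ Q →
      s(a, b) ∈ Q → b ≠ c → b ≠ d → c ≠ d → w ≠ d → ∀ z, G.Adj a z → z = b ∨ z = w ∨ z = c ∨ z = d := by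
    intro a b c d hab hac f1 f2 q1 q2 hbc hbd hcd hwd
    have := hΦ.facts hab; have := hΦ.facts hac
    exact (hΦ.closed4 (w := a) (a := b) (b := w) (c := c) (d := d) hab hac hF hQ
      (by simp [tri_edges]) (by simp [tri_edges]) (by simp [tri_edges]) (by simp [tri_edges])
      f1 f2 q1 q2 (by grind)).1
  have Nu := N u v x y (tri_perm h).2.2.2.1 hux h1 (Sym2.eq_swap ▸ h4) (Sym2.eq_swap ▸ g4) g1
    (by grind) (by grind) (by grind) (by grind)
  have Nv := N v u y x (tri_perm h).2.2.2.2 hvy h3 (Sym2.eq_swap ▸ h2) g2 (Sym2.eq_swap ▸ g1)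
    (by grind) (by grind) (by grind) (by grind)
  have Nx := N x y u v hxy (tri_perm hux).1 (Sym2.eq_swap ▸ h1) h2 (Sym2.eq_swap ▸ g2) g3
    (by grind) (by grind) (by grind) (by grind)
  have Ny := N y x v u (tri_perm hxy).1 (tri_perm hvy).1 (Sym2.eq_swap ▸ h3) h4 g4
    (Sym2.eq_swap ▸ g3) (by grind) (by grind) (by grind) (by grind)
  obtain ⟨a, ha, z, hz, haz⟩ := hE {u, v, w, x, y} (by simp) Finset.card_le_five
  simp only [Finset.mem_insert, Finset.mem_singleton] at ha hz
  grind

include hE in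
theorem supports_of_fan {u v w x y : V} {Q : Finset (Sym2 V)} (h : tri u v w ∈ Φ)
    (hux : tri w u x ∈ Φ) (hvy : tri w v y ∈ Φ) (hQ : Q ∈ Φ) (huv : s(u, v) ∈ Q) (hQ4 : Q.card = 4)
    (hxv : x ≠ v) (hyu : y ≠ u) (hwxy : tri w x y ∈ Φ)
    (hiu : ¬ IsInner Φ u x w) (hiv : ¬ IsInner Φ v y w) : Supports Φ w u x := by
  have := hΦ.facts h; have := hΦ.facts hux; have := hΦ.facts hvy; have := hΦ.facts hwxy
  obtain ⟨-, Nw⟩ := hΦ.closed_tri4 (tri_perm h).2.2.2.1 hvy (tri_perm hwxy).1 hux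
    ⟨hyu.symm, hxv.symm⟩
  refine Or.inr ⟨hiu, fun F hF he hne ↦ ?_, y, by grind, hwxy, fun h ↦ ?_⟩
  swap
  · obtain ⟨d, hd, h⟩ := h.2
    have := hΦ.facts h
    by_cases hdu : d = u
    · exact hiu ⟨y, by grind, by rw [← hdu]; exact (tri_perm h).2.2.2.1⟩
    by_cases hdv : d = v
    · exact hiv ⟨x, by grind, by rw [← hdv]; exact (tri_perm h).2.2.2.2⟩
    exact hG.false_of_chord w u x d y v (by grind)
  have nw : ∀ z, F.card ≠ 3 → s(w, z) ∉ F := fun z h h' ↦ h (Nw F hF z h')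
  refine hΦ.six_le hF he (fun z h3 h3' ↦ ?_) (fun c d h4 h' ↦ ?_) (fun c d e h5 h' ↦ ?_)
  · by_cases hzw : z = w
    · exact hne (by rw [h3, hzw, tri_rotate])
    · exact hiu ⟨z, hzw, h3'⟩
  · have : w ≠ c ∧ w ≠ d := by grind
    by_cases hv : v ≠ c ∧ v ≠ d
    · exact hG.false_of_chord w v u d c x (by grind)
    by_cases hy : y ≠ c ∧ y ≠ d
    · exact hG.false_of_chord x y w u d c (by grind)
    by_cases hvd : v = d
    · obtain rfl : y = c := by grind
      subst hvd
      exact hΦ.not_rim hE h hux hvy hwxy hyu.symm hxv.symm hF h4.2.2.2.2.2.2.2 (by grind) (by grind)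
        (Sym2.eq_swap ▸ he)
    obtain rfl : v = c := by grind
    obtain rfl : y = d := by grind
    obtain ⟨c, d, g4⟩ := hΦ.exists_of_card_four hQ huv hQ4
    have nw : ∀ z, s(w, z) ∉ Q := fun z h' ↦ by have := Nw Q hQ z h'; omega
    have : w ≠ c ∧ w ≠ d := by grind
    by_cases hx : x ≠ c ∧ x ≠ d
    · exact hG.false_of_chord w x u d c v (by grind)
    by_cases hy : y ≠ c ∧ y ≠ d
    · exact hG.false_of_chord w y v c d u (by grind)
    by_cases hxd : x = d
    · obtain rfl : y = c := by grind
      subst hxd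
      exact hΦ.not_rim hE h hux hvy hwxy hyu.symm hxv.symm hQ huv (by grind) (by grind) (by grind)
    obtain rfl : x = c := by grind
    obtain rfl : y = d := by grind
    exact hΦ.not_crossed hE h hux hvy hwxy hyu.symm hxv.symm hF he (by grind) (by grind) (by grind)
      hQ huv (by grind) (by grind) (by grind)
  · have : w ≠ c ∧ w ≠ d ∧ w ≠ e := by grind
    exact hG.false_of_chord u w x c d e (by grind)

theorem not_tri_tri {u v w x y : V} {Q : Finset (Sym2 V)} (h : tri u v w ∈ Φ)
    (hux : tri w u x ∈ Φ) (hvy : tri w v y ∈ Φ) (hQ : Q ∈ Φ) (huv : s(u, v) ∈ Q) (hQ4 : Q.card = 4)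
    (hxv : x ≠ v) (hyu : y ≠ u) (h1 : tri u x y ∈ Φ) (h2 : tri v y x ∈ Φ) : False := by
  have := hΦ.facts h; have := hΦ.facts hux; have := hΦ.facts hvy; have := hΦ.facts h1
  have := hΦ.facts h2
  have n : ∀ a b c d, c ≠ d → tri a b c ∈ Φ → tri a b d ∈ Φ → s(a, b) ∉ Q := by
    intro a b c d hcd hc hd hab
    rcases hΦ.eq_tri_or hc hd hcd hQ hab with rfl | rfl
    · have := hΦ.card_tri hc; omega
    · have := hΦ.card_tri hd; omega
  have n1 := n v w u y hyu.symm (tri_perm h).2.2.1 (tri_perm hvy).2.1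
  have n2 := n u w v x hxv.symm (tri_perm h).1 (tri_perm hux).2.1
  have n3 := n x y u v (by grind) (tri_perm h1).2.2.1 (tri_perm h2).2.2.2.2
  obtain ⟨c, d, n4, n5, n6⟩ := hΦ.exists_of_card_four hQ huv hQ4
  by_cases hc : c = w ∨ c = x ∨ c = y
  · by_cases hd : d = w ∨ d = x ∨ d = y
    · rcases hc with rfl | rfl | rfl <;> grind
    · rcases hc with rfl | rfl | rfl
      · exact hG.false_of_chord u v x y c d (by grind)
      · exact hG.false_of_chord u v w y c d (by grind)
      · exact hG.false_of_chord u v w x c d (by grind)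
  · by_cases hd : d = w ∨ d = x ∨ d = y
    · rcases hd with rfl | rfl | rfl
      · exact hG.false_of_chord v u x y d c (by grind)
      · exact hG.false_of_chord v u w y d c (by grind)
      · exact hG.false_of_chord v u w x d c (by grind)
    · exact hG.false_of_chord u d c v x y (by grind)

include hE in
/-- A triangular face with a quadrilateral across one edge and triangles across the other two is
supported by one of these triangles. -/
theorem supports_or {u v w x y : V} {Q : Finset (Sym2 V)} (h : tri u v w ∈ Φ)
    (hux : tri w u x ∈ Φ) (hvy : tri w v y ∈ Φ) (hQ : Q ∈ Φ) (huv : s(u, v) ∈ Q) (hQ4 : Q.card = 4)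
    (hxv : x ≠ v) (hyu : y ≠ u) : Supports Φ w u x ∨ Supports Φ w v y := by
  have := hΦ.facts h; have := hΦ.facts hux; have := hΦ.facts hvy
  by_cases hxy : x = y
  · subst hxy
    exact hΦ.supports_or_of_eq hG h hux hvy hQ huv hQ4
  have nuv : ∀ z, tri u v z ∈ Φ → z = w := by
    intro z hz
    by_contra hne
    rcases hΦ.eq_tri_or h hz (Ne.symm hne) hQ huv with rfl | rfl
    · have := hΦ.card_tri h; omega
    · have := hΦ.card_tri hz; omega
  have a1 : ∀ z, tri u x z ∈ Φ → z = w ∨ z = y := by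
    intro z hz
    have := hΦ.facts hz
    by_contra! hne
    have : z ≠ v := by
      rintro rfl
      exact (by grind : x ≠ w) (nuv x (tri_perm hz).1)
    exact hG.false_of_chord u z x w y v (by grind)
  have a2 : ∀ z, tri v y z ∈ Φ → z = w ∨ z = x := by
    intro z hz
    have := hΦ.facts hz
    by_contra! hne
    have : z ≠ u := by
      rintro rfl
      exact (by grind : y ≠ w) (nuv y (tri_perm hz).2.2.2.1)
    exact hG.false_of_chord v z y w x u (by grind)
  have b1 : ∀ z, tri w x z ∈ Φ → z = u ∨ z = y := by
    intro z hz
    have := hΦ.facts hz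
    by_contra! hne
    have : z ≠ v := by
      rintro rfl
      have := hΦ.apex (tri_perm h).2.2.2.2 hvy hyu.symm (tri_perm hz).1
      grind
    exact hG.false_of_chord w y v u x z (by grind)
  have b2 : ∀ z, tri w y z ∈ Φ → z = v ∨ z = x := by
    intro z hz
    have := hΦ.facts hz
    by_contra! hne
    have : z ≠ u := by
      rintro rfl
      have := hΦ.apex (tri_perm h).2.2.2.1 hux hxv.symm (tri_perm hz).1
      grind
    exact hG.false_of_chord w x u v y z (by grind)
  by_contra! hs
  obtain ⟨s1, s2⟩ := hs
  have c1 : IsInner Φ u x w ↔ tri u x y ∈ Φ := by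
    refine ⟨?_, fun h ↦ ⟨y, by grind, h⟩⟩
    rintro ⟨z, hz, h⟩
    rcases a1 z h with rfl | rfl
    exacts [absurd rfl hz, h]
  have c2 : IsInner Φ v y w ↔ tri v y x ∈ Φ := by
    refine ⟨?_, fun h ↦ ⟨x, by grind, h⟩⟩
    rintro ⟨z, hz, h⟩
    rcases a2 z h with rfl | rfl
    exacts [absurd rfl hz, h]
  have c3 : IsInner Φ w x u ↔ tri w x y ∈ Φ := by
    refine ⟨?_, fun h ↦ ⟨y, by grind, h⟩⟩
    rintro ⟨z, hz, h⟩
    rcases b1 z h with rfl | rfl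
    exacts [absurd rfl hz, h]
  have c4 : IsInner Φ w y v ↔ tri w x y ∈ Φ := by
    refine ⟨?_, fun h ↦ ⟨x, by grind, (tri_perm h).1⟩⟩
    rintro ⟨z, hz, h⟩
    rcases b2 z h with rfl | rfl
    exacts [absurd rfl hz, (tri_perm h).1]
  have d1 : ¬ (IsInner Φ u x w ↔ IsInner Φ w x u) := fun h ↦ s1 (Or.inl h)
  have d2 : ¬ (IsInner Φ v y w ↔ IsInner Φ w y v) := fun h ↦ s2 (Or.inl h)
  by_cases hwxy : tri w x y ∈ Φ
  · exact s1 (hΦ.supports_of_fan hG hE h hux hvy hQ huv hQ4 hxv hyu hwxy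
      (fun h ↦ d1 ⟨fun _ ↦ c3.2 hwxy, fun _ ↦ h⟩) (fun h ↦ d2 ⟨fun _ ↦ c4.2 hwxy, fun _ ↦ h⟩))
  · exact hΦ.not_tri_tri hG h hux hvy hQ huv hQ4 hxv hyu
      (by_contra fun hn ↦ d1 ⟨fun h ↦ absurd (c1.1 h) hn, fun h ↦ absurd (c3.1 h) hwxy⟩)
      (by_contra fun hn ↦ d2 ⟨fun h ↦ absurd (c2.1 h) hn, fun h ↦ absurd (c4.1 h) hwxy⟩)

end IsFaceSet
end QuadLemma

section Discharging

/-- The face across the edge `e` of the face `F`. -/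
noncomputable def opp {V : Type*} [DecidableEq V] (Φ : Finset (Finset (Sym2 V))) (F : Finset (Sym2 V))
    (e : Sym2 V) : Finset (Sym2 V) :=
  ((Φ.filter (e ∈ ·)).erase F).sup id

/-- The number of edges of `F` with a triangular face on the other side. -/
noncomputable def innerCount {V : Type*} [DecidableEq V] (Φ : Finset (Finset (Sym2 V))) (F : Finset (Sym2 V)) : ℕ :=
  ∑ e ∈ F, if (opp Φ F e).card = 3 then 1 else 0

/-- `F` is a triangular face adjacent only to triangular faces. -/
def IsSurrounded {V : Type*} [DecidableEq V] (Φ : Finset (Finset (Sym2 V))) (F : Finset (Sym2 V)) : Prop :=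
  F.card = 3 ∧ innerCount Φ F = 3

open Classical in
/-- The number of edges of `F` with a surrounded triangular face on the other side. -/
noncomputable def surroundedCount {V : Type*} [DecidableEq V] (Φ : Finset (Finset (Sym2 V)))
    (F : Finset (Sym2 V)) : ℕ :=
  ∑ e ∈ F, if IsSurrounded Φ (opp Φ F e) then 1 else 0

/-- The charge which a face of length `l` sends to each adjacent triangular face. -/
def faceWeight (l : ℕ) : ℤ :=
  if l = 3 then 0 else if l = 4 then 2 else if l = 5 then 3 else 5

/-- The total charge which `F` receives from faces which are not triangles. -/
noncomputable def outerWeight {V : Type*} [DecidableEq V] (Φ : Finset (Finset (Sym2 V))) (F : Finset (Sym2 V)) : ℤ :=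
  ∑ e ∈ F, faceWeight (opp Φ F e).card

open Classical in
/-- The charge which `F` sends across its edge `e`. -/
noncomputable def charge {V : Type*} [DecidableEq V] (Φ : Finset (Finset (Sym2 V))) (F : Finset (Sym2 V))
    (e : Sym2 V) : ℤ :=
  if F.card ≠ 3 then if (opp Φ F e).card = 3 then faceWeight F.card else 0
  else if (opp Φ F e).card ≠ 3 then 0
  else if innerCount Φ F = 1 then outerWeight Φ F - 3
  else if innerCount Φ F = 2 then
    if ∃ e' ∈ F, 6 ≤ (opp Φ F e').card then
      if surroundedCount Φ F = 0 then 1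
      else if IsSurrounded Φ (opp Φ F e) then if surroundedCount Φ F = 1 then 2 else 1
      else 0
    else 0
  else if innerCount Φ (opp Φ F e) = 2 ∧ ∃ e' ∈ opp Φ F e, (opp Φ (opp Φ F e) e').card = 4 then 1
  else 0

theorem faceWeight_nonneg (l : ℕ) : 0 ≤ faceWeight l := by
  unfold faceWeight
  split_ifs <;> norm_num

variable {V : Type*} [DecidableEq V] {G : SimpleGraph V} {Φ : Finset (Finset (Sym2 V))}

theorem tri_comm_right (a b c : V) : tri a c b = tri a b c := by
  rw [← tri_rotate a c b, tri_swap b c a, tri_rotate a b c]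

namespace IsFaceSet

variable (hΦ : IsFaceSet G Φ) (hG : Theta6Free G) (hE : Expands G)
include hΦ

theorem opp_eq {F F' : Finset (Sym2 V)} {e : Sym2 V} (hF : F ∈ Φ) (hF' : F' ∈ Φ) (hne : F' ≠ F)
    (he : e ∈ F) (he' : e ∈ F') : opp Φ F e = F' := by
  have : (Φ.filter (e ∈ ·)).erase F = {F'} := by
    ext X
    simp only [Finset.mem_erase, Finset.mem_filter, Finset.mem_singleton]
    constructor
    · rintro ⟨h1, h2, h3⟩
      exact (hΦ.eq_or_eq hF hF' h2 hne.symm he he' h3).resolve_left h1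
    · rintro rfl
      exact ⟨hne, hF', he'⟩
  rw [opp, this, Finset.sup_singleton, id]

theorem opp_spec {F : Finset (Sym2 V)} {e : Sym2 V} (hF : F ∈ Φ) (he : e ∈ F) :
    opp Φ F e ∈ Φ ∧ e ∈ opp Φ F e ∧ opp Φ F e ≠ F := by
  obtain ⟨F', h1, h2, h3, -⟩ := hΦ.exists_ne hF he
  rw [hΦ.opp_eq hF h1 h3 he h2]
  exact ⟨h1, h2, h3⟩

theorem opp_opp {F : Finset (Sym2 V)} {e : Sym2 V} (hF : F ∈ Φ) (he : e ∈ F) :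
    opp Φ (opp Φ F e) e = F := by
  obtain ⟨h1, h2, h3⟩ := hΦ.opp_spec hF he
  exact hΦ.opp_eq h1 hF h3.symm h2 he

theorem opp_tri {a b c d : V} {F : Finset (Sym2 V)} (hF : F = tri a b c) (h : tri a b c ∈ Φ)
    (hd : tri a b d ∈ Φ) (hcd : c ≠ d) : opp Φ F s(a, b) = tri a b d := by
  subst hF
  exact hΦ.opp_eq h hd (fun h' ↦ hcd (hΦ.eq_of_tri_eq h h'.symm)) (tri_edges a b c).1
    (tri_edges a b d).1

theorem card_opp_iff {a b c : V} {F : Finset (Sym2 V)} (hF : F = tri a b c) (h : tri a b c ∈ Φ) :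
    (opp Φ F s(a, b)).card = 3 ↔ IsInner Φ a b c := by
  constructor
  · intro h3
    subst hF
    obtain ⟨h1, h2, h4⟩ := hΦ.opp_spec h (tri_edges a b c).1
    obtain ⟨d, hd, hd'⟩ := hΦ.exists_eq_tri h1 h2 h3
    exact ⟨d, fun hcd ↦ h4 (by rw [hd, hcd]), hd'⟩
  · rintro ⟨d, hd, hd'⟩
    rw [hΦ.opp_tri hF h hd' hd.symm, hΦ.card_tri hd']

open Classical in
theorem innerCount_tri {a b c : V} (h : tri a b c ∈ Φ) : innerCount Φ (tri a b c) =
    (if IsInner Φ a b c then 1 else 0) + ((if IsInner Φ b c a then 1 else 0) +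
      (if IsInner Φ a c b then 1 else 0)) := by
  have hp := tri_perm h
  rw [innerCount, hΦ.sum_tri h]
  simp only [hΦ.card_opp_iff rfl h, hΦ.card_opp_iff (tri_rotate a b c).symm hp.2.2.1,
    hΦ.card_opp_iff (tri_comm_right a c b) hp.1]

theorem isSurrounded_iff {a b c : V} (h : tri a b c ∈ Φ) : IsSurrounded Φ (tri a b c) ↔
    IsInner Φ a b c ∧ IsInner Φ b c a ∧ IsInner Φ a c b := by
  classical
  rw [IsSurrounded, hΦ.innerCount_tri h]
  have := hΦ.card_tri h
  by_cases h1 : IsInner Φ a b c <;> by_cases h2 : IsInner Φ b c a <;>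
    by_cases h3 : IsInner Φ a c b <;> simp [h1, h2, h3, this]

theorem outerWeight_add_le {F : Finset (Sym2 V)} (hF : F ∈ Φ) :
    2 * (F.card : ℤ) ≤ outerWeight Φ F + 2 * (innerCount Φ F) := by
  rw [outerWeight, innerCount, Finset.card_eq_sum_ones]
  push_cast
  rw [Finset.mul_sum, Finset.mul_sum, ← Finset.sum_add_distrib]
  refine Finset.sum_le_sum fun e he ↦ ?_
  have := (hΦ.cycle _ (hΦ.opp_spec hF he).1).three_le_card
  unfold faceWeight
  split_ifs <;> norm_num

theorem charge_nonneg {F : Finset (Sym2 V)} (hF : F ∈ Φ) (e : Sym2 V) : 0 ≤ charge Φ F e := by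
  have := hΦ.outerWeight_add_le hF
  have := faceWeight_nonneg F.card
  unfold charge
  split_ifs with h1 h2 h3 h4 <;> try omega

end IsFaceSet
end Discharging

section DischargingBalance

variable {V : Type*} [DecidableEq V] {G : SimpleGraph V} {Φ : Finset (Finset (Sym2 V))}

/-- A triangular face receives at least as much as it sends, plus three. -/
def IsBalancedFace (Φ : Finset (Finset (Sym2 V))) (F : Finset (Sym2 V)) : Prop :=
  3 + ∑ e ∈ F, charge Φ F e ≤ ∑ e ∈ F, charge Φ (opp Φ F e) e

theorem isInner_comm {a b c : V} : IsInner Φ a b c ↔ IsInner Φ b a c := by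
  simp only [IsInner, tri_swap b a]

namespace IsFaceSet

variable (hΦ : IsFaceSet G Φ) (hG : Theta6Free G) (hE : Expands G)
include hΦ

theorem charge_of_not_inner {a b c : V} (h : tri a b c ∈ Φ) (hab : ¬ IsInner Φ a b c) :
    charge Φ (tri a b c) s(a, b) = 0 := by
  have := hΦ.card_opp_iff rfl h
  simp [charge, hΦ.card_tri h, this, hab]

theorem charge_of_one {a b c : V} (h : tri a b c ∈ Φ) (hab : IsInner Φ a b c)
    (hbc : ¬ IsInner Φ b c a) (hac : ¬ IsInner Φ a c b) :
    charge Φ (tri a b c) s(a, b) = outerWeight Φ (tri a b c) - 3 := by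
  have := hΦ.card_opp_iff rfl h
  simp [charge, hΦ.card_tri h, this, hab, hΦ.innerCount_tri h, hbc, hac]

theorem not_inner_of_six_le {a b c : V} (h : tri a b c ∈ Φ)
    (h6 : 6 ≤ (opp Φ (tri a b c) s(a, b)).card) : ¬ IsInner Φ a b c := by
  rw [← hΦ.card_opp_iff rfl h]
  omega

theorem six_le_opp {a b c : V} (h : tri a b c ∈ Φ)
    (h6 : ∀ F ∈ Φ, s(a, b) ∈ F → F ≠ tri a b c → 6 ≤ F.card) :
    6 ≤ (opp Φ (tri a b c) s(a, b)).card := by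
  obtain ⟨h1, h2, h3⟩ := hΦ.opp_spec h (tri_edges a b c).1
  exact h6 _ h1 h2 h3

/-- The opposite face across an edge without a triangular face is not surrounded. -/
theorem not_isSurrounded_opp {a b c : V} (h : tri a b c ∈ Φ) (hab : ¬ IsInner Φ a b c) :
    ¬ IsSurrounded Φ (opp Φ (tri a b c) s(a, b)) := by
  rw [← hΦ.card_opp_iff rfl h] at hab
  exact fun hs ↦ hab hs.1

open Classical in
theorem charge_of_big {a b c d e : V} (h : tri a b c ∈ Φ) (hd : tri a b d ∈ Φ) (hdc : d ≠ c)
    (he : tri b c e ∈ Φ) (hea : e ≠ a) (h6 : 6 ≤ (opp Φ (tri a c b) s(a, c)).card) :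
    (charge Φ (tri a b c) s(a, b) =
      if IsSurrounded Φ (tri a b d) then if IsSurrounded Φ (tri b c e) then 1 else 2
      else if IsSurrounded Φ (tri b c e) then 0 else 1) ∧
    innerCount Φ (tri a b c) = 2 ∧ ∀ e' ∈ tri a b c, (opp Φ (tri a b c) e').card ≠ 4 := by
  have hp := tri_perm h
  have h1 : IsInner Φ a b c := ⟨d, hdc, hd⟩
  have h2 : IsInner Φ b c a := ⟨e, hea, he⟩
  have h3 := hΦ.not_inner_of_six_le hp.1 h6
  have hs := hΦ.not_isSurrounded_opp hp.1 h3
  have o1 := hΦ.opp_tri rfl h hd hdc.symm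
  have o2 := hΦ.opp_tri rfl hp.2.2.1 he hea.symm
  rw [tri_comm_right a b c] at h6 hs
  rw [tri_rotate] at o2
  have hi : innerCount Φ (tri a b c) = 2 := by simp [hΦ.innerCount_tri h, h1, h2, h3]
  have hz : surroundedCount Φ (tri a b c) =
      (if IsSurrounded Φ (tri a b d) then 1 else 0) +
        if IsSurrounded Φ (tri b c e) then 1 else 0 := by
    rw [surroundedCount, hΦ.sum_tri h, o1, o2, if_neg hs, add_zero]
  have hbig : ∃ e' ∈ tri a b c, 6 ≤ (opp Φ (tri a b c) e').card :=
    ⟨s(a, c), (tri_edges a b c).2.2.2.2.1, h6⟩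
  refine ⟨?_, hi, ?_⟩
  · rw [charge, hz, if_pos hbig, hi, hΦ.card_tri h, o1, hΦ.card_tri hd]
    split_ifs <;> simp_all
  · intro e' he'
    simp only [tri, Finset.mem_insert, Finset.mem_singleton] at he'
    rcases he' with rfl | rfl | rfl
    · rw [o1, hΦ.card_tri hd]; decide
    · rw [o2, hΦ.card_tri he]; decide
    · omega

omit hΦ in
theorem charge_of_surrounded {F : Finset (Sym2 V)} (hF : IsSurrounded Φ F) (e : Sym2 V) :
    charge Φ F e ≤ 1 := by
  unfold charge
  simp only [hF.1, hF.2]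
  split_ifs <;> simp_all

theorem faceWeight_le_charge {F : Finset (Sym2 V)} (hF : F ∈ Φ) (h3 : F.card = 3) {e : Sym2 V}
    (he : e ∈ F) : faceWeight (opp Φ F e).card ≤ charge Φ (opp Φ F e) e := by
  obtain ⟨h1, h2, -⟩ := hΦ.opp_spec hF he
  by_cases h : (opp Φ F e).card = 3
  · rw [h]
    exact (hΦ.charge_nonneg h1 e).trans' (by simp [faceWeight])
  · rw [charge, if_pos h, hΦ.opp_opp hF he, if_pos h3]

theorem one_le_charge_of_supports {u v w x : V} (h : tri u v w ∈ Φ) (hux : tri w u x ∈ Φ)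
    (hxv : x ≠ v) (hi : ¬ IsInner Φ u v w) (hvw : IsInner Φ v w u)
    (h4 : (opp Φ (tri u v w) s(u, v)).card = 4) (hs : Supports Φ w u x) :
    1 ≤ charge Φ (tri w u x) s(w, u) := by
  have hp := tri_perm h
  have hq := tri_perm hux
  have i1 : IsInner Φ w u x := ⟨v, hxv.symm, hp.2.2.2.1⟩
  have o1 := hΦ.opp_tri rfl hux hp.2.2.2.1 hxv
  have e1 : tri w u v = tri u v w := (tri_rotate w u v).symm
  have hnS : ¬ IsSurrounded Φ (tri u v w) := fun hS ↦ hi ((hΦ.isSurrounded_iff h).1 hS).1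
  have hk : innerCount Φ (tri u v w) = 2 := by
    have : IsInner Φ u w v := isInner_comm.1 ⟨x, hxv, hux⟩
    simp [hΦ.innerCount_tri h, hi, hvw, this]
  rcases hs with hs | ⟨hs, h6, z, hz, hz1, hz2⟩
  · by_cases hi' : IsInner Φ u x w
    · have hS := (hΦ.isSurrounded_iff hux).2 ⟨i1, hi', hs.1 hi'⟩
      rw [charge, if_neg (by simp [hS.1]), o1, e1, hk, hS.2, hΦ.card_tri h]
      have : ∃ e' ∈ tri u v w, (opp Φ (tri u v w) e').card = 4 := ⟨_, (tri_edges u v w).1, h4⟩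
      simp [this]
    · have hi'' : ¬ IsInner Φ w x u := fun h ↦ hi' (hs.2 h)
      rw [hΦ.charge_of_one hux i1 hi' hi'']
      have := hΦ.outerWeight_add_le hux
      have hk' : innerCount Φ (tri w u x) = 1 := by simp [hΦ.innerCount_tri hux, i1, hi', hi'']
      rw [hΦ.card_tri hux, hk'] at this
      norm_num at this
      linarith
  · have h6' := hΦ.six_le_opp hq.2.2.1 (fun F hF he hne ↦ h6 F hF he (by rwa [tri_rotate] at hne))
    have := (hΦ.charge_of_big (a := u) (b := w) (c := x) (d := v) (e := z) hq.2.1 hp.1 hxv.symm hz1 hz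
      h6').1
    have hS1 : ¬ IsSurrounded Φ (tri u w v) := by rwa [tri_comm_right u v w]
    have hS2 : ¬ IsSurrounded Φ (tri w x z) := fun hS ↦
      hz2 ⟨((hΦ.isSurrounded_iff hz1).1 hS).2.2, ((hΦ.isSurrounded_iff hz1).1 hS).2.1⟩
    rw [if_neg hS1, if_neg hS2, tri_swap w u x, Sym2.eq_swap] at this
    exact this.ge

include hG hE in
theorem balanced_of_two {u v w x y : V} (h : tri u v w ∈ Φ) (hux : tri w u x ∈ Φ)
    (hvy : tri w v y ∈ Φ) (hxv : x ≠ v) (hyu : y ≠ u) (hi : ¬ IsInner Φ u v w) :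
    IsBalancedFace Φ (tri u v w) := by
  have hp := tri_perm h
  have hc := hΦ.card_tri h
  have e1 : tri w u v = tri u v w := (tri_rotate w u v).symm
  have e2 : tri w v u = tri u v w := (tri_comm_right w u v).trans e1
  have o1 := hΦ.opp_tri e1.symm hp.2.2.2.1 hux hxv.symm
  have o2 := hΦ.opp_tri e2.symm hp.2.2.2.2 hvy hyu.symm
  have i1 : IsInner Φ v w u := isInner_comm.1 ⟨y, hyu, hvy⟩
  have i2 : IsInner Φ u w v := isInner_comm.1 ⟨x, hxv, hux⟩
  have hk : innerCount Φ (tri u v w) = 2 := by simp [hΦ.innerCount_tri h, hi, i1, i2]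
  have c0 := hΦ.charge_of_not_inner h hi
  have hs1 := hΦ.faceWeight_le_charge h hc (tri_edges u v w).1
  obtain ⟨q1, q2, q3⟩ := hΦ.opp_spec h (tri_edges u v w).1
  have n1 := hΦ.charge_nonneg hux s(w, u)
  have n2 := hΦ.charge_nonneg hvy s(w, v)
  have q4 := (hΦ.cycle _ q1).three_le_card
  have q5 : (opp Φ (tri u v w) s(u, v)).card ≠ 3 := by rwa [Ne, hΦ.card_opp_iff rfl h]
  rw [IsBalancedFace, hΦ.sum_tri h, hΦ.sum_tri h, c0, Sym2.eq_swap (a := v) (b := w),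
    Sym2.eq_swap (a := u) (b := w), o1, o2]
  by_cases h6 : 6 ≤ (opp Φ (tri u v w) s(u, v)).card
  · have k1 := (hΦ.charge_of_big hp.1 (tri_perm hux).2.1 hxv hvy hyu
      (by rwa [tri_comm_right u w v] at h6 ⊢)).1
    have k2 := (hΦ.charge_of_big hp.2.2.1 (tri_perm hvy).2.1 hyu hux hxv
      (by rwa [tri_swap u v w, Sym2.eq_swap])).1
    rw [tri_comm_right u v w, tri_swap w u x] at k1
    rw [tri_rotate u v w, tri_swap w v y, Sym2.eq_swap] at k2
    rw [Sym2.eq_swap] at k1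
    have hw : faceWeight (opp Φ (tri u v w) s(u, v)).card = 5 := by
      unfold faceWeight
      split_ifs <;> omega
    have : charge Φ (tri u v w) s(w, v) + charge Φ (tri u v w) s(w, u) ≤ 2 := by
      rw [k1, k2]
      split_ifs <;> norm_num
    linarith
  · have hnb : ¬ ∃ e' ∈ tri u v w, 6 ≤ (opp Φ (tri u v w) e').card := by
      rintro ⟨e', he', h6'⟩
      simp only [tri, Finset.mem_insert, Finset.mem_singleton] at he'
      rcases he' with rfl | rfl | rfl
      · exact h6 h6'
      · rw [Sym2.eq_swap, o2, hΦ.card_tri hvy] at h6'; omega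
      · rw [Sym2.eq_swap, o1, hΦ.card_tri hux] at h6'; omega
    have out : ∀ e, charge Φ (tri u v w) e = 0 := by
      intro e
      simp [charge, hc, hk, hnb]
    rw [out, out]
    obtain h5 | h5 : (opp Φ (tri u v w) s(u, v)).card = 4 ∨
      (opp Φ (tri u v w) s(u, v)).card = 5 := by omega
    · rw [h5, show faceWeight 4 = 2 from rfl] at hs1
      rcases hΦ.supports_or hG hE h hux hvy q1 q2 h5 hxv hyu with hS | hS
      · have := hΦ.one_le_charge_of_supports h hux hxv hi i1 h5 hS
        linarith
      · have := hΦ.one_le_charge_of_supports hp.2.1 hvy hyu (fun h ↦ hi (isInner_comm.1 h)) i2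
          (by rwa [tri_swap u v w, Sym2.eq_swap]) hS
        linarith
    · rw [h5, show faceWeight 5 = 3 from rfl] at hs1
      linarith

end IsFaceSet
end DischargingBalance

section DischargingSum

variable {V : Type*} [DecidableEq V] {G : SimpleGraph V} {Φ : Finset (Finset (Sym2 V))}

theorem charge_eq_zero_of_surrounded {F : Finset (Sym2 V)} (hF : IsSurrounded Φ F) {e : Sym2 V}
    (h : innerCount Φ (opp Φ F e) = 2 → ∀ e' ∈ opp Φ F e, (opp Φ (opp Φ F e) e').card ≠ 4) :
    charge Φ F e = 0 := by
  rw [charge, if_neg (not_not.2 hF.1), hF.2]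
  by_cases h1 : (opp Φ F e).card = 3
  · rw [if_neg (not_not.2 h1), if_neg (by norm_num), if_neg (by norm_num), if_neg]
    rintro ⟨h3, e', he', h4⟩
    exact h h3 e' he' h4
  · rw [if_pos h1]

theorem IsBalancedFace.of_eq {F F' : Finset (Sym2 V)} (h : IsBalancedFace Φ F) (he : F = F') :
    IsBalancedFace Φ F' := he ▸ h

namespace IsFaceSet

variable (hΦ : IsFaceSet G Φ) (hG : Theta6Free G) (hE : Expands G)
include hΦ

theorem outerWeight_le {F : Finset (Sym2 V)} (hF : F ∈ Φ) (h3 : F.card = 3) :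
    outerWeight Φ F ≤ ∑ e ∈ F, charge Φ (opp Φ F e) e :=
  Finset.sum_le_sum fun _ he ↦ hΦ.faceWeight_le_charge hF h3 he

theorem balanced_of_one {a b c : V} (h : tri a b c ∈ Φ) (hab : IsInner Φ a b c)
    (hbc : ¬ IsInner Φ b c a) (hac : ¬ IsInner Φ a c b) : IsBalancedFace Φ (tri a b c) := by
  have hp := tri_perm h
  have c1 := hΦ.charge_of_one h hab hbc hac
  have c2 := hΦ.charge_of_not_inner hp.2.2.1 hbc
  have c3 := hΦ.charge_of_not_inner hp.1 hac
  rw [tri_rotate] at c2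
  rw [tri_comm_right] at c3
  have := hΦ.outerWeight_le h (hΦ.card_tri h)
  rw [IsBalancedFace, hΦ.sum_tri h, c1, c2, c3]
  linarith

theorem balanced_of_zero {a b c : V} (h : tri a b c ∈ Φ) (hab : ¬ IsInner Φ a b c)
    (hbc : ¬ IsInner Φ b c a) (hac : ¬ IsInner Φ a c b) : IsBalancedFace Φ (tri a b c) := by
  have hp := tri_perm h
  have c1 := hΦ.charge_of_not_inner h hab
  have c2 := hΦ.charge_of_not_inner hp.2.2.1 hbc
  have c3 := hΦ.charge_of_not_inner hp.1 hac
  rw [tri_rotate] at c2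
  rw [tri_comm_right] at c3
  have := hΦ.outerWeight_le h (hΦ.card_tri h)
  have h2 := hΦ.outerWeight_add_le h
  have hk : innerCount Φ (tri a b c) = 0 := by simp [hΦ.innerCount_tri h, hab, hbc, hac]
  rw [hk, hΦ.card_tri h] at h2
  norm_num at h2
  rw [IsBalancedFace, hΦ.sum_tri h, c1, c2, c3]
  linarith

include hG hE

theorem balanced_of_surrounded_of_tri {p q r x y : V} (h : tri p q r ∈ Φ) (hqr : tri q r y ∈ Φ)
    (hrp : tri r p y ∈ Φ) (hpq : tri p q x ∈ Φ) (hxy : x ≠ y) (hxr : x ≠ r)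
    (h1 : tri q y x ∈ Φ) : IsBalancedFace Φ (tri p q r) := by
  have f1 := hΦ.facts hqr
  have f2 := hΦ.facts hrp
  have f3 := hΦ.facts hpq
  have hp := tri_perm h
  obtain ⟨s1, s2, s3⟩ := hΦ.surrounded_of_tri hG hE h hqr hrp hpq hxy hxr h1
  have hS : IsSurrounded Φ (tri p q r) := (hΦ.isSurrounded_iff h).2
    ⟨⟨x, hxr, hpq⟩, ⟨y, by grind, hqr⟩, isInner_comm.1 ⟨y, by grind, hrp⟩⟩
  have hS' : ¬ IsSurrounded Φ (tri q x y) := fun hS ↦ by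
    obtain ⟨z, hz, hz'⟩ := ((hΦ.isSurrounded_iff (tri_perm h1).1).1 hS).2.1
    exact hz (s1 z hz')
  have h6 := hΦ.six_le_opp (tri_perm hpq).1 s3
  have h6' := hΦ.six_le_opp (tri_perm hrp).2.2.1 s2
  obtain ⟨c1, -, d1⟩ := hΦ.charge_of_big hpq h hxr.symm (tri_perm h1).1 (by grind) h6
  obtain ⟨c2, -, d2⟩ := hΦ.charge_of_big (tri_perm hrp).2.1 hp.1 (by grind) (tri_perm hqr).2.2.1
    (by grind) h6'
  have o1 := hΦ.opp_tri rfl h hpq hxr.symm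
  have o2 := hΦ.opp_tri (tri_comm_right p q r).symm hp.1 (tri_perm hrp).2.1 (by grind)
  have o3 := hΦ.opp_tri (tri_rotate p q r).symm hp.2.2.1 hqr (by grind)
  have hk : IsSurrounded Φ (tri q r y) := (hΦ.isSurrounded_iff hqr).2
    ⟨⟨p, by grind, hp.2.2.1⟩, ⟨p, by grind, (tri_perm hrp).1⟩, ⟨x, hxr, h1⟩⟩
  have z1 : charge Φ (tri p q r) s(p, q) = 0 :=
    charge_eq_zero_of_surrounded hS fun _ ↦ by rwa [o1]
  have z2 : charge Φ (tri p q r) s(p, r) = 0 :=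
    charge_eq_zero_of_surrounded hS fun _ ↦ by rwa [o2]
  have z3 : charge Φ (tri p q r) s(q, r) = 0 :=
    charge_eq_zero_of_surrounded hS fun h' ↦ by rw [o3, hk.2] at h'; omega
  have n3 := hΦ.charge_nonneg hqr s(q, r)
  rw [if_pos hS, if_neg hS'] at c1
  rw [tri_comm_right p q r, if_pos hS] at c2
  have c2' : 1 ≤ charge Φ (tri p r y) s(p, r) := by
    rw [c2]
    split_ifs <;> norm_num
  rw [IsBalancedFace, hΦ.sum_tri h, hΦ.sum_tri h, z1, z2, z3, o1, o2, o3, c1]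
  linarith

theorem balanced_of_surrounded {p q r x y : V} (h : tri p q r ∈ Φ) (hqr : tri q r y ∈ Φ)
    (hrp : tri r p y ∈ Φ) (hpq : tri p q x ∈ Φ) (hxr : x ≠ r) : IsBalancedFace Φ (tri p q r) := by
  have f0 := hΦ.facts h
  have f1 := hΦ.facts hqr
  have f2 := hΦ.facts hrp
  have f3 := hΦ.facts hpq
  have hp := tri_perm h
  by_cases hxy : x = y
  · subst hxy
    have n1 := (hΦ.closed_tri3 (w := r) hp.2.2.2.1 (tri_perm hqr).2.1 hrp).1
    have n2 := (hΦ.closed_tri3 (w := p) h (tri_perm hrp).2.1 hpq).1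
    have n3 := (hΦ.closed_tri3 (w := q) hp.2.1 hqr (tri_perm hpq).2.1).1
    have n4 := (hΦ.closed_tri3 (w := x) (tri_perm hpq).2.2.2.1 (tri_perm hqr).2.2.2.1
      (tri_perm hrp).2.2.2.2).1
    obtain ⟨u, hu, z, hz, huz⟩ := hE {p, q, r, x} (by simp)
      (Finset.card_le_four.trans (by norm_num))
    simp only [Finset.mem_insert, Finset.mem_singleton] at hu hz
    grind
  by_cases h1 : tri q y x ∈ Φ
  · exact hΦ.balanced_of_surrounded_of_tri hG hE h hqr hrp hpq hxy hxr h1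
  by_cases h2 : tri p y x ∈ Φ
  · exact (hΦ.balanced_of_surrounded_of_tri hG hE hp.2.1 (tri_perm hrp).2.1 (tri_perm hqr).2.1
      (tri_perm hpq).2.1 hxy hxr h2).of_eq (tri_swap p q r)
  have s1 := hΦ.surrounded_of_not_tri hG h hqr hrp hpq hxy hxr (fun h ↦ h2 (tri_perm h).1)
  have s2 := hΦ.surrounded_of_not_tri hG hp.2.1 (tri_perm hrp).2.1 (tri_perm hqr).2.1
    (tri_perm hpq).2.1 hxy hxr (fun h ↦ h1 (tri_perm h).1)
  have h6 := hΦ.six_le_opp (tri_perm hpq).1 s1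
  have h6' := hΦ.six_le_opp (tri_perm hpq).2.2.1 s2
  have hS : IsSurrounded Φ (tri p q r) := (hΦ.isSurrounded_iff h).2
    ⟨⟨x, hxr, hpq⟩, ⟨y, by grind, hqr⟩, isInner_comm.1 ⟨y, by grind, hrp⟩⟩
  have c1 := hΦ.charge_of_one hpq ⟨r, hxr.symm, h⟩ (hΦ.not_inner_of_six_le (tri_perm hpq).2.2.1 h6')
    (hΦ.not_inner_of_six_le (tri_perm hpq).1 h6)
  have hw : ∀ l, 6 ≤ l → faceWeight l = 5 := fun l hl ↦ by
    unfold faceWeight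
    split_ifs <;> omega
  rw [tri_comm_right] at h6
  rw [tri_rotate] at h6'
  have w : 10 ≤ outerWeight Φ (tri p q x) := by
    rw [outerWeight, hΦ.sum_tri hpq, hw _ h6, hw _ h6']
    have := faceWeight_nonneg (opp Φ (tri p q x) s(p, q)).card
    linarith
  have o1 := hΦ.opp_tri rfl h hpq hxr.symm
  have q1 := hΦ.opp_spec h (tri_edges p q r).2.2.1
  have q2 := hΦ.opp_spec h (tri_edges p q r).2.2.2.2.1
  have n1 := hΦ.charge_nonneg q1.1 s(q, r)
  have n2 := hΦ.charge_nonneg q2.1 s(p, r)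
  have m1 := charge_of_surrounded hS s(p, q)
  have m2 := charge_of_surrounded hS s(q, r)
  have m3 := charge_of_surrounded hS s(p, r)
  rw [IsBalancedFace, hΦ.sum_tri h, hΦ.sum_tri h, o1, c1]
  linarith

theorem balanced_of_three {a b c : V} (h : tri a b c ∈ Φ) (hab : IsInner Φ a b c)
    (hbc : IsInner Φ b c a) (hac : IsInner Φ a c b) : IsBalancedFace Φ (tri a b c) := by
  obtain ⟨x, hx, hx'⟩ := hab
  obtain ⟨y, hy, hy'⟩ := hbc
  obtain ⟨z, hz, hz'⟩ := hac
  have f0 := hΦ.facts h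
  have f1 := hΦ.facts hx'
  have f2 := hΦ.facts hy'
  have f3 := hΦ.facts hz'
  have hp := tri_perm h
  by_cases h1 : y = z
  · subst h1
    exact hΦ.balanced_of_surrounded hG hE h hy' (tri_perm hz').2.1 hx' hx
  by_cases h2 : x = y
  · subst h2
    exact (hΦ.balanced_of_surrounded hG hE hp.1 (tri_perm hy').2.1 (tri_perm hx').2.1 hz' hz).of_eq
      (tri_comm_right a b c)
  by_cases h3 : x = z
  · subst h3
    exact (hΦ.balanced_of_surrounded hG hE hp.2.2.1 (tri_perm hz').2.1 hx' hy' hy).of_eq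
      (tri_rotate a b c)
  exact (hG.false_of_chord a x b y c z (by grind)).elim

theorem balanced {F : Finset (Sym2 V)} (hF : F ∈ Φ) (h3 : F.card = 3) : IsBalancedFace Φ F := by
  obtain ⟨a, b, c, rfl⟩ : ∃ a b c, F = tri a b c := by
    obtain ⟨e, he⟩ := Finset.card_pos.1 (h3 ▸ Nat.succ_pos 2 : 0 < F.card)
    induction e with
    | h a b =>
      obtain ⟨c, hc, -⟩ := hΦ.exists_eq_tri hF he h3
      exact ⟨a, b, c, hc⟩
  have hp := tri_perm hF
  have e1 := tri_comm_right a b c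
  have e2 := tri_rotate a b c
  have two : ∀ {u v w : V}, tri u v w ∈ Φ → ¬ IsInner Φ u v w → IsInner Φ v w u →
      IsInner Φ u w v → IsBalancedFace Φ (tri u v w) := by
    rintro u v w h hi ⟨y, hy, hy'⟩ ⟨x, hx, hx'⟩
    exact hΦ.balanced_of_two hG hE h (tri_perm hx').2.1 (tri_perm hy').2.1 hx hy hi
  by_cases i1 : IsInner Φ a b c <;> by_cases i2 : IsInner Φ b c a <;>
    by_cases i3 : IsInner Φ a c b
  · exact hΦ.balanced_of_three hG hE hF i1 i2 i3
  · exact (two hp.1 i3 (isInner_comm.1 i2) i1).of_eq e1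
  · exact (two hp.2.2.1 i2 (isInner_comm.1 i3) (isInner_comm.1 i1)).of_eq e2
  · exact hΦ.balanced_of_one hF i1 i2 i3
  · exact two hF i1 i2 i3
  · exact (hΦ.balanced_of_one hp.2.2.1 i2 (fun h ↦ i3 (isInner_comm.1 h))
      (fun h ↦ i1 (isInner_comm.1 h))).of_eq e2
  · exact (hΦ.balanced_of_one hp.1 i3 (fun h ↦ i2 (isInner_comm.1 h)) i1).of_eq e1
  · exact hΦ.balanced_of_zero hF i1 i2 i3

omit hG hE in
theorem sum_charge_le {F : Finset (Sym2 V)} (hF : F ∈ Φ) (h3 : F.card ≠ 3) :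
    36 + ∑ e ∈ F, charge Φ F e ≤ 11 * F.card + ∑ e ∈ F, charge Φ (opp Φ F e) e := by
  have h1 : 0 ≤ ∑ e ∈ F, charge Φ (opp Φ F e) e :=
    Finset.sum_nonneg fun e he ↦ hΦ.charge_nonneg (hΦ.opp_spec hF he).1 e
  have h2 : ∑ e ∈ F, charge Φ F e ≤ F.card * faceWeight F.card := by
    rw [← nsmul_eq_mul]
    refine Finset.sum_le_card_nsmul _ _ _ fun e he ↦ ?_
    rw [charge, if_pos h3]
    split_ifs
    exacts [le_rfl, faceWeight_nonneg _]
  have h4 := (hΦ.cycle F hF).three_le_card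
  unfold faceWeight at h2
  rw [if_neg h3] at h2
  split_ifs at h2 with h5 h6
  · rw [h5] at h2 ⊢
    push_cast at h2 ⊢
    linarith
  · rw [h6] at h2 ⊢
    push_cast at h2 ⊢
    linarith
  · have : (6 : ℤ) ≤ F.card := by exact_mod_cast (by omega : 6 ≤ F.card)
    linarith

omit hG hE in
theorem sum_charge_eq : ∑ F ∈ Φ, ∑ e ∈ F, charge Φ F e =
    ∑ F ∈ Φ, ∑ e ∈ F, charge Φ (opp Φ F e) e := by
  rw [Finset.sum_sigma', Finset.sum_sigma']
  have key : ∀ p : (_ : Finset (Sym2 V)) × Sym2 V, p ∈ Φ.sigma (fun F ↦ F) →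
      (⟨opp Φ p.1 p.2, p.2⟩ : (_ : Finset (Sym2 V)) × Sym2 V) ∈ Φ.sigma (fun F ↦ F) := by
    rintro ⟨F, e⟩ hp
    obtain ⟨h1, h2⟩ := Finset.mem_sigma.1 hp
    exact Finset.mem_sigma.2 ⟨(hΦ.opp_spec h1 h2).1, (hΦ.opp_spec h1 h2).2.1⟩
  have inv : ∀ p : (_ : Finset (Sym2 V)) × Sym2 V, p ∈ Φ.sigma (fun F ↦ F) →
      (⟨opp Φ (opp Φ p.1 p.2) p.2, p.2⟩ : (_ : Finset (Sym2 V)) × Sym2 V) = p := by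
    rintro ⟨F, e⟩ hp
    obtain ⟨h1, h2⟩ := Finset.mem_sigma.1 hp
    simp only [hΦ.opp_opp h1 h2]
  refine Finset.sum_bij' (fun p _ ↦ ⟨opp Φ p.1 p.2, p.2⟩) (fun p _ ↦ ⟨opp Φ p.1 p.2, p.2⟩)
    key key inv inv ?_
  rintro ⟨F, e⟩ hp
  obtain ⟨h1, h2⟩ := Finset.mem_sigma.1 hp
  simp only [hΦ.opp_opp h1 h2]

/-- The discharging bound on the number of faces. -/
theorem card_mul_le : 36 * (Φ.card : ℤ) ≤ 11 * ∑ F ∈ Φ, (F.card : ℤ) := by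
  have key : ∀ F ∈ Φ, 36 + ∑ e ∈ F, charge Φ F e ≤
      11 * F.card + ∑ e ∈ F, charge Φ (opp Φ F e) e := by
    intro F hF
    by_cases h3 : F.card = 3
    · have := hΦ.balanced hG hE hF h3
      rw [IsBalancedFace] at this
      rw [h3]
      push_cast
      linarith
    · exact hΦ.sum_charge_le hF h3
  have := Finset.sum_le_sum key
  rw [Finset.sum_add_distrib, Finset.sum_add_distrib, hΦ.sum_charge_eq, ← Finset.mul_sum] at this
  simp only [Finset.sum_const, nsmul_eq_mul] at this
  linarith

end IsFaceSet
end DischargingSum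

section EdgeBound

theorem SimpleGraph.HasPlanarEmbedding.induce {V : Type*} {G : SimpleGraph V}
    (hG : G.HasPlanarEmbedding) (S : Set V) : (G.induce S).HasPlanarEmbedding := by
  obtain ⟨pos, arc, hpos, harc, hdisj⟩ := hG
  refine ⟨fun v ↦ pos v, fun u v ↦ arc u v, hpos.comp Subtype.val_injective, fun u v h ↦ ?_,
    fun u v x y h h' hne ↦ hdisj u v x y h h' fun he ↦ hne ?_⟩
  · obtain ⟨h1, h2, h3, h4, h5, h6⟩ := harc u v h
    exact ⟨h1, h2, h3, h4, h5, fun w ↦ h6 w⟩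
  · exact Sym2.map.injective Subtype.val_injective (by simpa using he)

theorem Theta6Free.induce {V : Type*} {G : SimpleGraph V} (hG : Theta6Free G) (S : Set V) :
    Theta6Free (G.induce S) := fun a b hab h ⟨f, hf⟩ ↦
  hG a b hab h ⟨(Embedding.induce S).toHom.comp f, Subtype.val_injective.comp hf⟩

theorem SimpleGraph.ncard_edgeSet_le_induce_add {V : Type*} [Finite V] {G : SimpleGraph V} {S : Set V}
    {R : Set (Sym2 V)} (h : ∀ a b, G.Adj a b → (a ∈ S ∧ b ∈ S) ∨ s(a, b) ∈ R) :
    G.edgeSet.ncard ≤ (G.induce S).edgeSet.ncard + R.ncard := by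
  have : G.edgeSet ⊆ Sym2.map Subtype.val '' (G.induce S).edgeSet ∪ R := by
    intro e he
    induction e with
    | h a b =>
      rcases h a b he with ⟨ha, hb⟩ | h
      · exact Or.inl ⟨s(⟨a, ha⟩, ⟨b, hb⟩), he, rfl⟩
      · exact Or.inr h
  calc G.edgeSet.ncard ≤ _ := Set.ncard_le_ncard this (Set.toFinite _)
    _ ≤ _ := Set.ncard_union_le _ _
    _ ≤ _ := Nat.add_le_add_right (Set.ncard_image_le (Set.toFinite _)) _

theorem SimpleGraph.ncard_edgeSet_le_induce_add_induce {V : Type*} [Finite V] {G : SimpleGraph V}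
    {S T : Set V} (h : ∀ a b, G.Adj a b → (a ∈ S ∧ b ∈ S) ∨ (a ∈ T ∧ b ∈ T)) :
    G.edgeSet.ncard ≤ (G.induce S).edgeSet.ncard + (G.induce T).edgeSet.ncard := by
  refine (ncard_edgeSet_le_induce_add (R := Sym2.map Subtype.val '' (G.induce T).edgeSet)
    fun a b hab ↦ (h a b hab).imp id ?_).trans
      (Nat.add_le_add_left (Set.ncard_image_le (Set.toFinite _)) _)
  rintro ⟨ha, hb⟩
  exact ⟨s(⟨a, ha⟩, ⟨b, hb⟩), hab, rfl⟩

theorem TwoConnected.expands {V : Type*} [DecidableEq V] [Fintype V] {G : SimpleGraph V}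
    (hG : TwoConnected G) (hV : 6 ≤ Fintype.card V) : Expands G := by
  intro U ⟨u, hu⟩ hU
  obtain ⟨z, hz⟩ : ∃ z, z ∉ U := by
    by_contra! h
    rw [Finset.eq_univ_iff_forall.2 h, Finset.card_univ] at hU
    omega
  obtain ⟨x, hx⟩ : ∃ x, x ∉ ({u, z} : Finset V) := by
    by_contra! h
    have := Finset.card_le_two (a := u) (b := z)
    rw [Finset.eq_univ_iff_forall.2 h, Finset.card_univ] at this
    omega
  obtain ⟨p, -⟩ := hG x u z (by grind) (by grind)
  obtain ⟨d, -, h1, h2⟩ := p.exists_boundary_dart (U : Set V) hu hz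
  exact ⟨_, h1, _, h2, d.adj⟩

theorem sum_card_eq_of_two {V : Type*} [DecidableEq V] {ι : Type*} {E : Finset (Sym2 V)}
    {Φ : Finset ι} {f : ι → Finset (Sym2 V)} (hsub : ∀ F ∈ Φ, f F ⊆ E)
    (h2 : ∀ e ∈ E, (∑ F ∈ Φ, if e ∈ f F then 1 else 0) = 2) :
    ∑ F ∈ Φ, (f F).card = 2 * E.card := by
  have : ∀ F ∈ Φ, (f F).card = ∑ e ∈ E, if e ∈ f F then 1 else 0 := by
    intro F hF
    rw [Finset.sum_boole, Finset.filter_mem_eq_inter, Finset.inter_eq_right.2 (hsub F hF)]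
    rfl
  rw [Finset.sum_congr rfl this, Finset.sum_comm, Finset.sum_congr rfl h2, Finset.sum_const,
    smul_eq_mul, mul_comm]

variable {V : Type*} [DecidableEq V] [Fintype V] {G : SimpleGraph V}

/-- Planar two-connected graphs satisfy the classical bound. -/
theorem ncard_edgeSet_add_six_le (hP : G.HasPlanarEmbedding) (hG : TwoConnected G)
    (hV : 3 ≤ Fintype.card V) : G.edgeSet.ncard + 6 ≤ 3 * Fintype.card V := by
  obtain ⟨D⟩ := hP.nonempty_drawing
  obtain ⟨E, Φ, hE, h⟩ := IsFaceSystem.exists_univ D.isSeparation hG hV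
  have h1 := sum_card_eq_of_two h.subset h.two
  have h2 := Finset.card_nsmul_le_sum Φ (fun F ↦ F.1.card) 3
    fun F hF ↦ (h.cycle F hF).three_le_card
  have h3 := h.euler
  have h4 : G.edgeSet.ncard = E.card := by
    rw [← Set.ncard_coe_finset]
    congr
    ext e
    exact (hE e).symm
  rw [Finset.card_univ] at h3
  rw [smul_eq_mul] at h2
  omega

theorem ncard_edgeSet_le_of_discharging (hP : G.HasPlanarEmbedding) (hF : Theta6Free G)
    (hG : TwoConnected G) (hV : 6 ≤ Fintype.card V)
    (hdeg : ∀ v x y, ∃ z, z ≠ x ∧ z ≠ y ∧ G.Adj v z) :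
    7 * G.edgeSet.ncard + 36 ≤ 18 * Fintype.card V := by
  classical
  obtain ⟨D⟩ := hP.nonempty_drawing
  obtain ⟨Φ, hΦ, h3⟩ := exists_isFaceSet D.isSeparation hG (by omega) hdeg
  have h1 := sum_card_eq_of_two (E := G.edgeFinset) (f := id)
    (fun F hF ↦ fun e he ↦ mem_edgeFinset.2 (hΦ.mem_edgeSet hF he)) (fun e he ↦ by
      have := hΦ.two e (mem_edgeFinset.1 he)
      rw [Finset.card_filter] at this
      exact this)
  have h2 := hΦ.card_mul_le hF (hG.expands hV)
  rw [← Set.ncard_coe_finset, coe_edgeFinset] at h1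
  have h4 : ∑ F ∈ Φ, (F.card : ℤ) = 2 * G.edgeSet.ncard := by exact_mod_cast h1
  rw [h4] at h2
  omega

/-- Six vertices, one of degree two: eleven edges force a theta graph. -/
theorem Theta6Free.ncard_edgeSet_le_of_card_six (hF : Theta6Free G) (hV : Fintype.card V = 6)
    {v x y : V} (hx : G.Adj v x) (hy : G.Adj v y) (hxy : x ≠ y)
    (hv : ∀ z, G.Adj v z → z = x ∨ z = y) : G.edgeSet.ncard ≤ 10 := by
  classical
  by_contra! hlt
  obtain ⟨p, q, r, hpq, hpr, hqr, hpqr⟩ : ∃ p q r, p ≠ q ∧ p ≠ r ∧ q ≠ r ∧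
      Finset.univ \ {v, x, y} = {p, q, r} := by
    rw [← Finset.card_eq_three, Finset.card_sdiff_of_subset (Finset.subset_univ _),
      Finset.card_univ, hV, Finset.card_eq_three.2 ⟨v, x, y, hx.ne, hy.ne, hxy, rfl⟩]
  have hmem : ∀ z, z = p ∨ z = q ∨ z = r ↔ z ≠ v ∧ z ≠ x ∧ z ≠ y := by
    intro z
    simpa using (Finset.ext_iff.1 hpqr z).symm
  have hp := (hmem p).1 (by simp)
  have hq := (hmem q).1 (by simp)
  have hr := (hmem r).1 (by simp)
  have key : ∀ a b c d, a ≠ v → b ≠ v → c ≠ v → d ≠ v → a ≠ b → c ≠ d →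
      ¬ (a = c ∧ b = d) → ¬ (a = d ∧ b = c) → ¬ G.Adj a b → G.Adj c d := by
    intro a b c d ha hb hc hd hab hcd h1 h2 h3
    by_contra h4
    have hM : ({s(v, p), s(v, q), s(v, r), s(a, b), s(c, d)} : Finset (Sym2 V)).card = 5 := by
      rw [Finset.card_insert_of_notMem, Finset.card_insert_of_notMem, Finset.card_insert_of_notMem,
        Finset.card_insert_of_notMem, Finset.card_singleton]
      all_goals simp only [Finset.mem_insert, Finset.mem_singleton, Sym2.eq_iff]; grind
    have hd : Disjoint G.edgeFinset {s(v, p), s(v, q), s(v, r), s(a, b), s(c, d)} := by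
      rw [Finset.disjoint_left]
      intro e he he'
      rw [mem_edgeFinset] at he
      simp only [Finset.mem_insert, Finset.mem_singleton] at he'
      rcases he' with rfl | rfl | rfl | rfl | rfl <;> rw [mem_edgeSet] at he <;> grind
    have hs : G.edgeFinset ∪ {s(v, p), s(v, q), s(v, r), s(a, b), s(c, d)} ⊆
        (⊤ : SimpleGraph V).edgeFinset := by
      intro e he
      rw [mem_edgeFinset]
      simp only [Finset.mem_union, Finset.mem_insert, Finset.mem_singleton] at he
      rcases he with he | rfl | rfl | rfl | rfl | rfl
      · exact edgeSet_mono le_top (mem_edgeFinset.1 he)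
      all_goals rw [mem_edgeSet, top_adj]; grind
    have := Finset.card_le_card hs
    rw [Finset.card_union_of_disjoint hd, hM, card_edgeFinset_top_eq_card_choose_two, hV,
      ← Set.ncard_coe_finset, coe_edgeFinset] at this
    norm_num [Nat.choose] at this
    omega
  have n1 : x ≠ v ∧ y ≠ v := ⟨hx.ne', hy.ne'⟩
  have s1 : G.Adj x v ∧ G.Adj y v := ⟨hx.symm, hy.symm⟩
  have other : ∀ a b, a ≠ v → b ≠ v → a ≠ b → ¬ G.Adj a b → ∀ c d, c ≠ v → d ≠ v → c ≠ d →
      ¬ (a = c ∧ b = d) → ¬ (a = d ∧ b = c) → G.Adj c d :=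
    fun a b ha hb hab h c d hc hd hcd h1 h2 ↦ key a b c d ha hb hc hd hab hcd h1 h2 h
  by_cases hxp : G.Adj x p
  swap
  · have := other x p (by grind) (by grind) (by grind) hxp
    exact hF.false_of_chord x r q p y v (by grind)
  by_cases hry : G.Adj r y
  swap
  · have := other r y (by grind) (by grind) (by grind) hry
    exact hF.false_of_chord x r q p y v (by grind)
  by_cases h1 : G.Adj p q
  swap
  · have := other p q (by grind) (by grind) (by grind) h1
    exact hF.false_of_chord x p r q y v (by grind)
  by_cases h2 : G.Adj q r
  swap
  · have := other q r (by grind) (by grind) (by grind) h2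
    exact hF.false_of_chord x r p q y v (by grind)
  by_cases h3 : G.Adj x q
  · exact hF.false_of_chord x p q r y v (by grind)
  · have := other x q (by grind) (by grind) (by grind) h3 y x
    exact hF.false_of_chord y v x p q r (by grind)

end EdgeBound

section MainInduction

universe u

/-- Seven times the bound on the number of edges of a planar graph on `n` vertices without
theta graphs on six vertices. -/
def edgeBound (n : ℕ) : ℕ :=
  if n ≤ 1 then 0 else if n = 2 then 7 else if n = 3 then 21 else if n = 4 then 42
  else if n = 5 then 63 else 18 * (n - 2)

theorem edgeBound_add_le {s t n : ℕ} (hs : 2 ≤ s) (ht : 2 ≤ t) (h : s + t = n + 1) (hn : 5 ≤ n) :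
    edgeBound s + edgeBound t ≤ edgeBound n := by
  have upper : ∀ m, 2 ≤ m → edgeBound m + 9 ≤ 18 * (m - 1) := fun m hm ↦ by
    unfold edgeBound
    split_ifs <;> omega
  have lower : 18 * (n - 2) ≤ edgeBound n := by
    unfold edgeBound
    split_ifs <;> omega
  have h1 := upper s hs
  have h2 := upper t ht
  omega

theorem edgeBound_of_six_le {n : ℕ} (hn : 6 ≤ n) : edgeBound n = 18 * (n - 2) := by
  unfold edgeBound
  split_ifs <;> omega

theorem exists_separation {V : Type*} {G : SimpleGraph V} (hG : ¬ TwoConnected G) :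
    ∃ (S T : Set V) (x a b : V), S ∪ T = Set.univ ∧ S ∩ T = {x} ∧ a ≠ x ∧ a ∈ S ∧ b ≠ x ∧ b ∈ T ∧
      ∀ u v, G.Adj u v → (u ∈ S ∧ v ∈ S) ∨ (u ∈ T ∧ v ∈ T) := by
  rw [TwoConnected] at hG
  push Not at hG
  obtain ⟨x, a, b, ha, hb, hab⟩ := hG
  set R : V → Prop := fun z ↦ ∃ p : G.Walk a z, x ∉ p.support with hR
  have step : ∀ u v, G.Adj u v → v ≠ x → R u → R v := by
    rintro u v huv hv ⟨p, hp⟩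
    refine ⟨p.concat huv, ?_⟩
    simp [Walk.support_concat, hp, hv.symm]
  refine ⟨{z | z = x ∨ R z}, {z | z = x ∨ ¬ R z}, x, a, b, ?_, ?_, ha, ?_, hb, ?_, ?_⟩
  · ext z
    simp only [Set.mem_union, Set.mem_ofPred_eq, Set.mem_univ, iff_true]
    tauto
  · ext z
    simp only [Set.mem_inter_iff, Set.mem_ofPred_eq, Set.mem_singleton_iff]
    tauto
  · exact Or.inr ⟨Walk.nil, by simpa using ha.symm⟩
  · exact Or.inr fun ⟨p, hp⟩ ↦ hp (hab p)
  · intro u v huv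
    have h1 := step u v huv
    have h2 := step v u huv.symm
    simp only [Set.mem_ofPred_eq]
    tauto

theorem ncard_edgeSet_le_edgeBound (n : ℕ) : ∀ (V : Type u) [Fintype V] (G : SimpleGraph V),
    Fintype.card V = n → G.HasPlanarEmbedding → Theta6Free G →
      7 * G.edgeSet.ncard ≤ edgeBound n := by
  classical
  induction n using Nat.strong_induction_on with
  | _ n ih =>
  intro V _ G hV hP hF
  have ih' : ∀ S : Set V, S.ncard < n → 7 * (G.induce S).edgeSet.ncard ≤ edgeBound S.ncard :=
    fun S hS ↦ ih _ hS S (G.induce S) (by rw [← Nat.card_eq_fintype_card]; rfl)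
      (hP.induce S) (hF.induce S)
  by_cases hn : n ≤ 4
  · have h := card_edgeFinset_le_card_choose_two (G := G)
    rw [← Set.ncard_coe_finset, coe_edgeFinset, hV] at h
    interval_cases n <;> norm_num [Nat.choose] at h <;> simp [edgeBound] <;> omega
  by_cases h2 : TwoConnected G
  swap
  · obtain ⟨S, T, x, a, b, h1, h2, hax, ha, hbx, hb, h3⟩ := exists_separation h2
    have hx : x ∈ S ∩ T := h2 ▸ rfl
    have c := Set.ncard_union_add_ncard_inter S T
    rw [h1, h2, Set.ncard_univ, Nat.card_eq_fintype_card, hV, Set.ncard_singleton] at c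
    have cS : 2 ≤ S.ncard := (Set.one_lt_ncard (Set.toFinite S)).2 ⟨a, ha, x, hx.1, hax⟩
    have cT : 2 ≤ T.ncard := (Set.one_lt_ncard (Set.toFinite T)).2 ⟨b, hb, x, hx.2, hbx⟩
    have e := ncard_edgeSet_le_induce_add_induce h3
    have eS := ih' S (by omega)
    have eT := ih' T (by omega)
    have := edgeBound_add_le cS cT c.symm (by omega)
    omega
  obtain rfl | hn : n = 5 ∨ 6 ≤ n := by omega
  · have := ncard_edgeSet_add_six_le hP h2 (by omega)
    have h5 : edgeBound 5 = 63 := rfl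
    omega
  have hH := edgeBound_of_six_le hn
  by_cases hdeg : ∀ v x y, ∃ z, z ≠ x ∧ z ≠ y ∧ G.Adj v z
  · have := ncard_edgeSet_le_of_discharging hP hF h2 (by omega) hdeg
    omega
  push Not at hdeg
  obtain ⟨v, x, y, hv⟩ := hdeg
  have hc : ({v}ᶜ : Set V).ncard = n - 1 := by
    rw [Set.ncard_compl, Set.ncard_singleton, Nat.card_eq_fintype_card, hV]
  have ihv := ih' {v}ᶜ (by omega)
  rw [hc] at ihv
  have del : ∀ R : Set (Sym2 V), (∀ z, G.Adj v z → s(v, z) ∈ R) →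
      G.edgeSet.ncard ≤ (G.induce {v}ᶜ).edgeSet.ncard + R.ncard := by
    refine fun R hR ↦ ncard_edgeSet_le_induce_add fun a b hab ↦ ?_
    by_cases ha : a = v
    · exact Or.inr (ha ▸ hR b (ha ▸ hab))
    by_cases hb : b = v
    · exact Or.inr (Sym2.eq_swap ▸ hb ▸ hR a (hb ▸ hab.symm))
    exact Or.inl ⟨ha, hb⟩
  have hv' : ∀ z, G.Adj v z → z = x ∨ z = y := fun z hz ↦ by
    by_contra! h
    exact hv z h.1 h.2 hz
  have two := del {s(v, x), s(v, y)} fun z hz ↦ by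
    rcases hv' z hz with rfl | rfl <;> simp
  have hpair : ({s(v, x), s(v, y)} : Set (Sym2 V)).ncard ≤ 2 := by
    rw [← Finset.coe_pair, Set.ncard_coe_finset]
    exact Finset.card_le_two
  obtain rfl | hn : n = 6 ∨ 7 ≤ n := by omega
  · have h5 : edgeBound (6 - 1) = 63 := rfl
    by_cases h : G.Adj v x ∧ G.Adj v y ∧ x ≠ y
    · have := hF.ncard_edgeSet_le_of_card_six hV h.1 h.2.1 h.2.2 hv'
      omega
    · obtain ⟨w, hw⟩ : ∃ w, ∀ z, G.Adj v z → z = w := by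
        by_cases hx : G.Adj v x
        · refine ⟨x, fun z hz ↦ ?_⟩
          grind
        · refine ⟨y, fun z hz ↦ ?_⟩
          grind
      have := del {s(v, w)} fun z hz ↦ by simp [hw z hz]
      rw [Set.ncard_singleton] at this
      omega
  · have hH' := edgeBound_of_six_le (n := n - 1) (by omega)
    omega

end MainInduction

/-- For every `n ≥ 6`, every planar simple graph on `n` vertices containing no member of
`Θ₆` as a subgraph has at most `18(n-2)/7` edges. -/
theorem planar_turan_theta6 (n : ℕ) (hn : 6 ≤ n)
    (V : Type*) [Fintype V] (G : SimpleGraph V) (hcard : Fintype.card V = n)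
    (hplanar : G.HasPlanarEmbedding) (hfree : Theta6Free G) :
    (G.edgeSet.ncard : ℝ) ≤ 18 * ((n : ℝ) - 2) / 7 := by
  have h := ncard_edgeSet_le_edgeBound n V G hcard hplanar hfree
  rw [edgeBound_of_six_le hn] at h
  have h' : 7 * G.edgeSet.ncard + 36 ≤ 18 * n := by omega
  have h'' : (7 * G.edgeSet.ncard + 36 : ℝ) ≤ 18 * n := by exact_mod_cast h'
  linarith
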